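/- arXiv:1710.06535 — 2 statements merged into one kernel-verified Lean document; each statement's English description precedes it below -/
import Mathlib

section
/- Let G be a connected graph on n vertices with chromatic number exactly 5, and let y ≥ 4 be an integer. Then the number of proper colourings of G with y+1 colours satisfies Q_G(y) ≤ (y+1)·y^{n-4}·(y-1)·(y-2)·(y-3). -/
/-- The number of proper colourings of `G` with `x` (labelled) colours. -/
noncomputable def numColorings {V : Type} (G : SimpleGraph V) (x : ℕ) : ℕ :=
  Nat.card {f : V → Fin x // ∀ u v : V, G.Adj u v → f u ≠ f v}

open Classical in
/-- The finset of proper colourings of `G` with colours in `Fin x`. -/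
noncomputable def colorings {V : Type} [Fintype V] (G : SimpleGraph V) (x : ℕ) :
    Finset (V → Fin x) :=
  Finset.univ.filter fun f => ∀ u v, G.Adj u v → f u ≠ f v

theorem mem_colorings {V : Type} [Fintype V] {G : SimpleGraph V} {x : ℕ} {f : V → Fin x} :
    f ∈ colorings G x ↔ ∀ u v, G.Adj u v → f u ≠ f v := by
  simp [colorings]

theorem numColorings_eq_card_colorings {V : Type} [Fintype V] (G : SimpleGraph V) (x : ℕ) :
    numColorings G x = (colorings G x).card := by
  classical
  unfold numColorings
  rw [Nat.card_eq_fintype_card, Fintype.card_of_subtype]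
  intro f
  exact mem_colorings

theorem colorable_iff_exists_fin {V : Type} {G : SimpleGraph V} {x : ℕ} :
    G.Colorable x ↔ ∃ f : V → Fin x, ∀ u v, G.Adj u v → f u ≠ f v := by
  constructor
  · rintro ⟨c⟩
    exact ⟨c, fun u v h => c.valid h⟩
  · rintro ⟨f, hf⟩
    exact ⟨SimpleGraph.Coloring.mk f (fun {u v} h => hf u v h)⟩

theorem SimpleGraph.Connected.exists_adj_dist_lt {V : Type} {G : SimpleGraph V}
    (hG : G.Connected) {r w : V} (h : w ≠ r) : ∃ p, G.Adj w p ∧ G.dist r p < G.dist r w := by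
  obtain ⟨W, hW⟩ := hG.exists_walk_length_eq_dist w r
  cases W with
  | nil => exact absurd rfl h
  | cons hadj W' =>
    refine ⟨_, hadj, ?_⟩
    have := SimpleGraph.dist_le W'
    rw [SimpleGraph.Walk.length_cons] at hW
    rw [SimpleGraph.dist_comm, SimpleGraph.dist_comm (u := r) (v := w)]
    omega

/-- Colourings of a connected graph extend a colouring of part of it in at most `y` ways per
further vertex. -/
theorem card_colorings_le_mul_pow {V U : Type} [Fintype V] [Fintype U] {G : SimpleGraph V}
    {H : SimpleGraph U} (hG : G.Connected) (i : U → V) (hi : Function.Injective i) (u₀ : U)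
    (hH : ∀ a b, H.Adj a b → G.Adj (i a) (i b)) (y : ℕ) :
    (colorings G (y + 1)).card ≤
      (colorings H (y + 1)).card * y ^ (Fintype.card V - Fintype.card U) := by
  classical
  have hex : ∀ w : {w // w ∉ Set.range i}, ∃ p, G.Adj w p ∧
      G.dist (i u₀) p < G.dist (i u₀) w := fun w =>
    hG.exists_adj_dist_lt (fun h => w.2 ⟨u₀, h.symm⟩)
  choose p hp hd using hex
  let F : {f // f ∈ colorings G (y + 1)} → {g // g ∈ colorings H (y + 1)} ×
      ({w // w ∉ Set.range i} → {d : Fin (y + 1) // d ≠ 0}) := fun f =>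
    (⟨f.1 ∘ i, mem_colorings.2 fun a b h => mem_colorings.1 f.2 _ _ (hH a b h)⟩,
      fun w => ⟨f.1 w - f.1 (p w), sub_ne_zero.2 (mem_colorings.1 f.2 _ _ (hp w))⟩)
  have hF : Function.Injective F := by
    intro f g hfg
    have h1 : f.1 ∘ i = g.1 ∘ i := congrArg (fun t => t.1.1) hfg
    have h2 : ∀ w : {w // w ∉ Set.range i}, f.1 w - f.1 (p w) = g.1 w - g.1 (p w) :=
      fun w => congrArg (fun t => (t.2 w).1) hfg
    apply Subtype.ext
    have h3 : ∀ k : ℕ, ∀ w, G.dist (i u₀) w = k → f.1 w = g.1 w := by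
      intro k
      induction k using Nat.strong_induction_on with
      | _ k ih =>
        intro w hw
        by_cases h : w ∈ Set.range i
        · obtain ⟨u, rfl⟩ := h
          exact congrFun h1 u
        · have h4 := h2 ⟨w, h⟩
          have h5 := ih _ (hw ▸ hd ⟨w, h⟩) _ rfl
          rw [h5] at h4
          exact sub_left_injective h4
    funext w
    exact h3 _ w rfl
  have key := Fintype.card_le_of_injective F hF
  have hr : Fintype.card {w // w ∈ Set.range i} = Fintype.card U :=
    Set.card_range_of_injective hi
  rw [Fintype.card_prod, Fintype.card_fun, Fintype.card_coe, Fintype.card_coe,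
    Fintype.card_subtype_compl, Fintype.card_subtype_compl, Fintype.card_subtype_eq,
    Fintype.card_fin, hr] at key
  simpa using key

/-- The simple graph obtained from `H` by identifying the vertices with the same image. -/
def SimpleGraph.merge {U W : Type} (H : SimpleGraph U) (φ : U → W) : SimpleGraph W where
  Adj p q := p ≠ q ∧ ∃ u v, φ u = p ∧ φ v = q ∧ H.Adj u v
  symm := ⟨fun _ _ ⟨h, u, v, hu, hv, ha⟩ => ⟨h.symm, v, u, hv, hu, ha.symm⟩⟩
  loopless := ⟨fun _ h => h.1 rfl⟩

theorem SimpleGraph.Connected.merge {U W : Type} {H : SimpleGraph U} (hH : H.Connected)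
    {φ : U → W} (hφ : Function.Surjective φ) : (H.merge φ).Connected := by
  have hr : ∀ u v, H.Reachable u v → (H.merge φ).Reachable (φ u) (φ v) := by
    rintro u v ⟨p⟩
    induction p with
    | nil => rfl
    | cons h _ ih =>
      refine SimpleGraph.Reachable.trans ?_ ih
      rename_i u v w _
      by_cases he : φ u = φ v
      · rw [he]
      · exact SimpleGraph.Adj.reachable ⟨he, u, v, rfl, rfl, h⟩
  have : Nonempty W := hH.nonempty.map φ
  refine ⟨fun p q => ?_⟩
  obtain ⟨u, rfl⟩ := hφ p
  obtain ⟨v, rfl⟩ := hφ q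
  exact hr u v (hH.preconnected u v)

/-- Two vertices of a connected graph can be identified. -/
theorem SimpleGraph.Connected.exists_identify {U : Type} [Fintype U] {H : SimpleGraph U}
    (hH : H.Connected) {a b : U} (hab : a ≠ b) (hn : ¬ H.Adj a b) :
    ∃ (W : Type) (_ : Fintype W) (K : SimpleGraph W) (φ : U → W),
      K.Connected ∧ Fintype.card W + 1 = Fintype.card U ∧ φ a = φ b ∧
      Function.Surjective φ ∧ (∀ u w, u ≠ b → w ≠ b → φ u = φ w → u = w) ∧
      (∀ (x : ℕ) (f : U → Fin x), f ∈ colorings H x → f a = f b →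
        ∃ g ∈ colorings K x, f = g ∘ φ) ∧
      (∀ (x : ℕ) (g : W → Fin x), g ∈ colorings K x → g ∘ φ ∈ colorings H x) := by
  classical
  let φ : U → {u // u ≠ b} := fun u => if h : u = b then ⟨a, hab⟩ else ⟨u, h⟩
  have hφb : φ b = ⟨a, hab⟩ := by simp [φ]
  have hφ : ∀ u (h : u ≠ b), φ u = ⟨u, h⟩ := fun u h => by simp [φ, h]
  have hsurj : Function.Surjective φ := fun w => ⟨w.1, hφ w.1 w.2⟩
  have hsep : ∀ u v, H.Adj u v → φ u ≠ φ v := by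
    intro u v huv he
    by_cases hu : u = b
    · subst hu
      rw [hφb, hφ v huv.ne'] at he
      have : a = v := congrArg Subtype.val he
      exact hn (this ▸ huv.symm)
    · by_cases hv : v = b
      · subst hv
        rw [hφb, hφ u hu] at he
        have : u = a := congrArg Subtype.val he
        exact hn (this ▸ huv)
      · rw [hφ u hu, hφ v hv] at he
        exact huv.ne (congrArg Subtype.val he)
  refine ⟨_, inferInstance, H.merge φ, φ, hH.merge hsurj, ?_, ?_, hsurj, ?_, ?_, ?_⟩
  · have := Fintype.card_pos_iff.2 ⟨a⟩
    rw [Fintype.card_subtype_compl, Fintype.card_subtype_eq]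
    omega
  · rw [hφb, hφ a hab]
  · intro u w hu hw he
    rw [hφ u hu, hφ w hw] at he
    exact congrArg Subtype.val he
  · intro x f hf he
    have hfφ : f = (fun w : {u // u ≠ b} => f w.1) ∘ φ := by
      funext u
      by_cases hu : u = b
      · subst hu
        simp [hφb, he]
      · simp [hφ u hu]
    refine ⟨fun w => f w.1, ?_, hfφ⟩
    rw [mem_colorings]
    rintro p q ⟨-, u, v, rfl, rfl, huv⟩
    have h1 := congrFun hfφ u
    have h2 := congrFun hfφ v
    simp only [Function.comp] at h1 h2
    rw [← h1, ← h2]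
    exact mem_colorings.1 hf u v huv
  · intro x g hg
    rw [mem_colorings] at hg ⊢
    intro u v huv
    exact hg _ _ ⟨hsep u v huv, u, v, rfl, rfl, huv⟩

/-- Tomescu's bound on the number of colourings with `y + 1` colours of a connected graph
on `n` vertices that is not `4`-colourable. -/
def tomescuBound (y n : ℕ) : ℕ :=
  if n < 5 then 0 else (y + 1) * y ^ (n - 4) * (y - 1) * (y - 2) * (y - 3)

theorem tomescuBound_of_le {n : ℕ} (y : ℕ) (hn : 5 ≤ n) :
    tomescuBound y n = (y + 1) * y ^ (n - 4) * (y - 1) * (y - 2) * (y - 3) := by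
  simp [tomescuBound, Nat.not_lt.2 hn]

theorem tomescuBound_add {n : ℕ} (y k : ℕ) (hn : 5 ≤ n) :
    tomescuBound y (n + k) = tomescuBound y n * y ^ k := by
  rw [tomescuBound_of_le y hn, tomescuBound_of_le y (by omega),
    show n + k - 4 = (n - 4) + k by omega, pow_add]
  ring

theorem mul_tomescuBound_le (y n : ℕ) : y * tomescuBound y n ≤ tomescuBound y (n + 1) := by
  by_cases hn : 5 ≤ n
  · rw [tomescuBound_add y 1 hn, pow_one, mul_comm]
  · simp [tomescuBound, show n < 5 by omega]

/-- The bound holds for all connected graphs that are not `4`-colourable and have fewer than `N`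
vertices. -/
def BoundHolds (y N : ℕ) : Prop :=
  ∀ (W : Type) [Fintype W] (H : SimpleGraph W), H.Connected → ¬ H.Colorable 4 →
    Fintype.card W < N → (colorings H (y + 1)).card ≤ tomescuBound y (Fintype.card W)

theorem five_le_card_of_not_colorable {W : Type} [Fintype W] {H : SimpleGraph W}
    (h : ¬ H.Colorable 4) : 5 ≤ Fintype.card W := by
  by_contra hlt
  exact h (H.colorable_of_fintype.mono (by omega))

theorem BoundHolds.card_filter_le {y N : ℕ} (hN : BoundHolds y N) {U : Type} [Fintype U]
    {H : SimpleGraph U} (hH : H.Connected) (h4 : ¬ H.Colorable 4) (hU : Fintype.card U ≤ N)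
    {a b : U} (hab : a ≠ b) :
    ((colorings H (y + 1)).filter fun f => f a = f b).card ≤
      tomescuBound y (Fintype.card U - 1) := by
  classical
  by_cases hadj : H.Adj a b
  · rw [Finset.filter_false_of_mem]
    · simp
    · intro f hf
      exact mem_colorings.1 hf a b hadj
  · obtain ⟨W, _, K, φ, hK, hcard, -, -, -, hfac, hlift⟩ := hH.exists_identify hab hadj
    have hK4 : ¬ K.Colorable 4 := by
      rw [colorable_iff_exists_fin]
      rintro ⟨g, hg⟩
      exact h4 (colorable_iff_exists_fin.2
        ⟨g ∘ φ, mem_colorings.1 (hlift 4 g (mem_colorings.2 hg))⟩)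
    have h1 := hN W K hK hK4 (by omega)
    rw [show Fintype.card W = Fintype.card U - 1 by omega] at h1
    refine le_trans ?_ h1
    refine (Finset.card_le_card (t := (colorings K (y + 1)).image (fun g => g ∘ φ)) ?_).trans
      Finset.card_image_le
    intro f hf
    rw [Finset.mem_filter] at hf
    obtain ⟨g, hg, rfl⟩ := hfac _ f hf.1 hf.2
    exact Finset.mem_image_of_mem _ hg

/-- A minimal counterexample to the bound. -/
structure IsMinCounterexample {V : Type} [Fintype V] (G : SimpleGraph V) (y : ℕ) : Prop where
  connected : G.Connected
  not_colorable : ¬ G.Colorable 4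
  boundHolds : BoundHolds y (Fintype.card V)
  lt_card : tomescuBound y (Fintype.card V) < (colorings G (y + 1)).card

namespace IsMinCounterexample

variable {V : Type} [Fintype V] {G : SimpleGraph V} {y : ℕ}

theorem exists_coloring (hG : IsMinCounterexample G y) {S : Set V} (hS : S ≠ Set.univ) :
    ∃ g : V → Fin 4, ∀ u ∈ S, ∀ w ∈ S, G.Adj u w → g u ≠ g w := by
  classical
  suffices h : (G.induce S).Colorable 4 by
    obtain ⟨g, hg⟩ := colorable_iff_exists_fin.1 h
    refine ⟨fun u => if h : u ∈ S then g ⟨u, h⟩ else 0, fun u hu w hw huw => ?_⟩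
    simpa [hu, hw] using hg ⟨u, hu⟩ ⟨w, hw⟩ huw
  by_contra h
  rw [SimpleGraph.colorable_iff_forall_connectedComponent] at h
  push Not at h
  obtain ⟨c, hc⟩ := h
  have hconn := c.connected_toSimpleGraph
  obtain ⟨u₀⟩ := hconn.nonempty
  let i : c → V := fun u => u.1.1
  have hi : Function.Injective i := fun a b h => Subtype.ext (Subtype.ext h)
  obtain ⟨v, hv⟩ := (Set.ne_univ_iff_exists_notMem S).1 hS
  have hlt : Fintype.card c < Fintype.card V :=
    Fintype.card_lt_of_injective_of_notMem i hi (b := v) (by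
      rintro ⟨u, rfl⟩
      exact hv u.1.2)
  have h5 := five_le_card_of_not_colorable hc
  have h1 := hG.boundHolds _ _ hconn hc hlt
  have h2 := card_colorings_le_mul_pow (H := c.toSimpleGraph) hG.connected i hi u₀
    (fun a b hab => hab) y
  have h3 := hG.lt_card
  rw [show Fintype.card V = Fintype.card c + (Fintype.card V - Fintype.card c) by omega,
    tomescuBound_add y _ h5] at h3
  have h4 := Nat.mul_le_mul_right (y ^ (Fintype.card V - Fintype.card c)) h1
  omega

/-- Any `4`-colouring of `G - v` uses all colours around `v`. -/
theorem exists_adj_eq (hG : IsMinCounterexample G y) (v : V) (g : V → Fin 4)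
    (hg : ∀ u, u ≠ v → ∀ w, w ≠ v → G.Adj u w → g u ≠ g w) (c : Fin 4) :
    ∃ u, G.Adj v u ∧ g u = c := by
  classical
  by_contra! h
  refine hG.not_colorable (colorable_iff_exists_fin.2 ⟨Function.update g v c, ?_⟩)
  intro u w huw
  by_cases hu : u = v
  · subst hu
    rw [Function.update_self, Function.update_of_ne huw.ne']
    exact (h w huw).symm
  · by_cases hw : w = v
    · subst hw
      rw [Function.update_self, Function.update_of_ne huw.ne]
      exact h u huw.symm
    · rw [Function.update_of_ne hu, Function.update_of_ne hw]
      exact hg u hu w hw huw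

theorem four_le_degree (hG : IsMinCounterexample G y) [DecidableRel G.Adj] (v : V) :
    4 ≤ G.degree v := by
  classical
  obtain ⟨g, hg⟩ := hG.exists_coloring (S := {v}ᶜ) (by simp)
  have h := hG.exists_adj_eq v g hg
  have h1 : (G.neighborFinset v).image g = Finset.univ := by
    ext c
    obtain ⟨u, hu, rfl⟩ := h c
    simp only [Finset.mem_univ, iff_true]
    exact Finset.mem_image_of_mem _ (by simpa using hu)
  have h2 := Finset.card_image_le (s := G.neighborFinset v) (f := g)
  rw [h1] at h2
  simpa using h2

theorem connected_comap (hG : IsMinCounterexample G y) (v : V) :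
    (G.comap (Subtype.val : {u // u ≠ v} → V)).Connected := by
  classical
  have h4 := hG.four_le_degree v
  have hne : Nonempty {u // u ≠ v} := by
    obtain ⟨u, hu⟩ : (G.neighborFinset v).Nonempty := by
      rw [← Finset.card_pos]
      exact lt_of_lt_of_le (by norm_num) h4
    exact ⟨u, ((G.mem_neighborFinset v u).1 hu).ne'⟩
  refine ⟨fun p q => ?_⟩
  by_contra hpq
  set H := G.comap (Subtype.val : {u // u ≠ v} → V) with hH
  let A : Set V := {u | ∃ h : u ≠ v, H.Reachable p ⟨u, h⟩}
  have hpA : p.1 ∈ A := ⟨p.2, SimpleGraph.Reachable.refl _⟩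
  have hqA : q.1 ∉ A := fun ⟨_, h⟩ => hpq h
  have hvA : v ∉ A := fun ⟨h, _⟩ => h rfl
  have hcut : ∀ u ∈ A, ∀ w, w ∉ A → G.Adj u w → w = v := by
    rintro u ⟨hu, hr⟩ w hw huw
    by_contra hwv
    exact hw ⟨hwv, hr.trans (SimpleGraph.Adj.reachable (G := H) (v := ⟨w, hwv⟩) huw)⟩
  obtain ⟨f₁, hf₁⟩ := hG.exists_coloring (S := insert v A) (fun h => by
    have : q.1 ∈ insert v A := h ▸ Set.mem_univ _
    exact this.elim q.2 hqA)
  obtain ⟨f₂, hf₂⟩ := hG.exists_coloring (S := Aᶜ) (fun h => by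
    have : p.1 ∈ Aᶜ := h ▸ Set.mem_univ _
    exact this hpA)
  let σ := Equiv.swap (f₁ v) (f₂ v)
  have hσ : ∀ u ∈ A, ∀ w, w ∉ A → G.Adj u w → σ (f₁ u) ≠ f₂ w := by
    intro u hu w hw huw he
    obtain rfl := hcut u hu w hw huw
    have h1 : σ (f₁ w) = f₂ w := Equiv.swap_apply_left _ _
    exact hf₁ u (Or.inr hu) w (Or.inl rfl) huw (σ.injective (he.trans h1.symm))
  refine hG.not_colorable (colorable_iff_exists_fin.2
    ⟨fun u => if u ∈ A then σ (f₁ u) else f₂ u, ?_⟩)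
  intro u w huw
  by_cases hu : u ∈ A <;> by_cases hw : w ∈ A <;> simp only [hu, hw, if_true, if_false]
  · exact fun he => hf₁ u (Or.inr hu) w (Or.inr hw) huw (σ.injective he)
  · exact hσ u hu w hw huw
  · exact (hσ w hw u hu huw.symm).symm
  · exact hf₂ u hu w hw huw

end IsMinCounterexample

theorem two_mul_card_le_image_add_offDiag {V α : Type*} [DecidableEq V] [DecidableEq α]
    (A : Finset V) (f : V → α) :
    2 * A.card ≤ 2 * (A.image f).card + (A.offDiag.filter fun p => f p.1 = f p.2).card := by
  induction A using Finset.induction_on with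
  | empty => simp
  | insert a A ha ih =>
    rw [Finset.card_insert_of_notMem ha, Finset.image_insert]
    have hsub : (A.offDiag.filter fun p => f p.1 = f p.2) ⊆
        ((insert a A).offDiag.filter fun p => f p.1 = f p.2) := by
      apply Finset.filter_subset_filter
      exact Finset.offDiag_mono (Finset.subset_insert _ _)
    by_cases h : f a ∈ A.image f
    · rw [Finset.insert_eq_of_mem h]
      obtain ⟨b, hb, hab⟩ := Finset.mem_image.1 h
      have hne : b ≠ a := fun h => ha (h ▸ hb)
      have h1 : insert (a, b) (insert (b, a) (A.offDiag.filter fun p => f p.1 = f p.2)) ⊆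
          ((insert a A).offDiag.filter fun p => f p.1 = f p.2) := by
        intro p hp
        rw [Finset.mem_insert, Finset.mem_insert] at hp
        rcases hp with rfl | rfl | hp
        · simp [hb, hab, hne.symm]
        · simp [hb, hab, hne]
        · exact hsub hp
      have h2 := Finset.card_le_card h1
      rw [Finset.card_insert_of_notMem (by simp [ha, hne.symm]),
        Finset.card_insert_of_notMem (by simp [ha])] at h2
      omega
    · rw [Finset.card_insert_of_notMem h]
      have := Finset.card_le_card hsub
      omega

theorem card_compl_triple_le {y : ℕ} (hy : 2 ≤ y) (p q r : Fin (y + 1)) :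
    (({p, q, r} : Finset (Fin (y + 1)))ᶜ).card ≤
      (y - 2) + (if p = q then 1 else 0) + (if p = r then 1 else 0) + (if q = r then 1 else 0) := by
  rw [Finset.card_compl, Fintype.card_fin]
  by_cases h1 : p = q
  · subst h1
    by_cases h2 : p = r
    · subst h2
      simp
      omega
    · simp [h2]
      omega
  · by_cases h2 : p = r
    · subst h2
      simp [h1, Ne.symm h1]
      omega
    · by_cases h3 : q = r
      · subst h3
        simp [h1]
        omega
      · rw [Finset.card_eq_three.2 ⟨p, q, r, h1, h2, h3, rfl⟩]
        simp [h1, h2, h3]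

namespace IsMinCounterexample

variable {V : Type} [Fintype V] {G : SimpleGraph V} {y : ℕ}

theorem card_filter_le (hG : IsMinCounterexample G y) {a b : V} (hab : a ≠ b) :
    ((colorings G (y + 1)).filter fun f => f a = f b).card ≤
      tomescuBound y (Fintype.card V - 1) :=
  hG.boundHolds.card_filter_le hG.connected hG.not_colorable le_rfl hab

/-- An improved bound for pairs of nonadjacent vertices with a common neighbour of degree `4`. -/
theorem card_filter_le_of_degree_eq_four (hG : IsMinCounterexample G y) (hy : 4 ≤ y)
    [DecidableRel G.Adj] {v a b : V} (hv : G.degree v = 4) (hva : G.Adj v a) (hvb : G.Adj v b)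
    (hab : a ≠ b) (hadj : ¬ G.Adj a b) :
    ((colorings G (y + 1)).filter fun f => f a = f b).card ≤
      (y - 2) * tomescuBound y (Fintype.card V - 2) +
        3 * tomescuBound y (Fintype.card V - 3) := by
  classical
  obtain ⟨c, d, hcd, hN⟩ : ∃ c d, c ≠ d ∧ ((G.neighborFinset v).erase a).erase b = {c, d} := by
    rw [← Finset.card_eq_two, Finset.card_erase_of_mem, Finset.card_erase_of_mem,
      SimpleGraph.card_neighborFinset_eq_degree, hv]
    · simpa
    · simp [hab.symm, hvb]
  have hc : c ∈ ((G.neighborFinset v).erase a).erase b := by simp [hN]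
  have hd : d ∈ ((G.neighborFinset v).erase a).erase b := by simp [hN]
  simp only [Finset.mem_erase, SimpleGraph.mem_neighborFinset] at hc hd
  obtain ⟨hcb, hca, hvc⟩ := hc
  obtain ⟨hdb, hda, hvd⟩ := hd
  have hmem : ∀ u, G.Adj v u → u = a ∨ u = b ∨ u = c ∨ u = d := by
    intro u hu
    by_contra! h
    have : u ∈ ((G.neighborFinset v).erase a).erase b := by simp [h.1, h.2.1, hu]
    rw [hN] at this
    simp [h.2.2.1, h.2.2.2] at this
  have hH := hG.connected_comap v
  set H := G.comap (Subtype.val : {u // u ≠ v} → V) with hHdef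
  obtain ⟨W, _, K, φ, hK, hcard, hφab, -, hinj, hfac, hlift⟩ :=
    hH.exists_identify (a := ⟨a, hva.ne'⟩) (b := ⟨b, hvb.ne'⟩)
      (fun h => hab (congrArg Subtype.val h)) hadj
  let ψ : V → W := fun u => if h : u ≠ v then φ ⟨u, h⟩ else φ ⟨a, hva.ne'⟩
  have hψ : ∀ u (h : u ≠ v), ψ u = φ ⟨u, h⟩ := fun u h => by simp [ψ, h]
  have hψab : ψ a = ψ b := by rw [hψ a hva.ne', hψ b hvb.ne', hφab]
  have hψne : ∀ u w, u ≠ v → w ≠ v → u ≠ b → w ≠ b → u ≠ w → ψ u ≠ ψ w := by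
    intro u w hu hw hub hwb huw he
    rw [hψ u hu, hψ w hw] at he
    exact huw (congrArg Subtype.val (hinj _ _ (fun h => hub (congrArg Subtype.val h))
      (fun h => hwb (congrArg Subtype.val h)) he))
  rw [Fintype.card_subtype_compl, Fintype.card_subtype_eq] at hcard
  have hK4 : ¬ K.Colorable 4 := by
    rw [colorable_iff_exists_fin]
    rintro ⟨g, hg⟩
    have h1 := mem_colorings.1 (hlift 4 g (mem_colorings.2 hg))
    have h2 := hG.exists_adj_eq v (g ∘ ψ) (by
      intro u hu w hw huw
      simp only [Function.comp, hψ u hu, hψ w hw]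
      exact h1 ⟨u, hu⟩ ⟨w, hw⟩ huw)
    have h3 : (Finset.univ : Finset (Fin 4)) ⊆ {g (ψ a), g (ψ c), g (ψ d)} := by
      intro k _
      obtain ⟨u, hu, rfl⟩ := h2 k
      rcases hmem u hu with rfl | rfl | rfl | rfl <;> simp [hψab]
    have h4 := (Finset.card_le_card h3).trans Finset.card_le_three
    simp at h4
  have hW5 := five_le_card_of_not_colorable hK4
  have hcol := hG.boundHolds W K hK hK4 (by omega)
  let E : (W → Fin (y + 1)) → Finset (Fin (y + 1)) := fun g => {g (ψ a), g (ψ c), g (ψ d)}ᶜ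
  let F : (Σ _ : W → Fin (y + 1), Fin (y + 1)) → V → Fin (y + 1) :=
    fun s => Function.update (s.1 ∘ ψ) v s.2
  have h1 : ((colorings G (y + 1)).filter fun f => f a = f b) ⊆
      ((colorings K (y + 1)).sigma E).image F := by
    intro f hf
    rw [Finset.mem_filter, mem_colorings] at hf
    obtain ⟨hf, hfab⟩ := hf
    obtain ⟨g, hg, hfg⟩ := hfac (y + 1) (fun u => f u.1)
      (mem_colorings.2 fun u w huw => hf _ _ huw) hfab
    have hfg' : ∀ u, u ≠ v → f u = g (ψ u) := fun u hu => by
      rw [hψ u hu]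
      exact congrFun hfg ⟨u, hu⟩
    refine Finset.mem_image.2 ⟨⟨g, f v⟩, ?_, ?_⟩
    · simp only [Finset.mem_sigma, hg, true_and, E, Finset.mem_compl, Finset.mem_insert,
        Finset.mem_singleton, ← hfg' a hva.ne', ← hfg' c hvc.ne', ← hfg' d hvd.ne']
      push Not
      exact ⟨hf v a hva, hf v c hvc, hf v d hvd⟩
    · funext u
      by_cases hu : u = v
      · subst hu
        simp [F]
      · simp [F, hu, hfg' u hu]
  have h2 := (Finset.card_le_card h1).trans Finset.card_image_le
  rw [Finset.card_sigma] at h2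
  have hpair : ∀ p q : W, p ≠ q → (∑ g ∈ colorings K (y + 1), if g p = g q then 1 else 0) ≤
      tomescuBound y (Fintype.card W - 1) := by
    intro p q hpq
    rw [← Finset.card_filter]
    exact hG.boundHolds.card_filter_le hK hK4 (by omega) hpq
  have h3 : ∑ g ∈ colorings K (y + 1), (E g).card ≤
      ∑ g ∈ colorings K (y + 1), ((y - 2) + (if g (ψ a) = g (ψ c) then 1 else 0) +
        (if g (ψ a) = g (ψ d) then 1 else 0) + (if g (ψ c) = g (ψ d) then 1 else 0)) :=
    Finset.sum_le_sum fun g _ => card_compl_triple_le (by omega) _ _ _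
  rw [Finset.sum_add_distrib, Finset.sum_add_distrib, Finset.sum_add_distrib, Finset.sum_const,
    smul_eq_mul] at h3
  have h4 := hpair _ _ (hψne a c hva.ne' hvc.ne' hab hcb hca.symm)
  have h5 := hpair _ _ (hψne a d hva.ne' hvd.ne' hab hdb hda.symm)
  have h6 := hpair _ _ (hψne c d hvc.ne' hvd.ne' hcb hdb hcd)
  have h7 := Nat.mul_le_mul_right (y - 2) hcol
  rw [show Fintype.card W = Fintype.card V - 2 by omega] at h7
  rw [show Fintype.card W - 1 = Fintype.card V - 3 by omega] at h4 h5 h6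
  rw [mul_comm (tomescuBound _ _)] at h7
  omega

end IsMinCounterexample

theorem card_image_le_fin {V : Type} {x : ℕ} (A : Finset V) (f : V → Fin x) :
    ((A.image f).card : ℝ) ≤ x := by
  have := Finset.card_le_univ (A.image f)
  rw [Fintype.card_fin] at this
  exact_mod_cast this

theorem card_image_lt_of_mem_colorings {V : Type} [Fintype V] {x : ℕ}
    {G : SimpleGraph V} {f : V → Fin x}
    (hf : f ∈ colorings G x) {w : V} {A : Finset V} (hA : ∀ u ∈ A, G.Adj w u) :
    f w ∉ A.image f ∧ ((A.image f).card : ℝ) < x := by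
  have h1 : f w ∉ A.image f := by
    intro h
    obtain ⟨u, hu, he⟩ := Finset.mem_image.1 h
    exact mem_colorings.1 hf w u (hA u hu) he.symm
  refine ⟨h1, ?_⟩
  have := Finset.card_lt_univ_of_notMem h1
  rw [Fintype.card_fin] at this
  exact_mod_cast this

open Classical in
/-- The probability with which a vertex gets the colour `f w` when that colour is sampled
uniformly among those not used by `f` on `A`. -/
noncomputable def sampleWeight {V : Type} {x : ℕ} (A : Finset V) (w : V) (f : V → Fin x) : ℝ :=
  if f w ∈ A.image f then 0 else ((x : ℝ) - (A.image f).card)⁻¹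

theorem sampleWeight_nonneg {V : Type} {x : ℕ} (A : Finset V) (w : V) (f : V → Fin x) :
    0 ≤ sampleWeight A w f := by
  unfold sampleWeight
  split_ifs
  · exact le_rfl
  · exact inv_nonneg.2 (sub_nonneg.2 (card_image_le_fin A f))

theorem image_update_of_notMem {V : Type} [DecidableEq V] {x : ℕ} {A : Finset V} {a : V}
    (ha : a ∉ A) (f : V → Fin x) (c : Fin x) :
    A.image (Function.update f a c) = A.image f :=
  Finset.image_congr fun u hu => Function.update_of_ne (by rintro rfl; exact ha hu) _ _

theorem sampleWeight_update {V : Type} [DecidableEq V] {x : ℕ} {A : Finset V} {a w : V}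
    (ha : a ∉ A) (haw : w ≠ a) (f : V → Fin x)
    (c : Fin x) : sampleWeight A w (Function.update f a c) = sampleWeight A w f := by
  simp only [sampleWeight, image_update_of_notMem ha, Function.update_of_ne haw]

section Sampling

variable {V : Type} [Fintype V] [DecidableEq V] {x : ℕ}

theorem sum_sum_update (w : V) (F : (V → Fin x) → ℝ) :
    ∑ f, ∑ c, F (Function.update f w c) = x * ∑ f, F f := by
  let e : (V → Fin x) × Fin x → (V → Fin x) × Fin x :=
    fun p => (Function.update p.1 w p.2, p.1 w)
  have he : Function.Involutive e := fun p => by simp [e]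
  have h := Equiv.sum_comp he.toPerm (fun p => F p.1)
  rw [Fintype.sum_prod_type, Fintype.sum_prod_type] at h
  simpa [e, Finset.mul_sum] using h

theorem sum_sampleWeight_update_le {A : Finset V} {a : V} (ha : a ∉ A) (f : V → Fin x) :
    ∑ c, sampleWeight A a (Function.update f a c) ≤ 1 := by
  simp only [sampleWeight, image_update_of_notMem ha, Function.update_self]
  rw [Finset.sum_ite, Finset.sum_const_zero, zero_add, Finset.sum_const, nsmul_eq_mul]
  have : (Finset.univ.filter fun c => c ∉ A.image f) = (A.image f)ᶜ := by
    ext c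
    simp
  rw [this, Finset.card_compl, Fintype.card_fin, Nat.cast_sub (by
    exact_mod_cast card_image_le_fin A f)]
  exact mul_inv_le_one

theorem sum_prod_sampleWeight_le {n : ℕ} (σ : V ≃ Fin n) (A : V → Finset V)
    (hA : ∀ w, ∀ u ∈ A w, σ u < σ w) (s : Finset V) :
    (x : ℝ) ^ s.card * ∑ f : V → Fin x, ∏ w ∈ s, sampleWeight (A w) w f ≤
      (x : ℝ) ^ Fintype.card V := by
  induction s using Finset.induction_on_max_value σ with
  | empty => simp
  | insert a s ha hmax ih =>
    have haA : ∀ w ∈ insert a s, a ∉ A w := by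
      intro w hw h
      rcases Finset.mem_insert.1 hw with rfl | hw
      · exact lt_irrefl _ (hA _ _ h)
      · exact absurd (hA _ _ h) (not_lt.2 (hmax w hw))
    refine le_trans ?_ ih
    rw [Finset.card_insert_of_notMem ha, pow_succ, mul_assoc]
    refine mul_le_mul_of_nonneg_left ?_ (by positivity)
    rw [← sum_sum_update a]
    refine Finset.sum_le_sum fun f _ => ?_
    have h1 : ∀ c, ∏ w ∈ insert a s, sampleWeight (A w) w (Function.update f a c) =
        sampleWeight (A a) a (Function.update f a c) * ∏ w ∈ s, sampleWeight (A w) w f := by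
      intro c
      rw [Finset.prod_insert ha]
      congr 1
      refine Finset.prod_congr rfl fun w hw => ?_
      exact sampleWeight_update (haA w (Finset.mem_insert_of_mem hw))
        (fun h => ha (h ▸ hw)) f c
    simp only [h1]
    rw [← Finset.sum_mul]
    exact mul_le_of_le_one_left (Finset.prod_nonneg fun w _ => sampleWeight_nonneg _ _ _)
      (sum_sampleWeight_update_le (haA a (Finset.mem_insert_self _ _)) f)

/-- The entropy bound for sampling a colouring vertex by vertex in the order `σ`. -/
theorem card_mul_log_card_le {G : SimpleGraph V} {n : ℕ} (σ : V ≃ Fin n) (A : V → Finset V)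
    (hA : ∀ w, ∀ u ∈ A w, σ u < σ w) (hAG : ∀ w, ∀ u ∈ A w, G.Adj w u) :
    ((colorings G x).card : ℝ) * Real.log (colorings G x).card ≤
      ∑ f ∈ colorings G x, ∑ w, Real.log ((x : ℝ) - ((A w).image f).card) := by
  set C := colorings G x with hC
  rcases C.eq_empty_or_nonempty with h0 | hne
  · simp [h0]
  have hP : (0 : ℝ) < C.card := by exact_mod_cast hne.card_pos
  have hpos : ∀ f ∈ C, ∀ w, 0 < (x : ℝ) - ((A w).image f).card := fun f hf w =>
    sub_pos.2 (card_image_lt_of_mem_colorings hf (hAG w)).2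
  have hx : 0 < Fintype.card V ∨ Fintype.card V = 0 := (Nat.eq_zero_or_pos _).symm
  have hx1 : (∑ f : V → Fin x, ∏ w, sampleWeight (A w) w f) ≤ 1 := by
    have h := sum_prod_sampleWeight_le (x := x) σ A hA Finset.univ
    rw [Finset.card_univ] at h
    have hxp : (0 : ℝ) < (x : ℝ) ^ Fintype.card V := by
      rcases hx with h0 | h0
      · obtain ⟨f, hf⟩ := hne
        obtain ⟨w⟩ := Fintype.card_pos_iff.1 h0
        have : 0 < x := (f w).pos
        positivity
      · simp [h0]
    nlinarith
  have hC1 : ∑ f ∈ C, ∏ w, ((x : ℝ) - ((A w).image f).card)⁻¹ ≤ 1 := by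
    refine le_trans ?_ hx1
    refine le_trans (le_of_eq ?_) (Finset.sum_le_univ_sum_of_nonneg (s := C)
      (fun f => Finset.prod_nonneg fun w _ => sampleWeight_nonneg (A w) w f))
    refine Finset.sum_congr rfl fun f hf => Finset.prod_congr rfl fun w _ => ?_
    rw [sampleWeight, if_neg (card_image_lt_of_mem_colorings hf (hAG w)).1]
  have hlog : ∀ f ∈ C, Real.log C.card - ∑ w, Real.log ((x : ℝ) - ((A w).image f).card) ≤
      C.card * ∏ w, ((x : ℝ) - ((A w).image f).card)⁻¹ - 1 := by
    intro f hf
    have hpr : 0 < ∏ w, ((x : ℝ) - ((A w).image f).card)⁻¹ :=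
      Finset.prod_pos fun w _ => inv_pos.2 (hpos f hf w)
    have := Real.log_le_sub_one_of_pos (mul_pos hP hpr)
    rw [Real.log_mul hP.ne' hpr.ne', Real.log_prod (fun w _ => (inv_pos.2 (hpos f hf w)).ne')]
      at this
    simpa [Real.log_inv, sub_eq_add_neg] using this
  have := Finset.sum_le_sum hlog
  rw [Finset.sum_sub_distrib, Finset.sum_sub_distrib, ← Finset.mul_sum, Finset.sum_const,
    Finset.sum_const, nsmul_eq_mul, nsmul_eq_mul] at this
  nlinarith

end Sampling

theorem sum_log_le_card_mul_log {ι : Type*} {C : Finset ι} {t : ι → ℝ} {b : ℝ}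
    (ht : ∀ f ∈ C, 0 < t f) (hb : 0 < b) (h : ∑ f ∈ C, t f ≤ C.card * b) :
    ∑ f ∈ C, Real.log (t f) ≤ C.card * Real.log b := by
  have h1 : ∀ f ∈ C, Real.log (t f) ≤ Real.log b + (t f / b - 1) := by
    intro f hf
    have := Real.log_le_sub_one_of_pos (div_pos (ht f hf) hb)
    rw [Real.log_div (ht f hf).ne' hb.ne'] at this
    linarith
  have h2 := Finset.sum_le_sum h1
  rw [Finset.sum_add_distrib, Finset.sum_sub_distrib, ← Finset.sum_div, Finset.sum_const,
    Finset.sum_const, nsmul_eq_mul, nsmul_eq_mul] at h2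
  have h3 : (∑ f ∈ C, t f) / b ≤ C.card := (div_le_iff₀ hb).2 h
  linarith

theorem sum_rank {V : Type} {n : ℕ} (σ : V ≃ Fin n) (T : Finset V) (h : ℕ → ℝ) :
    ∑ t ∈ T, h (T.filter fun u => σ u < σ t).card = ∑ i ∈ Finset.range T.card, h i := by
  have hinj : Set.InjOn (fun t => (T.filter fun u => σ u < σ t).card) T := by
    have key : ∀ s ∈ T, ∀ t, σ s < σ t → (T.filter fun u => σ u < σ s).card <
        (T.filter fun u => σ u < σ t).card := by
      intro s hs t hst
      refine Finset.card_lt_card ⟨?_, ?_⟩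
      · exact Finset.monotone_filter_right _ fun u hu hu' => hu'.trans hst
      · intro hsub
        have := hsub (Finset.mem_filter.2 ⟨hs, hst⟩)
        simp at this
    intro s hs t ht he
    rcases lt_trichotomy (σ s) (σ t) with hlt | heq | hlt
    · exact absurd he (key s hs t hlt).ne
    · exact σ.injective heq
    · exact absurd he (key t ht s hlt).ne'
  rw [← Finset.sum_image (f := h) hinj]
  congr 1
  refine Finset.eq_of_subset_of_card_le ?_ ?_
  · intro i hi
    obtain ⟨t, ht, rfl⟩ := Finset.mem_image.1 hi
    refine Finset.mem_range.2 (Finset.card_lt_card ⟨Finset.filter_subset _ _, fun hsub => ?_⟩)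
    have := hsub ht
    simp at this
  · rw [Finset.card_image_of_injOn hinj, Finset.card_range]

section RandomOrder

variable {V : Type} [Fintype V] [DecidableEq V]

/-- In a uniformly random order, the number of elements of `S` before `w ∉ S` is uniformly
distributed. -/
theorem sum_equiv_card_filter {n : ℕ} {S : Finset V} {w : V} (hw : w ∉ S) (h : ℕ → ℝ) :
    (S.card + 1 : ℝ) * ∑ σ : V ≃ Fin n, h (S.filter fun u => σ u < σ w).card =
      (Fintype.card (V ≃ Fin n) : ℝ) * ∑ i ∈ Finset.range (S.card + 1), h i := by
  set T := insert w S with hT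
  have hTc : T.card = S.card + 1 := Finset.card_insert_of_notMem hw
  have h1 : ∀ t ∈ T, ∑ σ : V ≃ Fin n, h (T.filter fun u => σ u < σ t).card =
      ∑ σ : V ≃ Fin n, h (S.filter fun u => σ u < σ w).card := by
    intro t ht
    refine Fintype.sum_equiv ((Equiv.swap t w).equivCongr (Equiv.refl _)) _ _ fun σ => ?_
    congr 1
    refine Finset.card_bij (fun u _ => Equiv.swap t w u) ?_ ?_ ?_
    · intro u hu
      rw [Finset.mem_filter] at hu
      have hut : u ≠ t := fun h => by simp [h] at hu
      have hsw : Equiv.swap t w u ≠ w := by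
        intro h
        exact hut ((Equiv.swap t w).injective (h.trans (Equiv.swap_apply_left t w).symm))
      refine Finset.mem_filter.2 ⟨?_, ?_⟩
      · have : Equiv.swap t w u ∈ T := by
          by_cases huw : u = w
          · rw [huw, Equiv.swap_apply_right]
            exact ht
          · rw [Equiv.swap_apply_of_ne_of_ne hut huw]
            exact hu.1
        exact (Finset.mem_insert.1 this).resolve_left hsw
      · simpa [Equiv.equivCongr] using hu.2
    · exact fun u _ v _ he => (Equiv.swap t w).injective he
    · intro v hv
      rw [Finset.mem_filter] at hv
      refine ⟨Equiv.swap t w v, Finset.mem_filter.2 ⟨?_, ?_⟩, by simp⟩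
      · by_cases hvt : v = t
        · rw [hvt, Equiv.swap_apply_left]
          exact Finset.mem_insert_self _ _
        · rw [Equiv.swap_apply_of_ne_of_ne hvt (by rintro rfl; exact hw hv.1)]
          exact Finset.mem_insert_of_mem hv.1
      · simpa [Equiv.equivCongr] using hv.2
  have h2 := Finset.sum_congr (rfl : T = T) h1
  rw [Finset.sum_comm, Finset.sum_const, nsmul_eq_mul] at h2
  simp only [sum_rank] at h2
  rw [Finset.sum_const, nsmul_eq_mul, Finset.card_univ, hTc] at h2
  push_cast at h2
  exact h2.symm

/-- The entropy bound averaged over all orders of the vertices. -/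
theorem log_card_colorings_le {x : ℕ} {G : SimpleGraph V} {β : ℝ}
    (hne : (colorings G x).Nonempty)
    (h : ∀ w, ∃ S : Finset V, ∃ b : ℕ → ℝ, (∀ u ∈ S, G.Adj w u) ∧
      (∀ A ⊆ S, 0 < b A.card ∧ ∑ f ∈ colorings G x, ((x : ℝ) - (A.image f).card) ≤
        (colorings G x).card * b A.card) ∧
      ∑ i ∈ Finset.range (S.card + 1), Real.log (b i) ≤ (S.card + 1) * β) :
    Real.log (colorings G x).card ≤ Fintype.card V * β := by
  choose S b hS hb hβ using h
  set C := colorings G x with hC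
  have hP : (0 : ℝ) < C.card := by exact_mod_cast hne.card_pos
  let n := Fintype.card V
  let A : (V ≃ Fin n) → V → Finset V := fun σ w => (S w).filter fun u => σ u < σ w
  have h1 : ∀ σ : V ≃ Fin n, Real.log C.card ≤ ∑ w, Real.log (b w (A σ w).card) := by
    intro σ
    have h2 := card_mul_log_card_le (x := x) (G := G) σ (A σ)
      (fun w u hu => (Finset.mem_filter.1 hu).2)
      (fun w u hu => hS w u (Finset.mem_filter.1 hu).1)
    rw [Finset.sum_comm] at h2
    have h3 : ∀ w, ∑ f ∈ C, Real.log ((x : ℝ) - ((A σ w).image f).card) ≤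
        C.card * Real.log (b w (A σ w).card) := fun w =>
      sum_log_le_card_mul_log
        (fun f hf => sub_pos.2 (card_image_lt_of_mem_colorings hf
          (fun u hu => hS w u (Finset.mem_filter.1 hu).1)).2)
        (hb w _ (Finset.filter_subset _ _)).1 (hb w _ (Finset.filter_subset _ _)).2
    have h4 := h2.trans (Finset.sum_le_sum fun w _ => h3 w)
    rw [← Finset.mul_sum] at h4
    exact le_of_mul_le_mul_left h4 hP
  have hE : (0 : ℝ) < Fintype.card (V ≃ Fin n) := by
    have : Nonempty (V ≃ Fin n) := ⟨Fintype.equivFin V⟩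
    exact_mod_cast Fintype.card_pos
  have h2 := Finset.sum_le_sum fun σ (_ : σ ∈ (Finset.univ : Finset (V ≃ Fin n))) => h1 σ
  rw [Finset.sum_comm, Finset.sum_const, nsmul_eq_mul, Finset.card_univ] at h2
  have h3 : ∀ w, ∑ σ : V ≃ Fin n, Real.log (b w (A σ w).card) ≤
      Fintype.card (V ≃ Fin n) * β := by
    intro w
    have h4 := sum_equiv_card_filter (n := n) (S := S w) (w := w)
      (fun h => (hS w w h).ne rfl) (fun i => Real.log (b w i))
    have h5 := mul_le_mul_of_nonneg_left (hβ w) hE.le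
    rw [← h4] at h5
    have h6 : (0 : ℝ) < (S w).card + 1 := by positivity
    refine le_of_mul_le_mul_left (h5.trans (le_of_eq ?_)) h6
    ring
  have h4 := h2.trans (Finset.sum_le_sum fun w _ => h3 w)
  rw [Finset.sum_const, nsmul_eq_mul, Finset.card_univ] at h4
  refine le_of_mul_le_mul_left (h4.trans (le_of_eq ?_)) hE
  ring

end RandomOrder

theorem sum_sub_card_image_le {V : Type} [Fintype V] {x : ℕ} {C : Finset (V → Fin x)}
    {A : Finset V} {q : ℝ}
    (hq : ∀ a ∈ A, ∀ b ∈ A, a ≠ b → ((C.filter fun f => f a = f b).card : ℝ) ≤ C.card * q) :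
    ∑ f ∈ C, ((x : ℝ) - (A.image f).card) ≤
      C.card * (x - A.card + A.card * (A.card - 1) / 2 * q) := by
  classical
  have h1 : ∀ f ∈ C, (x : ℝ) - (A.image f).card ≤
      x - A.card + 1 / 2 * ∑ p ∈ A.offDiag, if f p.1 = f p.2 then (1 : ℝ) else 0 := by
    intro f _
    have h := two_mul_card_le_image_add_offDiag A f
    rw [Finset.card_filter] at h
    have h' : (2 : ℝ) * A.card ≤ 2 * (A.image f).card +
        ∑ p ∈ A.offDiag, if f p.1 = f p.2 then (1 : ℝ) else 0 := by exact_mod_cast h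
    linarith
  refine (Finset.sum_le_sum h1).trans ?_
  rw [Finset.sum_add_distrib, Finset.sum_const, nsmul_eq_mul, ← Finset.mul_sum, Finset.sum_comm]
  have h2 : ∀ p ∈ A.offDiag, ∑ f ∈ C, (if f p.1 = f p.2 then (1 : ℝ) else 0) ≤ C.card * q := by
    intro p hp
    rw [Finset.mem_offDiag] at hp
    have := hq _ hp.1 _ hp.2.1 hp.2.2
    rw [Finset.card_filter, Nat.cast_sum] at this
    simpa only [Nat.cast_ite, Nat.cast_one, Nat.cast_zero] using this
  have h3 := Finset.sum_le_sum h2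
  rw [Finset.sum_const, nsmul_eq_mul, Finset.offDiag_card, Nat.cast_sub (Nat.le_mul_self _)] at h3
  push_cast at h3
  nlinarith

theorem cast_tomescuBound {y n : ℕ} (hy : 4 ≤ y) (hn : 5 ≤ n) :
    (tomescuBound y n : ℝ) = (y + 1) * (y : ℝ) ^ (n - 4) * (y - 1) * (y - 2) * (y - 3) := by
  rw [tomescuBound_of_le y hn]
  push_cast [Nat.cast_sub (show 1 ≤ y by omega), Nat.cast_sub (show 2 ≤ y by omega),
    Nat.cast_sub (show 3 ≤ y by omega)]
  ring

theorem cast_tomescuBound_le_pow {y n : ℕ} (hy : 4 ≤ y) (hn : 5 ≤ n) :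
    (tomescuBound y n : ℝ) ≤ (y : ℝ) ^ n := by
  rw [cast_tomescuBound hy hn]
  have hy' : (4 : ℝ) ≤ y := by exact_mod_cast hy
  have h1 : (y + 1 : ℝ) * (y - 1) * (y - 2) * (y - 3) ≤ (y : ℝ) ^ 4 := by
    nlinarith [mul_nonneg (sub_nonneg.2 hy') (sub_nonneg.2 hy'),
      mul_nonneg (mul_nonneg (sub_nonneg.2 hy') (sub_nonneg.2 hy')) (sub_nonneg.2 hy')]
  calc (y + 1 : ℝ) * (y : ℝ) ^ (n - 4) * (y - 1) * (y - 2) * (y - 3)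
      = (y : ℝ) ^ (n - 4) * ((y + 1 : ℝ) * (y - 1) * (y - 2) * (y - 3)) := by ring
    _ ≤ (y : ℝ) ^ (n - 4) * (y : ℝ) ^ 4 := mul_le_mul_of_nonneg_left h1 (by positivity)
    _ = (y : ℝ) ^ n := by rw [← pow_add]; congr 1; omega

theorem cast_tomescuBound_pos {y n : ℕ} (hy : 4 ≤ y) (hn : 5 ≤ n) :
    (0 : ℝ) < tomescuBound y n := by
  rw [cast_tomescuBound hy hn]
  have hy' : (4 : ℝ) ≤ y := by exact_mod_cast hy
  have h1 : (0 : ℝ) < y - 1 := by linarith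
  have h2 : (0 : ℝ) < y - 2 := by linarith
  have h3 : (0 : ℝ) < y - 3 := by linarith
  have h4 : (0 : ℝ) < y := by linarith
  positivity

namespace IsMinCounterexample

variable {V : Type} [Fintype V] {G : SimpleGraph V} {y : ℕ}

theorem five_le_card (hG : IsMinCounterexample G y) : 5 ≤ Fintype.card V :=
  five_le_card_of_not_colorable hG.not_colorable

theorem card_filter_le_inv_mul (hG : IsMinCounterexample G y) (hy : 4 ≤ y) {a b : V}
    (hab : a ≠ b) :
    (((colorings G (y + 1)).filter fun f => f a = f b).card : ℝ) ≤
      (colorings G (y + 1)).card * (1 / y) := by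
  have hy' : (0 : ℝ) < y := by exact_mod_cast (by omega : 0 < y)
  have h1 := Nat.mul_le_mul_left y (hG.card_filter_le hab)
  have h2 := mul_tomescuBound_le y (Fintype.card V - 1)
  rw [Nat.sub_add_cancel (by have := hG.five_le_card; omega)] at h2
  have h3 := (h1.trans h2).trans hG.lt_card.le
  rw [mul_one_div, le_div_iff₀ hy', mul_comm]
  exact_mod_cast h3

theorem card_filter_le_of_degree_eq_four' (hG : IsMinCounterexample G y) (hy : 4 ≤ y)
    [DecidableRel G.Adj] {v a b : V} (hv : G.degree v = 4) (hva : G.Adj v a) (hvb : G.Adj v b)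
    (hab : a ≠ b) :
    (((colorings G (y + 1)).filter fun f => f a = f b).card : ℝ) ≤
      (colorings G (y + 1)).card * (((y : ℝ) - 2) / y ^ 2 + 3 / y ^ 3) := by
  have hy' : (0 : ℝ) < y := by exact_mod_cast (by omega : 0 < y)
  have hy4 : (4 : ℝ) ≤ y := by exact_mod_cast hy
  by_cases hadj : G.Adj a b
  · rw [Finset.filter_false_of_mem fun f hf => mem_colorings.1 hf a b hadj]
    have : (0 : ℝ) ≤ y - 2 := by linarith
    simp only [Finset.card_empty, Nat.cast_zero]
    positivity
  · have h0 := hG.card_filter_le_of_degree_eq_four hy hv hva hvb hab hadj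
    have hn := hG.five_le_card
    have h1 := mul_tomescuBound_le y (Fintype.card V - 1)
    have h2 := mul_tomescuBound_le y (Fintype.card V - 2)
    have h3 := mul_tomescuBound_le y (Fintype.card V - 3)
    rw [show Fintype.card V - 1 + 1 = Fintype.card V by omega] at h1
    rw [show Fintype.card V - 2 + 1 = Fintype.card V - 1 by omega] at h2
    rw [show Fintype.card V - 3 + 1 = Fintype.card V - 2 by omega] at h3
    have h4 := hG.lt_card.le
    generalize (colorings G (y + 1)).card = P at *
    generalize ((colorings G (y + 1)).filter fun f => f a = f b).card = N at *
    generalize tomescuBound y (Fintype.card V) = B0 at *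
    generalize tomescuBound y (Fintype.card V - 1) = B1 at *
    generalize tomescuBound y (Fintype.card V - 2) = B2 at *
    generalize tomescuBound y (Fintype.card V - 3) = B3 at *
    have h0' : (N : ℝ) ≤ (y - 2) * B2 + 3 * B3 := by
      rw [← Nat.cast_le (α := ℝ)] at h0
      push_cast [Nat.cast_sub (show 2 ≤ y by omega)] at h0
      exact h0
    have h1' : (y : ℝ) * B1 ≤ P := by exact_mod_cast h1.trans h4
    have h2' : (y : ℝ) * B2 ≤ B1 := by exact_mod_cast h2
    have h3' : (y : ℝ) * B3 ≤ B2 := by exact_mod_cast h3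
    have hB2 : (B2 : ℝ) ≤ P / y ^ 2 := by
      rw [le_div_iff₀ (by positivity)]
      nlinarith
    have hB3 : (B3 : ℝ) ≤ P / y ^ 3 := by
      rw [le_div_iff₀ (by positivity)]
      nlinarith [mul_le_mul_of_nonneg_left h3' (sq_nonneg (y : ℝ)),
        mul_le_mul_of_nonneg_left h2' hy'.le]
    have h5 := mul_le_mul_of_nonneg_left hB2 (show (0 : ℝ) ≤ y - 2 by linarith)
    calc (N : ℝ) ≤ (y - 2) * B2 + 3 * B3 := h0'
      _ ≤ (y - 2) * (P / y ^ 2) + 3 * (P / y ^ 3) := by linarith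
      _ = _ := by ring

theorem false_of_entropy (hG : IsMinCounterexample G y) (hy : 4 ≤ y) {n : ℕ} (hn : 5 ≤ n)
    (hV : n ≤ Fintype.card V)
    (h : ∀ w, ∃ S : Finset V, ∃ q : ℝ, 0 < q ∧ S.card ≤ 5 ∧ (∀ u ∈ S, G.Adj w u) ∧
      (∀ a ∈ S, ∀ b ∈ S, a ≠ b → (((colorings G (y + 1)).filter fun f => f a = f b).card : ℝ) ≤
        (colorings G (y + 1)).card * q) ∧
      (∏ i ∈ Finset.range (S.card + 1), ((y : ℝ) + 1 - i + i * (i - 1) / 2 * q)) ^ n ≤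
        (tomescuBound y n : ℝ) ^ (S.card + 1)) : False := by
  classical
  have hy' : (0 : ℝ) < y := by exact_mod_cast (by omega : 0 < y)
  have hy4 : (4 : ℝ) ≤ y := by exact_mod_cast hy
  have hn' : (0 : ℝ) < n := by exact_mod_cast (by omega : 0 < n)
  have hB := cast_tomescuBound_pos hy hn
  have hP := hG.lt_card
  have hne : (colorings G (y + 1)).Nonempty := Finset.card_pos.1 (by omega)
  have hbpos : ∀ q : ℝ, 0 < q → ∀ i : ℕ, i ≤ 5 → 0 < (y : ℝ) + 1 - i + i * (i - 1) / 2 * q := by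
    intro q hq i hi
    interval_cases i <;> norm_num <;> linarith
  have key : Real.log (colorings G (y + 1)).card ≤
      Fintype.card V * (Real.log (tomescuBound y n) / n) := by
    refine log_card_colorings_le hne fun w => ?_
    obtain ⟨S, q, hq, hS5, hS, hpair, hprod⟩ := h w
    refine ⟨S, fun i => (y : ℝ) + 1 - i + i * (i - 1) / 2 * q, hS, fun A hA => ⟨?_, ?_⟩, ?_⟩
    · exact hbpos q hq _ ((Finset.card_le_card hA).trans hS5)
    · have := sum_sub_card_image_le (C := colorings G (y + 1)) (A := A) (q := q)
        fun a ha b hb => hpair a (hA ha) b (hA hb)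
      push_cast at this ⊢
      exact this
    · have hpos : ∀ i ∈ Finset.range (S.card + 1),
          0 < (y : ℝ) + 1 - i + i * (i - 1) / 2 * q := fun i hi =>
        hbpos q hq i (by have := Finset.mem_range.1 hi; omega)
      rw [← Real.log_prod fun i hi => (hpos i hi).ne', ← mul_div_assoc, le_div_iff₀ hn', mul_comm,
        ← Real.log_pow]
      have := Real.log_le_log (pow_pos (Finset.prod_pos hpos) n) hprod
      refine this.trans (le_of_eq ?_)
      rw [Real.log_pow]
      push_cast
      rfl
  have h1 : Real.log (tomescuBound y n) / n ≤ Real.log y := by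
    rw [div_le_iff₀ hn', mul_comm, ← Real.log_pow]
    exact Real.log_le_log hB (cast_tomescuBound_le_pow hy hn)
  obtain ⟨k, hk⟩ := Nat.exists_eq_add_of_le hV
  have h2 : Real.log (tomescuBound y (Fintype.card V)) < Real.log (colorings G (y + 1)).card :=
    Real.log_lt_log (cast_tomescuBound_pos hy hG.five_le_card) (by exact_mod_cast hP)
  rw [hk, tomescuBound_add y k hn] at h2
  rw [hk] at key
  push_cast at h2 key
  rw [Real.log_mul hB.ne' (pow_pos hy' k).ne', Real.log_pow] at h2
  have h3 := mul_le_mul_of_nonneg_left h1 (Nat.cast_nonneg k : (0 : ℝ) ≤ k)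
  have h4 : (n : ℝ) * (Real.log (tomescuBound y n) / n) = Real.log (tomescuBound y n) := by
    field_simp
  linarith

theorem exists_subset_neighbors [DecidableRel G.Adj] {w : V} {k : ℕ} (hw : k ≤ G.degree w) :
    ∃ S : Finset V, S.card = k ∧ ∀ u ∈ S, G.Adj w u := by
  rw [← SimpleGraph.card_neighborFinset_eq_degree] at hw
  obtain ⟨S, hS, hk⟩ := Finset.exists_subset_card_eq hw
  exact ⟨S, hk, fun u hu => (G.mem_neighborFinset w u).1 (hS hu)⟩

theorem false_of_entropy_of_degree (hG : IsMinCounterexample G y) (hy : 4 ≤ y) {n : ℕ}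
    (hn : 5 ≤ n) (hV : n ≤ Fintype.card V)
    (h4 : (∏ i ∈ Finset.range 5, ((y : ℝ) + 1 - i +
      i * (i - 1) / 2 * (((y : ℝ) - 2) / y ^ 2 + 3 / y ^ 3))) ^ n ≤ (tomescuBound y n : ℝ) ^ 5)
    (h5 : (∏ i ∈ Finset.range 6, ((y : ℝ) + 1 - i + i * (i - 1) / 2 * (1 / y))) ^ n ≤
      (tomescuBound y n : ℝ) ^ 6) : False := by
  classical
  have hy4 : (4 : ℝ) ≤ y := by exact_mod_cast hy
  refine hG.false_of_entropy hy hn hV fun w => ?_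
  rcases (hG.four_le_degree w).eq_or_lt with hw | hw
  · obtain ⟨S, hS, hSw⟩ := exists_subset_neighbors hw.le
    refine ⟨S, ((y : ℝ) - 2) / y ^ 2 + 3 / y ^ 3, ?_, by omega, hSw, ?_, by rwa [hS]⟩
    · have : (0 : ℝ) < y - 2 := by linarith
      positivity
    · intro a ha b hb hab
      exact hG.card_filter_le_of_degree_eq_four' hy hw.symm (hSw a ha) (hSw b hb) hab
  · obtain ⟨S, hS, hSw⟩ := exists_subset_neighbors (Nat.succ_le_of_lt hw)
    refine ⟨S, 1 / y, by positivity, by omega, hSw, ?_, by rwa [hS]⟩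
    exact fun a _ b _ hab => hG.card_filter_le_inv_mul hy hab

theorem card_lt_ten_of_eq_four (hG : IsMinCounterexample G 4) : Fintype.card V < 10 := by
  by_contra! hV
  refine hG.false_of_entropy_of_degree le_rfl (by norm_num) hV ?_ ?_
  · rw [cast_tomescuBound le_rfl (by norm_num)]
    norm_num [Finset.prod_range_succ]
  · rw [cast_tomescuBound le_rfl (by norm_num)]
    norm_num [Finset.prod_range_succ]

theorem card_lt_eight (hG : IsMinCounterexample G y) (hy : 5 ≤ y) : Fintype.card V < 8 := by
  classical
  by_contra! hV
  rcases (by omega : y = 5 ∨ y = 6 ∨ 7 ≤ y) with rfl | rfl | hy7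
  · refine hG.false_of_entropy_of_degree (by norm_num) (by norm_num) hV ?_ ?_
    · rw [cast_tomescuBound (by norm_num) (by norm_num)]
      norm_num [Finset.prod_range_succ]
    · rw [cast_tomescuBound (by norm_num) (by norm_num)]
      norm_num [Finset.prod_range_succ]
  · refine hG.false_of_entropy_of_degree (by norm_num) (by norm_num) hV ?_ ?_
    · rw [cast_tomescuBound (by norm_num) (by norm_num)]
      norm_num [Finset.prod_range_succ]
    · rw [cast_tomescuBound (by norm_num) (by norm_num)]
      norm_num [Finset.prod_range_succ]
  · refine hG.false_of_entropy (by omega) (by norm_num) hV fun w => ?_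
    obtain ⟨S, hS, hSw⟩ := exists_subset_neighbors (hG.four_le_degree w)
    refine ⟨S, 1 / y, by positivity, by omega, hSw, ?_, ?_⟩
    · exact fun a _ b _ hab => hG.card_filter_le_inv_mul (by omega) hab
    · rw [hS, cast_tomescuBound (by omega) (by norm_num)]
      obtain ⟨z, hz⟩ : ∃ z : ℝ, (y : ℝ) = 7 + z := ⟨y - 7, by ring⟩
      have hz0 : 0 ≤ z := by
        have : (7 : ℝ) ≤ y := by exact_mod_cast hy7
        linarith
      rw [hz]
      have h3 : ∏ i ∈ Finset.range (4 + 1), ((7 + z : ℝ) + 1 - i + i * (i - 1) / 2 * (1 / (7 + z))) =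
          (8 + z) * (z ^ 2 + 13 * z + 43) * (z ^ 2 + 12 * z + 38) * (z ^ 2 + 11 * z + 34) /
            (7 + z) ^ 2 := by
        have : (7 + z) ≠ 0 := by positivity
        norm_num [Finset.prod_range_succ]
        field_simp
        ring
      have h1 : (8 + z) * (z ^ 2 + 13 * z + 43) * (z ^ 2 + 12 * z + 38) *
          (z ^ 2 + 11 * z + 34) / (7 + z) ^ 2 ≤ (7 + z) * (6 + z) ^ 4 := by
        rw [div_le_iff₀ (by positivity), ← sub_nonneg]
        ring_nf
        positivity
      have h2 : (7 + z) ^ 2 * (6 + z) ^ 6 ≤ (7 + z + 1) * (7 + z) ^ (8 - 4) * (7 + z - 1) *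
          (7 + z - 2) * (7 + z - 3) := by
        rw [← sub_nonneg]
        ring_nf
        positivity
      rw [h3]
      calc _ ≤ ((7 + z) * (6 + z) ^ 4) ^ 8 := pow_le_pow_left₀ (by positivity) h1 8
        _ = ((7 + z) ^ 8 * (6 + z) ^ 30) * (6 + z) ^ 2 := by ring
        _ ≤ ((7 + z) ^ 8 * (6 + z) ^ 30) * (7 + z) ^ 2 := by
          gcongr
          norm_num
        _ = ((7 + z) ^ 2 * (6 + z) ^ 6) ^ 5 := by ring
        _ ≤ _ := pow_le_pow_left₀ (by positivity) h2 5

end IsMinCounterexample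

theorem card_filter_injective_le {V : Type} [Fintype V] {x : ℕ} (C : Finset (V → Fin x)) :
    (C.filter Function.Injective).card ≤ x.descFactorial (Fintype.card V) := by
  classical
  have h : Fintype.card {f : V → Fin x // Function.Injective f} =
      x.descFactorial (Fintype.card V) := by
    rw [Fintype.card_congr (Equiv.subtypeInjectiveEquivEmbedding V (Fin x)),
      Fintype.card_embedding_eq, Fintype.card_fin]
  rw [← h, Fintype.card_subtype]
  exact Finset.card_le_card (Finset.filter_subset_filter _ (Finset.subset_univ _))

theorem SimpleGraph.card_filter_compl_adj {V : Type} [Fintype V] [DecidableEq V]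
    (G : SimpleGraph V) [DecidableRel G.Adj] (Y : Finset V) :
    ((Finset.univ : Finset (V × V)).filter fun p => Gᶜ.Adj p.1 p.2 ∧ p.1 ∈ Y).card =
      ∑ a ∈ Y, Gᶜ.degree a := by
  simp only [← SimpleGraph.card_neighborFinset_eq_degree]
  rw [← Finset.card_sigma]
  refine Finset.card_bij' (fun p _ => ⟨p.1, p.2⟩) (fun s _ => (s.1, s.2))
    (t := Y.sigma fun a => Gᶜ.neighborFinset a) ?_ ?_ ?_ ?_
  · intro p hp
    have h := (Finset.mem_filter.1 hp).2
    exact Finset.mem_sigma.2 ⟨h.2, (Gᶜ.mem_neighborFinset _ _).2 h.1⟩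
  · intro s hs
    have h := Finset.mem_sigma.1 hs
    exact Finset.mem_filter.2 ⟨Finset.mem_univ _, (Gᶜ.mem_neighborFinset _ _).1 h.2, h.1⟩
  · exact fun _ _ => rfl
  · exact fun _ _ => rfl

theorem descFactorial_five {y : ℕ} (hy : 4 ≤ y) : (y + 1).descFactorial 5 = tomescuBound y 5 := by
  obtain ⟨z, rfl⟩ := Nat.exists_eq_add_of_le hy
  rw [tomescuBound_of_le _ le_rfl]
  simp only [Nat.descFactorial]
  rw [show 4 + z - 1 = z + 3 by omega, show 4 + z - 2 = z + 2 by omega,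
    show 4 + z - 3 = z + 1 by omega, show 4 + z + 1 - 4 = z + 1 by omega,
    show 4 + z + 1 - 3 = z + 2 by omega, show 4 + z + 1 - 2 = z + 3 by omega,
    show 4 + z + 1 - 1 = z + 4 by omega]
  norm_num
  ring

namespace IsMinCounterexample

variable {V : Type} [Fintype V] {G : SimpleGraph V} {y : ℕ}

theorem degree_add_degree_compl [DecidableEq V] [DecidableRel G.Adj] (v : V) :
    G.degree v + Gᶜ.degree v + 1 = Fintype.card V := by
  have h := G.degree_compl v
  have := G.degree_lt_card_verts v
  omega

theorem degree_compl_le (hG : IsMinCounterexample G y) [DecidableEq V] [DecidableRel G.Adj]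
    (v : V) : Gᶜ.degree v + 5 ≤ Fintype.card V := by
  have := hG.four_le_degree v
  have := degree_add_degree_compl (G := G) v
  omega

theorem sum_card_filter_eq [DecidableEq V] [DecidableRel G.Adj] :
    ∑ f ∈ colorings G (y + 1),
        ((Finset.univ : Finset V).offDiag.filter fun p => f p.1 = f p.2).card =
      ∑ p ∈ (Finset.univ : Finset (V × V)).filter (fun p => Gᶜ.Adj p.1 p.2),
        ((colorings G (y + 1)).filter fun f => f p.1 = f p.2).card := by
  simp only [Finset.card_filter]
  rw [Finset.sum_comm]
  symm
  apply Finset.sum_subset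
  · intro p hp
    simpa using (Finset.mem_filter.1 hp).2.ne
  · intro p hp hp'
    have hadj : G.Adj p.1 p.2 := by
      by_contra h
      refine hp' (Finset.mem_filter.2 ⟨Finset.mem_univ _, ?_⟩)
      rw [SimpleGraph.compl_adj]
      exact ⟨(Finset.mem_offDiag.1 hp).2.2, h⟩
    refine Finset.sum_eq_zero fun f hf => if_neg (mem_colorings.1 hf _ _ hadj)

theorem two_mul_card_colorings_le [DecidableEq V] [DecidableRel G.Adj] :
    2 * (colorings G (y + 1)).card ≤ 2 * (y + 1).descFactorial (Fintype.card V) +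
      ∑ p ∈ (Finset.univ : Finset (V × V)).filter (fun p => Gᶜ.Adj p.1 p.2),
        ((colorings G (y + 1)).filter fun f => f p.1 = f p.2).card := by
  classical
  rw [← sum_card_filter_eq]
  have h1 := card_filter_injective_le (colorings G (y + 1))
  have h2 : ∀ f ∈ colorings G (y + 1), 2 ≤ 2 * (if Function.Injective f then 1 else 0) +
      ((Finset.univ : Finset V).offDiag.filter fun p => f p.1 = f p.2).card := by
    intro f _
    by_cases hf : Function.Injective f
    · simp [hf]
    · have h := two_mul_card_le_image_add_offDiag Finset.univ f
      have h3 : (Finset.univ.image f).card < (Finset.univ : Finset V).card := by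
        refine lt_of_le_of_ne Finset.card_image_le fun he => hf ?_
        rw [Finset.card_image_iff] at he
        exact fun a b hab => he (by simp) (by simp) hab
      omega
  have h3 := Finset.sum_le_sum h2
  rw [Finset.sum_const, smul_eq_mul, Finset.sum_add_distrib, ← Finset.mul_sum] at h3
  have h4 : (∑ f ∈ colorings G (y + 1), if Function.Injective f then 1 else 0) ≤
      (y + 1).descFactorial (Fintype.card V) := by
    rw [← Finset.card_filter]
    refine le_trans (le_of_eq ?_) h1
    congr
  omega

theorem mul_card_colorings_le [DecidableEq V] [DecidableRel G.Adj] {k : ℕ}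
    (hk : k + (y + 1) = Fintype.card V) :
    2 * k * (colorings G (y + 1)).card ≤
      ∑ p ∈ (Finset.univ : Finset (V × V)).filter (fun p => Gᶜ.Adj p.1 p.2),
        ((colorings G (y + 1)).filter fun f => f p.1 = f p.2).card := by
  rw [← sum_card_filter_eq, mul_comm, ← smul_eq_mul, ← Finset.sum_const]
  refine Finset.sum_le_sum fun f _ => ?_
  have h := two_mul_card_le_image_add_offDiag Finset.univ f
  have h1 := Finset.card_le_univ (Finset.univ.image f)
  rw [Fintype.card_fin] at h1
  rw [Finset.card_univ] at h
  omega

/-- Two nonadjacent vertices with sufficiently large degrees have a common neighbour of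
degree `4`. -/
theorem exists_common_neighbor [DecidableEq V] [DecidableRel G.Adj] {a b : V}
    (hab : Gᶜ.Adj a b) {k : ℕ}
    (hk : ((Finset.univ.filter fun v => G.degree v ≠ 4).filter
      fun v => G.Adj a v ∧ G.Adj b v).card ≤ k)
    (h : k + Fintype.card V < G.degree a + G.degree b + 2) :
    ∃ v, G.degree v = 4 ∧ G.Adj v a ∧ G.Adj v b := by
  rw [SimpleGraph.compl_adj] at hab
  by_contra! hno
  have h1 : G.neighborFinset a ∩ G.neighborFinset b ⊆
      (Finset.univ.filter fun v => G.degree v ≠ 4).filter fun v => G.Adj a v ∧ G.Adj b v := by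
    intro v hv
    simp only [Finset.mem_inter, SimpleGraph.mem_neighborFinset] at hv
    simp only [Finset.mem_filter, Finset.mem_univ, true_and]
    exact ⟨fun h4 => hno v h4 hv.1.symm hv.2.symm, hv⟩
  have h2 := Finset.card_le_card h1
  have h3 := Finset.card_union_add_card_inter (G.neighborFinset a) (G.neighborFinset b)
  rw [SimpleGraph.card_neighborFinset_eq_degree, SimpleGraph.card_neighborFinset_eq_degree] at h3
  have h4 : G.neighborFinset a ∪ G.neighborFinset b ⊆ ({a, b} : Finset V)ᶜ := by
    intro v hv
    simp only [Finset.mem_union, SimpleGraph.mem_neighborFinset] at hv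
    simp only [Finset.mem_compl, Finset.mem_insert, Finset.mem_singleton]
    rintro (rfl | rfl)
    · exact hv.elim (fun h => h.ne rfl) (fun h => hab.2 h.symm)
    · exact hv.elim (fun h => hab.2 h) (fun h => h.ne rfl)
  have h5 := Finset.card_le_card h4
  rw [Finset.card_compl, Finset.card_pair hab.1] at h5
  have h6 : 2 ≤ Fintype.card V := by
    rw [← Finset.card_pair hab.1]
    exact Finset.card_le_univ _
  omega

theorem sum_degree_compl [DecidableEq V] [DecidableRel G.Adj] :
    ((Finset.univ : Finset (V × V)).filter fun p => Gᶜ.Adj p.1 p.2).card =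
      ∑ a, Gᶜ.degree a := by
  simpa using G.card_filter_compl_adj Finset.univ

theorem card_filter_compl_adj_le (hG : IsMinCounterexample G y) [DecidableEq V]
    [DecidableRel G.Adj] :
    ((Finset.univ : Finset (V × V)).filter fun p => Gᶜ.Adj p.1 p.2).card ≤
      Fintype.card V * (Fintype.card V - 5) := by
  rw [sum_degree_compl, ← Finset.card_univ, ← smul_eq_mul, ← Finset.sum_const]
  refine Finset.sum_le_sum fun v _ => ?_
  have := hG.degree_compl_le v
  rw [Finset.card_univ]
  omega

theorem sum_card_filter_le (hG : IsMinCounterexample G y) [DecidableEq V] [DecidableRel G.Adj] :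
    ∑ p ∈ (Finset.univ : Finset (V × V)).filter (fun p => Gᶜ.Adj p.1 p.2),
        ((colorings G (y + 1)).filter fun f => f p.1 = f p.2).card ≤
      ((Finset.univ : Finset (V × V)).filter fun p => Gᶜ.Adj p.1 p.2).card *
        tomescuBound y (Fintype.card V - 1) := by
  rw [← smul_eq_mul, ← Finset.sum_const]
  refine Finset.sum_le_sum fun p hp => ?_
  exact hG.card_filter_le (Finset.mem_filter.1 hp).2.ne

theorem card_ne_five (hG : IsMinCounterexample G y) (hy : 4 ≤ y) : Fintype.card V ≠ 5 := by
  classical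
  intro hV
  have h1 := two_mul_card_colorings_le (G := G) (y := y)
  have h2 := hG.sum_card_filter_le
  have h3 := hG.lt_card
  have h4 : tomescuBound y 4 = 0 := by simp [tomescuBound]
  rw [hV] at h1 h2 h3
  rw [descFactorial_five hy] at h1
  rw [h4, mul_zero] at h2
  omega

theorem card_ne_six (hG : IsMinCounterexample G y) (hy : 4 ≤ y) : Fintype.card V ≠ 6 := by
  classical
  intro hV
  have h1 := two_mul_card_colorings_le (G := G) (y := y)
  have h2 := hG.sum_card_filter_le
  have h3 := hG.lt_card
  have h4 := hG.card_filter_compl_adj_le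
  rw [hV] at h1 h2 h3 h4
  rw [Nat.descFactorial_succ, descFactorial_five hy] at h1
  rw [tomescuBound_add y 1 (le_refl 5)] at h3
  have h5 := h2.trans (Nat.mul_le_mul_right _ h4)
  obtain ⟨z, rfl⟩ := Nat.exists_eq_add_of_le hy
  rw [show 4 + z + 1 - 5 = z by omega] at h1
  norm_num at h5
  nlinarith

theorem even_card_filter_compl_adj [DecidableEq V] [DecidableRel G.Adj] :
    Even ((Finset.univ : Finset (V × V)).filter fun p => Gᶜ.Adj p.1 p.2).card := by
  rw [sum_degree_compl, Gᶜ.sum_degrees_eq_twice_card_edges]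
  exact even_two_mul _

/-- The sum of `degree - 4` over all vertices is determined by the number of nonadjacent pairs. -/
theorem sum_degree_compl_add (hG : IsMinCounterexample G y) [DecidableEq V] [DecidableRel G.Adj] :
    ((Finset.univ : Finset (V × V)).filter fun p => Gᶜ.Adj p.1 p.2).card +
      ∑ a ∈ Finset.univ.filter (fun v => G.degree v ≠ 4), (G.degree a - 4) =
      Fintype.card V * (Fintype.card V - 5) := by
  have h : ∑ a ∈ Finset.univ.filter (fun v => G.degree v ≠ 4), (G.degree a - 4) =
      ∑ a, (G.degree a - 4) := by
    refine Finset.sum_subset (Finset.subset_univ _) fun a _ ha => ?_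
    have : G.degree a = 4 := by simpa using ha
    omega
  rw [sum_degree_compl, h, ← Finset.sum_add_distrib, ← Finset.card_univ, ← smul_eq_mul,
    ← Finset.sum_const]
  refine Finset.sum_congr rfl fun a _ => ?_
  have h1 := hG.four_le_degree a
  have h2 := degree_add_degree_compl (G := G) a
  rw [Finset.card_univ]
  omega

theorem card_filter_degree_ne_four_le (hG : IsMinCounterexample G y) [DecidableEq V]
    [DecidableRel G.Adj] :
    (Finset.univ.filter fun v => G.degree v ≠ 4).card ≤
      ∑ a ∈ Finset.univ.filter (fun v => G.degree v ≠ 4), (G.degree a - 4) := by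
  rw [Finset.card_eq_sum_ones]
  refine Finset.sum_le_sum fun a ha => ?_
  have h1 := hG.four_le_degree a
  have h2 := (Finset.mem_filter.1 ha).2
  omega

theorem card_ne_seven (hG : IsMinCounterexample G y) (hy : 5 ≤ y) : Fintype.card V ≠ 7 := by
  classical
  intro hV
  have h1 := two_mul_card_colorings_le (G := G) (y := y)
  have h2 := hG.sum_card_filter_le
  have h3 := hG.lt_card
  have h4 := hG.sum_degree_compl_add
  have h6 := hG.card_filter_degree_ne_four_le
  obtain ⟨m, hm⟩ := even_card_filter_compl_adj (G := G)
  rw [hV] at h1 h2 h3 h4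
  rw [Nat.descFactorial_succ, Nat.descFactorial_succ, descFactorial_five (by omega)] at h1
  rw [tomescuBound_add y 2 (le_refl 5)] at h3
  rw [show 7 - 1 = 5 + 1 by rfl, tomescuBound_add y 1 (le_refl 5)] at h2
  have hyt := Nat.exists_eq_add_of_le hy
  obtain ⟨t, ht⟩ := hyt
  rw [show y + 1 - 6 = t by omega, show y + 1 - 5 = t + 1 by omega] at h1
  by_cases hM : m ≤ 5
  · have h5 := h2.trans (Nat.mul_le_mul_right _ (show _ ≤ 10 by omega))
    subst ht
    nlinarith
  · have himp : ∀ p ∈ (Finset.univ : Finset (V × V)).filter (fun p => Gᶜ.Adj p.1 p.2),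
        ((colorings G (y + 1)).filter fun f => f p.1 = f p.2).card ≤
          (y - 2) * tomescuBound y 5 := by
      intro p hp
      have hp := (Finset.mem_filter.1 hp).2
      obtain ⟨v, hv, hva, hvb⟩ := exists_common_neighbor hp (k := 2)
        ((Finset.card_le_card (Finset.filter_subset _ _)).trans (by omega)) (by
          have := hG.four_le_degree p.1
          have := hG.four_le_degree p.2
          omega)
      have := hG.card_filter_le_of_degree_eq_four (by omega) hv hva hvb hp.ne
        ((G.compl_adj _ _).1 hp).2
      rwa [hV, show tomescuBound y (7 - 3) = 0 by simp [tomescuBound], mul_zero, add_zero] at this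
    have h5 := Finset.sum_le_sum himp
    rw [Finset.sum_const, smul_eq_mul] at h5
    have h7 := h5.trans (Nat.mul_le_mul_right _ (show _ ≤ 14 by omega))
    rw [show y - 2 = t + 3 by omega] at h7
    subst ht
    nlinarith

theorem card_ne_seven_of_eq_four (hG : IsMinCounterexample G 4) : Fintype.card V ≠ 7 := by
  classical
  intro hV
  have h1 := mul_card_colorings_le (G := G) (y := 4) (k := 2) (by omega)
  have h2 := hG.sum_card_filter_le
  have h3 := hG.lt_card
  have h4 := hG.card_filter_compl_adj_le
  rw [hV] at h2 h3 h4
  rw [show tomescuBound 4 (7 - 1) = 480 by norm_num [tomescuBound]] at h2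
  have h5 := h2.trans (Nat.mul_le_mul_right _ h4)
  norm_num [tomescuBound] at h3
  omega

theorem card_ne_eight_of_eq_four (hG : IsMinCounterexample G 4) : Fintype.card V ≠ 8 := by
  classical
  intro hV
  have h1 := mul_card_colorings_le (G := G) (y := 4) (k := 3) (by omega)
  have h2 := hG.sum_card_filter_le
  have h3 := hG.lt_card
  have h4 := hG.card_filter_compl_adj_le
  rw [hV] at h2 h3 h4
  rw [show tomescuBound 4 (8 - 1) = 1920 by norm_num [tomescuBound]] at h2
  have h5 := h2.trans (Nat.mul_le_mul_right _ h4)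
  norm_num [tomescuBound] at h3
  omega

/-- The contribution of a set `K` of pairs that have a common neighbour of degree `4`. -/
theorem sum_card_filter_add_le (hG : IsMinCounterexample G 4) (hV : Fintype.card V = 9)
    [DecidableEq V] [DecidableRel G.Adj] {K : Finset (V × V)}
    (hK : ∀ p ∈ K, Gᶜ.Adj p.1 p.2 ∧ ∃ v, G.degree v = 4 ∧ G.Adj v p.1 ∧ G.Adj v p.2) :
    ∑ p ∈ (Finset.univ : Finset (V × V)).filter (fun p => Gᶜ.Adj p.1 p.2),
        ((colorings G (4 + 1)).filter fun f => f p.1 = f p.2).card + K.card * 2400 ≤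
      ((Finset.univ : Finset (V × V)).filter fun p => Gᶜ.Adj p.1 p.2).card * 7680 := by
  have hKs : ((Finset.univ : Finset (V × V)).filter fun p => Gᶜ.Adj p.1 p.2).filter
      (fun p => p ∈ K) = K := by
    ext p
    simp only [Finset.mem_filter, Finset.mem_univ, true_and, and_iff_right_iff_imp]
    exact fun hp => (hK p hp).1
  have h : K.card * 2400 =
      ∑ p ∈ (Finset.univ : Finset (V × V)).filter (fun p => Gᶜ.Adj p.1 p.2),
        if p ∈ K then 2400 else 0 := by
    rw [← Finset.sum_filter, hKs, Finset.sum_const, smul_eq_mul]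
  rw [h, ← Finset.sum_add_distrib, ← smul_eq_mul, ← Finset.sum_const]
  refine Finset.sum_le_sum fun p hp => ?_
  have hp := (Finset.mem_filter.1 hp).2
  split_ifs with hpK
  · obtain ⟨v, hv, hva, hvb⟩ := (hK p hpK).2
    have h := hG.card_filter_le_of_degree_eq_four le_rfl hv hva hvb hp.ne
        ((G.compl_adj _ _).1 hp).2
    norm_num [hV, tomescuBound] at h
    omega
  · have h := hG.card_filter_le hp.ne
    norm_num [hV, tomescuBound] at h
    omega

theorem card_ne_nine_of_eq_four (hG : IsMinCounterexample G 4) : Fintype.card V ≠ 9 := by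
  classical
  intro hV
  have h1 := mul_card_colorings_le (G := G) (y := 4) (k := 4) (by omega)
  have h3 := hG.lt_card
  have h4 := hG.sum_degree_compl_add
  have h6 := hG.card_filter_degree_ne_four_le
  obtain ⟨m, hm⟩ := even_card_filter_compl_adj (G := G)
  rw [hV] at h3 h4
  norm_num [tomescuBound] at h3
  set X := Finset.univ.filter fun v => G.degree v ≠ 4 with hX
  have hdeg := hG.four_le_degree
  have hdc : ∀ v, G.degree v + Gᶜ.degree v = 8 := fun v => by
    have := degree_add_degree_compl (G := G) v
    omega
  by_cases h16 : m ≤ 16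
  · have := hG.sum_card_filter_add_le hV (K := ∅) (by simp)
    rw [Finset.card_empty] at this
    omega
  by_cases h18 : m = 18
  · have hX0 : X.card = 0 := by omega
    have := hG.sum_card_filter_add_le hV
      (K := Finset.univ.filter (fun p => Gᶜ.Adj p.1 p.2)) (by
      intro p hp
      have hp := (Finset.mem_filter.1 hp).2
      refine ⟨hp, exists_common_neighbor hp (k := 0)
        ((Finset.card_le_card (Finset.filter_subset _ _)).trans hX0.le) ?_⟩
      have := hdeg p.1
      have := hdeg p.2
      omega)
    omega
  have hs : ∑ a ∈ X, (G.degree a - 4) = 2 := by omega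
  have hXmem : ∀ a, a ∈ X ↔ G.degree a ≠ 4 := fun a => by simp [hX]
  suffices h : ∃ K : Finset (V × V), 7 ≤ K.card ∧
      ∀ p ∈ K, Gᶜ.Adj p.1 p.2 ∧ ∃ v, G.degree v = 4 ∧ G.Adj v p.1 ∧ G.Adj v p.2 by
    obtain ⟨K, hK7, hK⟩ := h
    have := hG.sum_card_filter_add_le hV hK
    omega
  have hXne : X.card ≠ 0 := by
    intro h
    rw [Finset.card_eq_zero.1 h] at hs
    simp at hs
  rcases (by omega : X.card = 1 ∨ X.card = 2) with hX1 | hX2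
  · obtain ⟨x, hx⟩ := Finset.card_eq_one.1 hX1
    rw [hx, Finset.sum_singleton] at hs
    have hY : ∀ a ∈ Gᶜ.neighborFinset x, G.degree a = 4 := by
      intro a ha
      have hxa := (Gᶜ.mem_neighborFinset _ _).1 ha
      by_contra h
      have h := (hXmem a).2 h
      rw [hx, Finset.mem_singleton] at h
      exact hxa.ne h.symm
    refine ⟨(Finset.univ : Finset (V × V)).filter
      fun p => Gᶜ.Adj p.1 p.2 ∧ p.1 ∈ Gᶜ.neighborFinset x, ?_, ?_⟩
    · rw [G.card_filter_compl_adj, Finset.sum_congr rfl (g := fun _ => 4) (fun a ha => by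
        have := hY a ha
        have := hdc a
        omega), Finset.sum_const, SimpleGraph.card_neighborFinset_eq_degree, smul_eq_mul]
      have := hdc x
      omega
    · intro p hp
      obtain ⟨-, hp, hpx⟩ := Finset.mem_filter.1 hp
      refine ⟨hp, exists_common_neighbor hp (k := 0) ?_ ?_⟩
      · rw [← hX, hx, Nat.le_zero, Finset.card_eq_zero, Finset.filter_singleton, if_neg]
        have hxa := (Gᶜ.mem_neighborFinset _ _).1 hpx
        exact fun h => ((G.compl_adj _ _).1 hxa).2 h.1.symm
      · have := hdeg p.1
        have := hdeg p.2
        omega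
  · obtain ⟨x, z, hxz, hXxz⟩ := Finset.card_eq_two.1 hX2
    have hx4 : G.degree x ≠ 4 := (hXmem x).1 (by simp [hXxz])
    have hz4 : G.degree z ≠ 4 := (hXmem z).1 (by simp [hXxz])
    rw [hXxz, Finset.sum_pair hxz] at hs
    have := hdeg x
    have := hdeg z
    have hx5 : G.degree x = 5 := by omega
    have hz5 : G.degree z = 5 := by omega
    have hcommon : ∀ a b, Gᶜ.Adj a b → a ∈ X → ∃ v, G.degree v = 4 ∧ G.Adj v a ∧ G.Adj v b := by
      intro a b hab ha
      refine exists_common_neighbor hab (k := 1) ?_ ?_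
      · have : (X.filter fun v => G.Adj a v ∧ G.Adj b v) ⊆ X.erase a := by
          intro v hv
          obtain ⟨hv, hav, -⟩ := Finset.mem_filter.1 hv
          exact Finset.mem_erase.2 ⟨hav.ne', hv⟩
        have := Finset.card_le_card this
        rwa [Finset.card_erase_of_mem ha, hX2] at this
      · have := hdeg b
        have := hdeg a
        have := (hXmem a).1 ha
        omega
    obtain ⟨b, hb, hbz⟩ : ∃ b ∈ Gᶜ.neighborFinset x, b ≠ z := by
      refine Finset.exists_mem_ne ?_ z
      rw [SimpleGraph.card_neighborFinset_eq_degree]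
      have := hdc x
      omega
    have hxb := (Gᶜ.mem_neighborFinset _ _).1 hb
    refine ⟨insert (b, x) ((Finset.univ : Finset (V × V)).filter
      fun p => Gᶜ.Adj p.1 p.2 ∧ p.1 ∈ X), ?_, ?_⟩
    · rw [Finset.card_insert_of_notMem, G.card_filter_compl_adj, hXxz, Finset.sum_pair hxz]
      · have := hdc x
        have := hdc z
        omega
      · simp [hXxz, hbz, hxb.ne']
    · intro p hp
      rcases Finset.mem_insert.1 hp with rfl | hp
      · obtain ⟨v, hv, hvx, hvb⟩ := hcommon x b hxb (by simp [hXxz])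
        exact ⟨hxb.symm, v, hv, hvb, hvx⟩
      · obtain ⟨-, hp, hpX⟩ := Finset.mem_filter.1 hp
        exact ⟨hp, hcommon _ _ hp hpX⟩

end IsMinCounterexample

theorem not_isMinCounterexample {V : Type} [Fintype V] {G : SimpleGraph V} {y : ℕ} (hy : 4 ≤ y) :
    ¬ IsMinCounterexample G y := by
  intro hG
  have h5 := hG.five_le_card
  have h5' := hG.card_ne_five hy
  have h6 := hG.card_ne_six hy
  rcases hy.eq_or_lt with rfl | hy
  · have h7 := hG.card_ne_seven_of_eq_four
    have h8 := hG.card_ne_eight_of_eq_four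
    have h9 := hG.card_ne_nine_of_eq_four
    have h10 := hG.card_lt_ten_of_eq_four
    omega
  · have h7 := hG.card_ne_seven hy
    have h8 := hG.card_lt_eight hy
    omega

theorem boundHolds {y : ℕ} (hy : 4 ≤ y) (N : ℕ) : BoundHolds y N := by
  induction N with
  | zero => exact fun W _ H _ _ h => absurd h (Nat.not_lt_zero _)
  | succ N ih =>
    intro W _ H hH h4 hW
    by_contra! hlt
    refine not_isMinCounterexample hy ⟨hH, h4, fun U _ K hK hK4 hU => ?_, hlt⟩
    exact ih U K hK hK4 (by omega)

/-- If `G` is a connected graph on `n` vertices with chromatic number exactly `5` and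
`y ≥ 4` is an integer, then `Q_G(y) ≤ (y+1)·y^(n-4)·(y-1)·(y-2)·(y-3)`. -/
theorem tomescu_five_chromatic_bound {V : Type} [Fintype V] (G : SimpleGraph V)
    (hconn : G.Connected) (hchrom : G.chromaticNumber = 5)
    (y : ℕ) (hy : 4 ≤ y) :
    numColorings G (y + 1) ≤
      (y + 1) * y ^ (Fintype.card V - 4) * (y - 1) * (y - 2) * (y - 3) := by
  have h4 : ¬ G.Colorable 4 := by
    intro h
    have := SimpleGraph.chromaticNumber_le_iff_colorable.2 h
    rw [hchrom] at this
    exact absurd this (by decide)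
  have h := boundHolds hy (Fintype.card V + 1) V G hconn h4 (Nat.lt_succ_self _)
  rw [numColorings_eq_card_colorings]
  rwa [tomescuBound_of_le y (five_le_card_of_not_colorable h4)] at h
end

section
/- Let G be a connected graph on n vertices with chromatic number exactly 5. If Q_G(y) = (y+1)·y^{n-4}·(y-1)·(y-2)·(y-3) holds for some integer y ≥ 4, then G can be obtained from the complete graph K_5 by repeatedly adding pendant vertices (vertices of degree 1), i.e., G is formed from K_5 by attaching a tree rooted at each vertex of the K_5. -/
/-- `G` is obtained from the complete graph `K_k` by repeatedly adding pendant vertices: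
there is an ordering of the vertices (via an isomorphism with a graph on `Fin n`) in which
the first `k` vertices form a clique and every later vertex is joined by an edge to
exactly one earlier vertex. -/
def ObtainedFromCliqueByPendants {V : Type} (G : SimpleGraph V) (k : ℕ) : Prop :=
  ∃ (n : ℕ) (p : ℕ → ℕ), k ≤ n ∧ (∀ i : ℕ, k ≤ i → i < n → p i < i) ∧
    Nonempty (G ≃g SimpleGraph.fromRel (fun a b : Fin n =>
      (a.val < k ∧ b.val < k ∧ a ≠ b) ∨ (k ≤ a.val ∧ p a.val = b.val)))

section

open Finset

/-- Proper colourings of `G` with `x` colours. -/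
@[ext]
structure Col {V : Type} (G : SimpleGraph V) (x : ℕ) where
  /-- The underlying function. -/
  val : V → Fin x
  prop : ∀ u v : V, G.Adj u v → val u ≠ val v

namespace Col

variable {V : Type} {G : SimpleGraph V} {x : ℕ}

instance [Finite V] : Finite (Col G x) :=
  Finite.of_injective Col.val fun _ _ => Col.ext

noncomputable instance [Finite V] : Fintype (Col G x) := Fintype.ofFinite _

/-- Restriction of a colouring to an induced subgraph. -/
def res (S : Set V) (f : Col G x) : Col (G.induce S) x :=
  ⟨fun v => f.1 v, fun u v h => f.2 u v h⟩

lemma res_eq_iff {S : Set V} {f g : Col G x} :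
    f.res S = g.res S ↔ ∀ v ∈ S, f.1 v = g.1 v := by
  constructor
  · intro h v hv
    exact congrFun (congrArg Col.val h) ⟨v, hv⟩
  · intro h
    exact Col.ext (funext fun v => h v v.2)

end Col

section Counting

variable {V : Type} [Finite V] {G : SimpleGraph V} {x : ℕ}

lemma numColorings_eq_card : numColorings G x = Fintype.card (Col G x) :=
  (Nat.card_congr ⟨fun f => ⟨f.1, f.2⟩, fun f => ⟨f.1, f.2⟩, fun _ => rfl, fun _ => rfl⟩).trans
    (Nat.card_eq_fintype_card (α := Col G x))

lemma numColorings_eq_sum : (numColorings G x : ℝ) = ∑ _f : Col G x, (1 : ℝ) := by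
  simp [numColorings_eq_card]

open Classical in
/-- The number of colourings extending a given colouring of `Lᶜ`, when each `u ∈ L` has the
neighbours `D u` outside `L`. -/
lemma card_extensions_le {S : Set V} (L : Finset V) (hS : ∀ v, v ∈ S ↔ v ∉ L) (D : V → Finset V)
    (hD : ∀ u ∈ L, ∀ v ∈ D u, v ∉ L ∧ G.Adj u v) (f₀ : Col G x) :
    #{f : Col G x | f.res S = f₀.res S} ≤ ∏ u ∈ L, (x - #((D u).image f₀.1)) := by
  have : ∏ u ∈ L, (x - #((D u).image f₀.1)) = #(L.pi fun u => ((D u).image f₀.1)ᶜ) := by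
    simp [card_pi, card_compl]
  rw [this]
  refine card_le_card_of_injOn (fun f u _ => f.1 u) ?_ ?_
  · intro f hf
    simp only [coe_filter, mem_univ, true_and, Set.mem_ofPred_eq, Col.res_eq_iff] at hf
    simp only [mem_coe, mem_pi, mem_compl, mem_image, not_exists, not_and]
    intro u hu v hv
    rw [← hf v ((hS v).2 (hD u hu v hv).1)]
    exact (f.2 u v (hD u hu v hv).2).symm
  · intro f hf g hg hfg
    simp only [coe_filter, mem_univ, true_and, Set.mem_ofPred_eq, Col.res_eq_iff] at hf hg
    refine Col.ext (funext fun v => ?_)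
    by_cases hv : v ∈ L
    · exact congrFun (congrFun hfg v) hv
    · rw [hf v ((hS v).2 hv), hg v ((hS v).2 hv)]

open Classical in
lemma sum_prod_inv_le {S : Set V} (L : Finset V) (hS : ∀ v, v ∈ S ↔ v ∉ L) (D : V → Finset V)
    (hD : ∀ u ∈ L, ∀ v ∈ D u, v ∉ L ∧ G.Adj u v) :
    ∑ f : Col G x, ∏ u ∈ L, ((x : ℝ) - #((D u).image f.1))⁻¹ ≤
      numColorings (G.induce S) x := by
  rw [← sum_fiberwise_of_maps_to (s := univ) (t := univ) (g := Col.res S)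
    (fun _ _ => mem_univ _), numColorings_eq_sum]
  refine sum_le_sum fun g _ => ?_
  by_cases hg : ∃ f₀ : Col G x, f₀.res S = g
  · obtain ⟨f₀, rfl⟩ := hg
    have hle (u : V) : #((D u).image f₀.1) ≤ x := by
      simpa using card_le_univ ((D u).image f₀.1)
    have hconst : ∀ f ∈ univ.filter (fun f : Col G x => f.res S = f₀.res S),
        ∏ u ∈ L, ((x : ℝ) - #((D u).image f.1))⁻¹ =
          ∏ u ∈ L, ((x : ℝ) - #((D u).image f₀.1))⁻¹ := by
      intro f hf
      simp only [mem_filter, mem_univ, true_and, Col.res_eq_iff] at hf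
      refine prod_congr rfl fun u hu => ?_
      rw [image_congr fun v hv => hf v ((hS v).2 (hD u hu v hv).1)]
    rw [sum_congr rfl hconst, sum_const, nsmul_eq_mul, prod_inv_distrib, ← div_eq_mul_inv]
    refine div_le_one_of_le₀ ?_ (prod_nonneg fun u _ => sub_nonneg.2 (by exact_mod_cast hle u))
    have := card_extensions_le L hS D hD f₀
    rw [← Nat.cast_le (α := ℝ)] at this
    refine this.trans (le_of_eq ?_)
    rw [Nat.cast_prod]
    exact prod_congr rfl fun u _ => Nat.cast_sub (hle u)
  · rw [filter_false_of_mem (fun f _ hf => hg ⟨f, hf⟩)]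
    simp

open Classical in
lemma numColorings_le_of_fiber (z : V) (D : Finset V) (hD : ∀ v ∈ D, G.Adj z v)
    (w : Col (G.induce {z}ᶜ) x → ℝ) (hw : ∀ g, 0 ≤ w g)
    (h : ∀ f : Col G x, ((x - #(D.image f.1) : ℕ) : ℝ) ≤ w (f.res {z}ᶜ)) :
    (numColorings G x : ℝ) ≤ ∑ g, w g := by
  rw [numColorings_eq_sum, ← sum_fiberwise_of_maps_to (s := univ) (t := univ)
    (g := Col.res ({z}ᶜ : Set V)) (fun _ _ => mem_univ _)]
  refine sum_le_sum fun g _ => ?_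
  by_cases hg : ∃ f₀ : Col G x, f₀.res {z}ᶜ = g
  · obtain ⟨f₀, rfl⟩ := hg
    refine le_trans ?_ (h f₀)
    have := card_extensions_le (S := {z}ᶜ) {z} (by simp) (fun _ => D) (fun u hu v hv => by
      obtain rfl := mem_singleton.1 hu
      exact ⟨fun hv' => (hD v hv).ne (mem_singleton.1 hv').symm, hD v hv⟩) f₀
    simpa using this
  · rw [filter_false_of_mem (fun f _ hf => hg ⟨f, hf⟩)]
    simpa using hw g

lemma numColorings_le_mul_of_adj {y : ℕ} {z a : V} (h : G.Adj z a) :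
    (numColorings G (y + 1) : ℝ) ≤ y * numColorings (G.induce {z}ᶜ) (y + 1) := by
  classical
  refine (numColorings_le_of_fiber z {a} (by simpa using h) (fun _ => (y : ℝ))
    (fun _ => by positivity) (by simp)).trans ?_
  simp [numColorings_eq_card, mul_comm]

open Classical in
lemma numColorings_le_of_adj_adj {y : ℕ} {z a b : V} (ha : G.Adj z a) (hb : G.Adj z b)
    (hy : 1 ≤ y) :
    (numColorings G (y + 1) : ℝ) ≤ (y - 1) * numColorings (G.induce {z}ᶜ) (y + 1) +
      ∑ g : Col (G.induce {z}ᶜ) (y + 1),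
        if g.1 ⟨a, ha.ne.symm⟩ = g.1 ⟨b, hb.ne.symm⟩ then (1 : ℝ) else 0 := by
  have hy' : (1 : ℝ) ≤ y := by exact_mod_cast hy
  refine (numColorings_le_of_fiber z {a, b} (by simp [ha, hb]) (fun g => ((y : ℝ) - 1) +
    if g.1 ⟨a, ha.ne.symm⟩ = g.1 ⟨b, hb.ne.symm⟩ then (1 : ℝ) else 0)
    (fun g => by split_ifs <;> linarith) ?_).trans ?_
  · intro f
    by_cases hf : f.1 a = f.1 b
    · simp [Col.res, hf]
    · have : #(image f.1 {a, b}) = 2 := by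
        rw [image_insert, image_singleton, card_pair hf]
      rw [this]
      simp [Col.res, hf, Nat.cast_sub hy]
  · rw [sum_add_distrib, sum_const, card_univ, nsmul_eq_mul, numColorings_eq_card, mul_comm]

end Counting

section Merge

variable {V : Type}

/-- The graph obtained from `G` by identifying `b` with `a`. -/
def mergeGraph (G : SimpleGraph V) (a b : V) : SimpleGraph {v // v ≠ b} where
  Adj u w := u ≠ w ∧
    (G.Adj u w ∨ (u.1 = a ∧ G.Adj b w) ∨ (w.1 = a ∧ G.Adj b u))
  symm := ⟨fun u w h => ⟨h.1.symm, by
    rcases h.2 with h | h | h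
    · exact Or.inl h.symm
    · exact Or.inr (Or.inr h)
    · exact Or.inr (Or.inl h)⟩⟩
  loopless := ⟨fun _ h => h.1 rfl⟩

variable {G : SimpleGraph V} {a b : V}

open Classical in
/-- The quotient map onto the vertices of `mergeGraph G a b`. -/
noncomputable def mergeMap (hab : a ≠ b) (v : V) : {v // v ≠ b} :=
  if h : v = b then ⟨a, hab⟩ else ⟨v, h⟩

lemma mergeMap_self (hab : a ≠ b) : mergeMap hab b = ⟨a, hab⟩ := by simp [mergeMap]

lemma mergeMap_of_ne (hab : a ≠ b) {v : V} (h : v ≠ b) : mergeMap hab v = ⟨v, h⟩ := by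
  simp [mergeMap, h]

lemma mergeGraph_adj_mergeMap (hab : a ≠ b) {u v : V} (h : G.Adj u v)
    (hne : mergeMap hab u ≠ mergeMap hab v) :
    (mergeGraph G a b).Adj (mergeMap hab u) (mergeMap hab v) := by
  refine ⟨hne, ?_⟩
  by_cases hu : u = b
  · subst hu
    rw [mergeMap_self, mergeMap_of_ne hab h.ne.symm]
    exact Or.inr (Or.inl ⟨rfl, h⟩)
  · by_cases hv : v = b
    · subst hv
      rw [mergeMap_self, mergeMap_of_ne hab hu]
      exact Or.inr (Or.inr ⟨rfl, h.symm⟩)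
    · rw [mergeMap_of_ne hab hu, mergeMap_of_ne hab hv]
      exact Or.inl h

lemma mergeGraph_connected (hG : G.Connected) (hab : a ≠ b) : (mergeGraph G a b).Connected := by
  have key : ∀ u v, G.Walk u v →
      (mergeGraph G a b).Reachable (mergeMap hab u) (mergeMap hab v) := by
    intro u v p
    induction p with
    | nil => exact SimpleGraph.Reachable.rfl
    | @cons u v w h _ ih =>
      by_cases hne : mergeMap hab u = mergeMap hab v
      · rwa [hne]
      · exact (mergeGraph_adj_mergeMap hab h hne).reachable.trans ih
  have : Nonempty {v // v ≠ b} := ⟨⟨a, hab⟩⟩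
  refine ⟨fun u v => ?_⟩
  obtain ⟨p⟩ := hG.preconnected u.1 v.1
  have := key _ _ p
  rwa [mergeMap_of_ne hab u.2, mergeMap_of_ne hab v.2] at this

lemma mergeGraph_adj_mergeMap_of_not_adj (hab : a ≠ b) (hadj : ¬ G.Adj a b) {u v : V}
    (h : G.Adj u v) : (mergeGraph G a b).Adj (mergeMap hab u) (mergeMap hab v) := by
  refine mergeGraph_adj_mergeMap hab h fun heq => ?_
  by_cases hu : u = b
  · subst hu
    rw [mergeMap_self, mergeMap_of_ne hab h.ne.symm, Subtype.mk.injEq] at heq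
    exact hadj (heq ▸ h.symm)
  · by_cases hv : v = b
    · subst hv
      rw [mergeMap_self, mergeMap_of_ne hab hu, Subtype.mk.injEq] at heq
      exact hadj (heq ▸ h)
    · rw [mergeMap_of_ne hab hu, mergeMap_of_ne hab hv, Subtype.mk.injEq] at heq
      exact h.ne heq

lemma not_colorable_mergeGraph {m : ℕ} (hG : ¬ G.Colorable m) (hab : a ≠ b)
    (hadj : ¬ G.Adj a b) : ¬ (mergeGraph G a b).Colorable m := fun ⟨c⟩ =>
  hG ⟨SimpleGraph.Coloring.mk (fun v => c (mergeMap hab v)) fun h =>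
    c.valid (mergeGraph_adj_mergeMap_of_not_adj hab hadj h)⟩

variable [Finite V]

lemma card_ne_add_one (b : V) : Nat.card {v // v ≠ b} + 1 = Nat.card V := by
  classical
  have := Fintype.ofFinite V
  rw [Nat.card_eq_fintype_card, Nat.card_eq_fintype_card, Fintype.card_subtype_compl,
    Fintype.card_subtype_eq]
  have : 0 < Fintype.card V := Fintype.card_pos_iff.2 ⟨b⟩
  omega

open Classical in
lemma sum_ite_eq_le_mergeGraph {x : ℕ} (hab : a ≠ b) (W : ({v // v ≠ b} → Fin x) → ℝ)
    (hW : ∀ g, 0 ≤ W g) :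
    ∑ f : Col G x, (if f.1 a = f.1 b then W (fun v => f.1 v) else 0) ≤
      ∑ g : Col (mergeGraph G a b) x, W g.1 := by
  let e : {f : Col G x // f.1 a = f.1 b} → Col (mergeGraph G a b) x := fun f =>
    ⟨fun v => f.1.1 v, fun u w h => by
      rcases h.2 with h | ⟨h, h'⟩ | ⟨h, h'⟩
      · exact f.1.2 _ _ h
      · rw [h, f.2]
        exact f.1.2 _ _ h'
      · rw [h, f.2]
        exact (f.1.2 _ _ h').symm⟩
  have he : Function.Injective e := by
    intro f g hfg
    have h (v : V) (hv : v ≠ b) : f.1.1 v = g.1.1 v :=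
      congrFun (congrArg Col.val hfg) ⟨v, hv⟩
    refine Subtype.ext (Col.ext (funext fun v => ?_))
    by_cases hv : v = b
    · rw [hv, ← f.2, ← g.2, h a hab]
    · exact h v hv
  rw [← sum_filter, sum_subtype (p := fun f : Col G x => f.1 a = f.1 b) _ (by simp)]
  calc ∑ f : {f : Col G x // f.1 a = f.1 b}, W (fun v => f.1.1 v)
      = ∑ g ∈ univ.image e, W g.1 := by rw [sum_image he.injOn]
    _ ≤ _ := sum_le_univ_sum_of_nonneg fun g => hW _

end Merge

section Basic

variable {V : Type} [Finite V] {G : SimpleGraph V} {x : ℕ}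

lemma numColorings_induce_le_mul {S C D : Set V} (hC : C ⊆ S) (hD : D ⊆ S) (hS : S ⊆ C ∪ D) :
    numColorings (G.induce S) x ≤ numColorings (G.induce C) x * numColorings (G.induce D) x := by
  rw [numColorings_eq_card, numColorings_eq_card, numColorings_eq_card, ← Fintype.card_prod]
  let r {A : Set V} (hA : A ⊆ S) (f : Col (G.induce S) x) : Col (G.induce A) x :=
    ⟨fun v => f.1 ⟨v, hA v.2⟩, fun u v h => f.2 ⟨u, hA u.2⟩ ⟨v, hA v.2⟩ h⟩
  refine Fintype.card_le_of_injective (fun f => (r hC f, r hD f)) fun f g hfg => ?_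
  refine Col.ext (funext fun v => ?_)
  rcases hS v.2 with hv | hv
  · exact congrFun (congrArg Col.val (Prod.ext_iff.1 hfg).1) ⟨v, hv⟩
  · exact congrFun (congrArg Col.val (Prod.ext_iff.1 hfg).2) ⟨v, hv⟩

lemma numColorings_le_descFactorial (hG : ∀ u v, u ≠ v → G.Adj u v) :
    numColorings G x ≤ x.descFactorial (Nat.card V) := by
  classical
  have := Fintype.ofFinite V
  rw [numColorings_eq_card, Nat.card_eq_fintype_card]
  conv_rhs => rw [← Fintype.card_fin x]
  rw [← Fintype.card_embedding_eq]
  refine Fintype.card_le_of_injective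
    (fun f => ⟨f.1, fun u v h => by_contra fun hne => f.2 u v (hG u v hne) h⟩) fun f g h => ?_
  exact Col.ext (congrArg DFunLike.coe h)

lemma card_le_of_not_colorable {m : ℕ} (h : ¬ G.Colorable m) : m < Nat.card V := by
  classical
  have := Fintype.ofFinite V
  rw [Nat.card_eq_fintype_card]
  by_contra! hlt
  exact h (G.colorable_of_fintype.mono hlt)

/-- Colourability in terms of plain functions. -/
lemma colorable_iff_exists {V : Type} {G : SimpleGraph V} {m : ℕ} :
    G.Colorable m ↔ ∃ f : V → Fin m, ∀ u v, G.Adj u v → f u ≠ f v :=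
  ⟨fun ⟨c⟩ => ⟨c, fun _ _ h => c.valid h⟩,
    fun ⟨f, hf⟩ => ⟨SimpleGraph.Coloring.mk f fun {u v} h => hf u v h⟩⟩

end Basic

section Separation

variable {V : Type} {G : SimpleGraph V}

/-- `S` is the disjoint union of `C` and `D` and no edge joins `C` to `D`. -/
structure Separation (G : SimpleGraph V) (S C D : Set V) : Prop where
  disj : ∀ v ∈ C, v ∉ D
  cover : ∀ v, v ∈ S ↔ v ∈ C ∨ v ∈ D
  no_adj : ∀ u ∈ C, ∀ v ∈ D, ¬ G.Adj u v

/-- `S` is separated into two nonempty parts. -/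
def Splits (G : SimpleGraph V) (S : Set V) : Prop :=
  ∃ C D : Set V, C.Nonempty ∧ D.Nonempty ∧ Separation G S C D

lemma Separation.symm {S C D : Set V} (h : Separation G S C D) : Separation G S D C :=
  ⟨fun v hv hv' => h.disj v hv' hv, fun v => (h.cover v).trans or_comm,
    fun u hu v hv huv => h.no_adj v hv u hu huv.symm⟩

lemma Splits.exists_mem {S : Set V} (h : Splits G S) {z : V} (hz : z ∈ S) :
    ∃ C D : Set V, z ∈ C ∧ D.Nonempty ∧ Separation G S C D := by
  obtain ⟨C, D, hC, hD, hs⟩ := h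
  rcases (hs.cover z).1 hz with hz | hz
  · exact ⟨C, D, hz, hD, hs⟩
  · exact ⟨D, C, hz, hC, hs.symm⟩

lemma induce_connected_of_not_splits {S : Set V} (hS : S.Nonempty) (h : ¬ Splits G S) :
    (G.induce S).Connected := by
  have : Nonempty S := hS.to_subtype
  refine ⟨fun u v => by_contra fun huv => h ?_⟩
  refine ⟨{w | ∃ hw : w ∈ S, (G.induce S).Reachable u ⟨w, hw⟩},
    {w | ∃ hw : w ∈ S, ¬ (G.induce S).Reachable u ⟨w, hw⟩},
    ⟨u, u.2, SimpleGraph.Reachable.rfl⟩, ⟨v, v.2, huv⟩, ?_, ?_, ?_⟩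
  · rintro w ⟨hw, h⟩ ⟨_, h'⟩
    exact h' h
  · intro w
    simp only [Set.mem_ofPred_eq, ← exists_or]
    exact ⟨fun hw => ⟨hw, em _⟩, fun ⟨hw, _⟩ => hw⟩
  · rintro w ⟨hw, h⟩ t ⟨ht, h'⟩ hwt
    exact h' (h.trans (SimpleGraph.Adj.reachable (G := G.induce S) (u := ⟨w, hw⟩)
      (v := ⟨t, ht⟩) hwt))

lemma not_splits_of_induce_connected {S : Set V} (h : (G.induce S).Connected) :
    ¬ Splits G S := by
  rintro ⟨C, D, ⟨c, hc⟩, ⟨d, hd⟩, hs⟩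
  have key : ∀ u v, (G.induce S).Walk u v → u.1 ∈ C → v.1 ∈ C := by
    intro u v p
    induction p with
    | nil => exact id
    | @cons u v w h _ ih =>
      intro hu
      refine ih ?_
      rcases (hs.cover v).1 v.2 with hv | hv
      · exact hv
      · exact absurd h (hs.no_adj _ hu _ hv)
  obtain ⟨p⟩ := h.preconnected ⟨c, (hs.cover c).2 (Or.inl hc)⟩ ⟨d, (hs.cover d).2 (Or.inr hd)⟩
  exact hs.disj d (key _ _ p hc) hd

lemma not_splits_univ (h : G.Connected) : ¬ Splits G Set.univ :=
  not_splits_of_induce_connected ((SimpleGraph.induceUnivIso G).connected_iff.2 h)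

lemma not_splits_insert {S : Set V} (h : ¬ Splits G S) {u w : V} (hu : u ∈ S)
    (huw : G.Adj u w) : ¬ Splits G (insert w S) := by
  intro hs
  obtain ⟨C, D, huC, ⟨d, hd⟩, hsep⟩ := hs.exists_mem (Set.mem_insert_of_mem w hu)
  have hw : w ∈ C := by
    rcases (hsep.cover w).1 (Set.mem_insert w S) with hw | hw
    · exact hw
    · exact absurd huw (hsep.no_adj u huC w hw)
  refine h ⟨C ∩ S, D, ⟨u, huC, hu⟩, ⟨d, hd⟩, fun v hv => hsep.disj v hv.1, fun v => ?_,
    fun p hp => hsep.no_adj p hp.1⟩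
  have h1 := hsep.cover v
  have h2 := hsep.disj v
  by_cases hvw : v = w
  · subst hvw
    simp only [Set.mem_inter_iff]
    tauto
  · simp only [Set.mem_insert_iff, hvw, false_or, Set.mem_inter_iff] at h1 ⊢
    tauto

/-- `G` has a proper colouring of the vertices of `S` with `m` colours. -/
def ColorableOn (G : SimpleGraph V) (S : Set V) (m : ℕ) : Prop :=
  ∃ f : V → Fin m, ∀ u ∈ S, ∀ v ∈ S, G.Adj u v → f u ≠ f v

lemma ColorableOn.mono {S T : Set V} {m : ℕ} (h : ColorableOn G T m) (hST : S ⊆ T) :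
    ColorableOn G S m :=
  h.imp fun _ hf u hu v hv => hf u (hST hu) v (hST hv)

lemma colorableOn_iff {S : Set V} {m : ℕ} (hm : 0 < m) :
    ColorableOn G S m ↔ (G.induce S).Colorable m := by
  classical
  rw [colorable_iff_exists]
  constructor
  · rintro ⟨f, hf⟩
    exact ⟨fun v => f v, fun u v h => hf u u.2 v v.2 h⟩
  · rintro ⟨f, hf⟩
    refine ⟨fun v => if hv : v ∈ S then f ⟨v, hv⟩ else ⟨0, hm⟩, fun u hu v hv h => ?_⟩
    simpa [hu, hv] using hf ⟨u, hu⟩ ⟨v, hv⟩ h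

lemma ColorableOn.of_separation {S C D : Set V} {m : ℕ} (hs : Separation G S C D)
    (hC : ColorableOn G C m) (hD : ColorableOn G D m) : ColorableOn G S m := by
  classical
  obtain ⟨f, hf⟩ := hC
  obtain ⟨g, hg⟩ := hD
  refine ⟨fun v => if v ∈ C then f v else g v, fun u hu v hv h => ?_⟩
  have hu' := (hs.cover u).1 hu
  have hv' := (hs.cover v).1 hv
  by_cases huC : u ∈ C <;> by_cases hvC : v ∈ C <;> simp only [huC, hvC, if_true, if_false]
  · exact hf u huC v hvC h
  · exact absurd h (hs.no_adj u huC v (hv'.resolve_left hvC))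
  · exact absurd h.symm (hs.no_adj v hvC u (hu'.resolve_left huC))
  · exact hg u (hu'.resolve_left huC) v (hv'.resolve_left hvC) h

/-- A proper `m`-colouring outside an independent set extends to an `(m + 1)`-colouring. -/
lemma colorable_succ_of_independent {L : Set V} {m : ℕ} (hL : ∀ u ∈ L, ∀ v ∈ L, ¬ G.Adj u v)
    (h : ColorableOn G Lᶜ m) : G.Colorable (m + 1) := by
  classical
  obtain ⟨f, hf⟩ := h
  refine colorable_iff_exists.2 ⟨fun v => if v ∈ L then Fin.last m else (f v).castSucc,
    fun u v huv => ?_⟩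
  by_cases hu : u ∈ L <;> by_cases hv : v ∈ L <;> simp only [hu, hv, if_true, if_false]
  · exact absurd huv (hL u hu v hv)
  · exact (Fin.castSucc_lt_last _).ne'
  · exact (Fin.castSucc_lt_last _).ne
  · exact fun h => hf u hu v hv huv (Fin.castSucc_injective _ h)

lemma exists_min_ncard {p : Set V → Prop} {S : Set V} (hS : p S) :
    ∃ T, p T ∧ ∀ T', p T' → T.ncard ≤ T'.ncard := by
  obtain ⟨T, hT, hmin⟩ := (measure (Set.ncard (α := V))).wf.has_min {T | p T} ⟨S, hS⟩
  exact ⟨T, hT, fun T' hT' => not_lt.1 (hmin T' hT')⟩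

variable {m : ℕ}

/-- A connected graph that is not `m`-colourable either has a vertex whose deletion leaves
a connected graph that is not `m`-colourable, or is vertex-critical. -/
lemma exists_connected_not_colorable_or [Finite V] (hG : G.Connected) (hm : 0 < m) :
    (∃ w, (G.induce {w}ᶜ).Connected ∧ ¬ (G.induce {w}ᶜ).Colorable m) ∨
      ∀ w, ColorableOn G {w}ᶜ m := by
  by_cases hz : ∀ w, ColorableOn G {w}ᶜ m
  · exact Or.inr hz
  left
  push Not at hz
  obtain ⟨z, hz⟩ := hz
  have nonempty_of {S : Set V} (hS : ¬ ColorableOn G S m) : S.Nonempty := by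
    rw [Set.nonempty_iff_ne_empty]
    rintro rfl
    exact hS ⟨fun _ => ⟨0, hm⟩, by simp⟩
  obtain ⟨S, ⟨hSz, hS⟩, hmin⟩ :=
    exists_min_ncard (p := fun S => z ∉ S ∧ ¬ ColorableOn G S m) (S := {z}ᶜ) ⟨by simp, hz⟩
  have hSs : ¬ Splits G S := by
    rintro ⟨C, D, ⟨c, hcC⟩, ⟨d, hdD⟩, hs⟩
    have small {A : Set V} (hA : A ⊆ S) {x : V} (hx : x ∈ S) (hxA : x ∉ A) :
        ColorableOn G A m := by
      by_contra hAc
      have := hmin A ⟨fun h => hSz (hA h), hAc⟩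
      exact this.not_gt (Set.ncard_lt_ncard ⟨hA, fun h => hxA (h hx)⟩)
    exact hS (ColorableOn.of_separation hs
      (small (fun v hv => (hs.cover v).2 (Or.inl hv)) ((hs.cover d).2 (Or.inr hdD))
        fun h => hs.disj d h hdD)
      (small (fun v hv => (hs.cover v).2 (Or.inr hv)) ((hs.cover c).2 (Or.inl hcC))
        fun h => hs.disj c hcC h))
  obtain ⟨N, ⟨hN, hNs, hNc⟩, hmax⟩ := exists_min_ncard
    (p := fun N => N.Nonempty ∧ ¬ Splits G Nᶜ ∧ ¬ ColorableOn G Nᶜ m) (S := Sᶜ)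
    ⟨⟨z, hSz⟩, by rwa [compl_compl], by rwa [compl_compl]⟩
  obtain ⟨u, hu, w, hw, huw⟩ : ∃ u ∈ Nᶜ, ∃ w ∈ N, G.Adj u w := by
    by_contra! hno
    exact not_splits_univ hG ⟨Nᶜ, N, nonempty_of hNc, hN, fun v hv => hv,
      fun v => by simp [or_comm, em], hno⟩
  have hins : insert w Nᶜ = (N \ {w})ᶜ := by
    ext v
    simp only [Set.mem_insert_iff, Set.mem_compl_iff, Set.mem_sdiff, Set.mem_singleton_iff]
    tauto
  have hNw : N = {w} := by
    refine Set.eq_singleton_iff_unique_mem.2 ⟨hw, fun v hv => by_contra fun hvw => ?_⟩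
    refine (hmax (N \ {w}) ⟨⟨v, hv, hvw⟩, ?_, ?_⟩).not_gt
      (Set.ncard_lt_ncard ⟨Set.sdiff_subset, fun h => (h hw).2 rfl⟩)
    · rw [← hins]
      exact not_splits_insert hNs hu huw
    · rw [← hins]
      exact fun h => hNc (h.mono (Set.subset_insert _ _))
  subst hNw
  exact ⟨w, induce_connected_of_not_splits ⟨u, hu⟩ hNs, fun h => hNc ((colorableOn_iff hm).2 h)⟩

lemma exists_adj_of_critical (hc : ¬ G.Colorable m) (hcrit : ∀ w, ColorableOn G {w}ᶜ m) (z : V) :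
    ∃ D : Finset V, #D = m ∧ ∀ v ∈ D, G.Adj z v := by
  classical
  obtain ⟨f, hf⟩ := hcrit z
  have key : ∀ c : Fin m, ∃ v, G.Adj z v ∧ f v = c := by
    by_contra! ⟨c, hcol⟩
    refine hc (colorable_iff_exists.2 ⟨fun v => if v = z then c else f v, fun u v huv => ?_⟩)
    by_cases hu : u = z <;> by_cases hv : v = z <;> simp only [hu, hv, if_true, if_false]
    · exact absurd (hu.trans hv.symm) huv.ne
    · exact (hcol v (hu ▸ huv)).symm
    · exact hcol u (hv ▸ huv.symm)
    · exact hf u hu v hv huv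
  choose g hg hgc using key
  refine ⟨univ.image g, ?_, by simpa using hg⟩
  rw [card_image_of_injective _ (fun c d h => by rw [← hgc c, ← hgc d, h]), card_univ,
    Fintype.card_fin]

lemma not_splits_compl_singleton_of_critical (hc : ¬ G.Colorable m)
    (hcrit : ∀ w, ColorableOn G {w}ᶜ m) (z : V) : ¬ Splits G {z}ᶜ := by
  classical
  rintro ⟨C, D, ⟨c, hcC⟩, ⟨d, hdD⟩, hs⟩
  have hz : z ∉ C ∧ z ∉ D := by
    have := hs.cover z
    simp only [Set.mem_compl_iff, Set.mem_singleton_iff, not_true_eq_false, false_iff,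
      not_or] at this
    exact this
  have hcov (v : V) (hv : v ≠ z) : v ∈ C ∨ v ∈ D := (hs.cover v).1 hv
  obtain ⟨f, hf⟩ := (hcrit d).mono (S := insert z C) fun v hv => by
    rintro rfl
    rcases hv with rfl | hv
    · exact hz.2 hdD
    · exact hs.disj _ hv hdD
  obtain ⟨g, hg⟩ := (hcrit c).mono (S := insert z D) fun v hv => by
    rintro rfl
    rcases hv with rfl | hv
    · exact hz.1 hcC
    · exact hs.disj _ hcC hv
  let σ := Equiv.swap (g z) (f z)
  have hσ : σ (g z) = f z := Equiv.swap_apply_left _ _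
  have hgσ (u v : V) (hu : u ∈ insert z D) (hv : v ∈ insert z D) (huv : G.Adj u v) :
      σ (g u) ≠ σ (g v) := fun h => hg u hu v hv huv (σ.injective h)
  refine hc (colorable_iff_exists.2 ⟨fun v => if v ∈ C then f v else σ (g v), fun u v huv => ?_⟩)
  have hD (v : V) (hv : v ∉ C) : v ∈ insert z D := by
    by_cases hvz : v = z
    · exact Or.inl hvz
    · exact Or.inr ((hcov v hvz).resolve_left hv)
  have hcross (u v : V) (hu : u ∈ C) (hv : v ∉ C) (huv : G.Adj u v) : f u ≠ σ (g v) := by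
    rcases hD v hv with rfl | hv
    · rw [hσ]
      exact hf u (Or.inr hu) _ (Or.inl rfl) huv
    · exact absurd huv (hs.no_adj u hu v hv)
  by_cases hu : u ∈ C <;> by_cases hv : v ∈ C <;> simp only [hu, hv, if_true, if_false]
  · exact hf u (Or.inr hu) v (Or.inr hv) huv
  · exact hcross u v hu hv huv
  · exact (hcross v u hv hu huv.symm).symm
  · exact hgσ u v (hD u hu) (hD v hv) huv

end Separation

section IndependentSets

variable {V : Type} {G : SimpleGraph V}

/-- In a graph without cut vertices a nonempty set with at most one outer neighbour `z`
contains every vertex except `z`. -/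
lemma mem_or_eq_of_closed (h2 : ∀ z, ¬ Splits G {z}ᶜ) {D : Set V} {z : V} (hD : D.Nonempty)
    (hz : z ∉ D) (hcl : ∀ u ∈ D, ∀ v, G.Adj u v → v ∈ D ∨ v = z) (v : V) : v ∈ D ∨ v = z := by
  by_contra hv
  refine h2 z ⟨D, {w | w ∉ D ∧ w ≠ z}, hD, ⟨v, not_or.1 hv⟩, fun w hw hw' => hw'.1 hw,
    fun w => ?_, fun u hu w hw huw => ?_⟩
  · by_cases hw : w ∈ D
    · simp only [hw, true_or, iff_true]
      rintro rfl
      exact hz hw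
    · simp [hw]
  · exact (hcl u hu w huw).elim hw.1 hw.2

/-- A graph without cut vertices, with minimum degree at least three, that is not complete has
two non-adjacent vertices whose removal does not disconnect it. -/
lemma exists_nonadj_pair_not_splits [Finite V] (h2 : ∀ z, ¬ Splits G {z}ᶜ)
    (hdeg : ∀ z p q, ∃ w, G.Adj z w ∧ w ≠ p ∧ w ≠ q) (hne : ∃ a b, a ≠ b ∧ ¬ G.Adj a b) :
    ∃ a b, a ≠ b ∧ ¬ G.Adj a b ∧ ¬ Splits G {a, b}ᶜ := by
  by_contra! H
  let p : Set V → Prop := fun A => A.Nonempty ∧ ∃ a b B, a ≠ b ∧ B.Nonempty ∧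
    Separation G {a, b}ᶜ A B
  obtain ⟨A₀, hA₀⟩ : ∃ A, p A := by
    obtain ⟨a, b, hab, hadj⟩ := hne
    obtain ⟨A, B, hA, hB, hs⟩ := H a b hab hadj
    exact ⟨A, hA, a, b, B, hab, hB, hs⟩
  obtain ⟨A, ⟨⟨x, hx⟩, a, b, B, hab, ⟨x', hx'⟩, hs⟩, hmin⟩ := exists_min_ncard hA₀
  have claim : ∀ a b, Separation G {a, b}ᶜ A B → a ≠ b → ∀ x ∈ A, ¬ Splits G {a, x}ᶜ := by
    intro a b hs hab x hx hspl
    have hxab := (hs.cover x).2 (Or.inl hx)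
    simp only [Set.mem_compl_iff, Set.mem_insert_iff, Set.mem_singleton_iff, not_or] at hxab
    have hb : b ∈ ({a, x} : Set V)ᶜ := by
      simp [hab.symm, Ne.symm hxab.2]
    obtain ⟨D, C, hbD, hC, hs'⟩ := hspl.exists_mem hb
    have hcov := hs.cover
    have hcov' := hs'.cover
    simp only [Set.mem_compl_iff, Set.mem_insert_iff, Set.mem_singleton_iff, not_or]
      at hcov hcov'
    have hCB : ∀ v ∈ C, v ∉ B := by
      intro v hvC hvB
      have := mem_or_eq_of_closed h2 (D := C ∩ B) (z := a) ⟨v, hvC, hvB⟩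
        (fun h => ((hcov a).2 (Or.inr h.2)).1 rfl) (fun u hu w huw => by
          have h1 := hs.no_adj w
          have h2 := hs'.no_adj w
          have h3 := hcov w
          have h4 := hcov' w
          by_cases hwa : w = a
          · exact Or.inr hwa
          left
          have hwb : w ≠ b := by
            rintro rfl
            exact h2 hbD u hu.1 huw.symm
          have hwA : w ∉ A := fun h => h1 h u hu.2 huw.symm
          have hwB : w ∈ B := (h3.1 ⟨hwa, hwb⟩).resolve_left hwA
          have hwx : w ≠ x := by
            rintro rfl
            exact hwA hx
          have hwD : w ∉ D := fun h => h2 h u hu.1 huw.symm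
          exact ⟨(h4.1 ⟨hwa, hwx⟩).resolve_left hwD, hwB⟩) x
      rcases this with h | h
      · exact hs.disj x hx h.2
      · exact hxab.1 h
    have hCA : C ⊆ A := by
      intro v hv
      have h1 := (hcov' v).2 (Or.inr hv)
      have hvb : v ≠ b := by
        rintro rfl
        exact hs'.disj v hbD hv
      exact ((hcov v).1 ⟨h1.1, hvb⟩).resolve_right (hCB v hv)
    refine (hmin C ⟨hC, a, x, D, Ne.symm hxab.1, ⟨b, hbD⟩, hs'.symm⟩).not_gt
      (Set.ncard_lt_ncard ⟨hCA, fun h => ?_⟩)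
    exact ((hcov' x).2 (Or.inr (h hx))).2 rfl
  have hcov := hs.cover
  simp only [Set.mem_compl_iff, Set.mem_insert_iff, Set.mem_singleton_iff, not_or] at hcov
  have hadj : ∀ t ∈ A, G.Adj a t ∧ G.Adj b t := by
    intro t ht
    have h1 := (hcov t).2 (Or.inl ht)
    constructor
    · exact by_contra fun h => claim a b hs hab t ht (H a t (Ne.symm h1.1) h)
    · exact by_contra fun h => claim b a (by rwa [Set.pair_comm]) hab.symm t ht
        (H b t (Ne.symm h1.2) h)
  have hxx' : x ≠ x' := by
    rintro rfl
    exact hs.disj x hx hx'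
  have hxab := (hcov x).2 (Or.inl hx)
  have hxab' := (hcov x').2 (Or.inr hx')
  obtain ⟨C, D, haC, hD, hs'⟩ := (H x x' hxx' (hs.no_adj x hx x' hx')).exists_mem (z := a)
    (by simp [Ne.symm hxab.1, Ne.symm hxab'.1])
  have hcov' := hs'.cover
  simp only [Set.mem_compl_iff, Set.mem_insert_iff, Set.mem_singleton_iff, not_or] at hcov'
  have hAC : ∀ t ∈ A, t ≠ x → t ∈ C := by
    intro t ht htx
    have htx' : t ≠ x' := by
      rintro rfl
      exact hs.disj t ht hx'
    exact ((hcov' t).1 ⟨htx, htx'⟩).resolve_right fun h => hs'.no_adj a haC t h (hadj t ht).1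
  have hbC : b ∈ C := by
    obtain ⟨w, hw, hwa, hwb⟩ := hdeg x a b
    have hwA : w ∈ A := ((hcov w).1 ⟨hwa, hwb⟩).resolve_right fun h => hs.no_adj x hx w h hw
    refine ((hcov' b).1 ⟨Ne.symm hxab.2, Ne.symm hxab'.2⟩).resolve_right fun h => ?_
    exact hs'.no_adj w (hAC w hwA hw.ne.symm) b h (hadj w hwA).2.symm
  have hDB : ∀ u ∈ D, u ∈ B := by
    intro u hu
    have h1 := hs'.disj u
    have hua : u ≠ a := by
      rintro rfl
      exact h1 haC hu
    have hub : u ≠ b := by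
      rintro rfl
      exact h1 hbC hu
    refine ((hcov u).1 ⟨hua, hub⟩).resolve_left fun h => h1 (hAC u h ?_) hu
    exact ((hcov' u).2 (Or.inr hu)).1
  have := mem_or_eq_of_closed h2 (z := x') hD (fun h => ((hcov' x').2 (Or.inr h)).2 rfl)
    (fun u hu v huv => by
      by_cases hvx' : v = x'
      · exact Or.inr hvx'
      · left
        have hvx : v ≠ x := by
          rintro rfl
          exact hs.no_adj v hx u (hDB u hu) huv.symm
        exact ((hcov' v).1 ⟨hvx, hvx'⟩).resolve_left fun h => hs'.no_adj v h u hu huv.symm) x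
  rcases this with h | h
  · exact hs.disj x hx (hDB x h)
  · exact hxx' h

lemma Separation.refine_left {S C D C₁ C₂ : Set V} (hs : Separation G S C D)
    (hs' : Separation G C C₁ C₂) : Separation G S C₁ (C₂ ∪ D) := by
  refine ⟨fun v hv => ?_, fun v => ?_, fun u hu v hv => ?_⟩
  · have h1 := hs'.disj v hv
    have h2 := hs.disj v ((hs'.cover v).2 (Or.inl hv))
    exact fun h => h.elim h1 h2
  · rw [hs.cover, hs'.cover, Set.mem_union, or_assoc]
  · exact hv.elim (hs'.no_adj u hu v) (hs.no_adj u ((hs'.cover u).2 (Or.inl hu)) v)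

/-- `a` and `b` are connected in `G` through `Q`: no separation of `Q ∪ {a, b}` has `a` and `b`
in different parts. -/
def Links (G : SimpleGraph V) (Q : Set V) (a b : V) : Prop :=
  ∀ E F, a ∈ E → b ∈ F → ¬ Separation G (Q ∪ {a, b}) E F

/-- If `a` and `b` have neighbours in a connected set `K` whose outer neighbours are
among `a, b, c`, then they are linked through a proper subset of `K`. -/
lemma exists_links_ssubset [Finite V]
    (hdeg : ∀ z p q r, ∃ w, G.Adj z w ∧ w ≠ p ∧ w ≠ q ∧ w ≠ r) {a b c : V} {K : Set V}
    (hcl : ∀ u ∈ K, ∀ v, G.Adj u v → v = a ∨ v = b ∨ v = c ∨ v ∈ K) (hK : ¬ Splits G K)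
    (hta : ∃ p ∈ K, G.Adj a p) (htb : ∃ p ∈ K, G.Adj b p) :
    ∃ Q ⊆ K, Links G Q a b ∧ ∃ x ∈ K, x ∉ Q := by
  obtain ⟨p₁, hp₁, hap₁⟩ := hta
  obtain ⟨p₂, hp₂, hbp₂⟩ := htb
  have hlink : Links G K a b := by
    intro E F haE hbF hs
    have hEF (v : V) (hv : v ∈ K) : v ∈ E ∨ v ∈ F := (hs.cover v).1 (Or.inl hv)
    refine hK ⟨E ∩ K, F ∩ K, ⟨p₁, (hEF p₁ hp₁).resolve_right
      fun h => hs.no_adj a haE p₁ h hap₁, hp₁⟩, ⟨p₂, (hEF p₂ hp₂).resolve_left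
      fun h => hs.no_adj p₂ h b hbF hbp₂.symm, hp₂⟩, fun v h h' => hs.disj v h.1 h'.1,
      fun v => ?_, fun u hu v hv => hs.no_adj u hu.1 v hv.1⟩
    have := hEF v
    simp only [Set.mem_inter_iff]
    grind
  obtain ⟨Q, ⟨hQK, hQ⟩, hmin⟩ := exists_min_ncard (p := fun Q => Q ⊆ K ∧ Links G Q a b)
    ⟨subset_rfl, hlink⟩
  refine ⟨Q, hQK, hQ, ?_⟩
  by_contra! hall
  obtain rfl : Q = K := hQK.antisymm hall
  have small {S : Set V} (hS : S ⊆ Q) {x : V} (hx : x ∈ Q) (hxS : x ∉ S) : ¬ Links G S a b :=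
    fun h => (hmin S ⟨hS, h⟩).not_gt (Set.ncard_lt_ncard ⟨hS, fun h => hxS (h hx)⟩)
  obtain ⟨w₁, hw₁, hw₁a, hw₁b, hw₁c⟩ := hdeg p₁ a b c
  obtain ⟨w₂, hw₂, hw₂a, hw₂c, hw₂₁⟩ := hdeg p₁ a c w₁
  have hw₁Q : w₁ ∈ Q := by
    have := hcl p₁ hp₁ w₁ hw₁
    grind
  have hns := small (S := Q \ {w₁}) Set.sdiff_subset hw₁Q (fun h => h.2 rfl)
  simp only [Links, not_forall, not_not] at hns
  obtain ⟨C, D, haC, hbD, hs⟩ := hns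
  have hcovs := hs.cover
  simp only [Set.mem_union, Set.mem_sdiff, Set.mem_insert_iff, Set.mem_singleton_iff] at hcovs
  have hp₁C : p₁ ∈ C := ((hcovs p₁).1 (Or.inl ⟨hp₁, hw₁.ne⟩)).resolve_right
    fun h => hs.no_adj a haC p₁ h hap₁
  have hw₂C : w₂ ∈ C := by
    have h1 := hcl p₁ hp₁ w₂ hw₂
    refine ((hcovs w₂).1 ?_).resolve_right fun h => hs.no_adj p₁ hp₁C w₂ h hw₂
    grind
  have hw₂Q : w₂ ∈ Q := by
    have h1 := hcl p₁ hp₁ w₂ hw₂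
    have h2 : w₂ ≠ b := by
      rintro rfl
      exact hs.disj w₂ hw₂C hbD
    grind
  have hw₁C : w₁ ∉ C := fun h => by
    have := (hcovs w₁).2 (Or.inl h)
    grind
  refine small (S := {v | v ∈ Q ∧ (v ∈ C → v = p₁)}) (fun v hv => hv.1) hw₂Q
    (fun h => hw₂.ne (h.2 hw₂C).symm) fun E F haE hbF hs' => ?_
  have hcovs' := hs'.cover
  simp only [Set.mem_union, Set.mem_ofPred_eq, Set.mem_insert_iff,
    Set.mem_singleton_iff] at hcovs'
  have hp₁E : p₁ ∈ E := ((hcovs' p₁).1 (Or.inl ⟨hp₁, fun _ => rfl⟩)).resolve_right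
    fun h => hs'.no_adj a haE p₁ h hap₁
  have hw₁E : w₁ ∈ E := ((hcovs' w₁).1 (Or.inl ⟨hw₁Q, fun h => absurd h hw₁C⟩)).resolve_right
    fun h => hs'.no_adj p₁ hp₁E w₁ h hw₁
  have hFD : ∀ v ∈ F, v ∈ D := by
    intro v hv
    have h1 := (hcovs' v).2 (Or.inr hv)
    have h2 : v ∉ E := fun h => hs'.disj v h hv
    have h3 := hcovs v
    have h4 : v ≠ a := fun h => h2 (h ▸ haE)
    have h5 : v ≠ p₁ := fun h => h2 (h ▸ hp₁E)
    have h6 : v ≠ w₁ := fun h => h2 (h ▸ hw₁E)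
    by_cases h7 : v = b
    · rwa [h7]
    · grind
  refine hlink (E ∪ {v | v ∈ Q ∧ v ∈ C}) F (Or.inl haE) hbF ⟨?_, fun v => ?_, ?_⟩
  · rintro v (hv | hv) hvF
    · exact hs'.disj v hv hvF
    · exact hs.disj v hv.2 (hFD v hvF)
  · have h1 := hcovs' v
    have h2 := hcovs v
    simp only [Set.mem_union, Set.mem_insert_iff, Set.mem_singleton_iff, Set.mem_ofPred_eq]
    constructor
    · intro h
      by_cases hvC : v ∈ C <;> grind
    · rintro ((h | h) | h) <;> grind
  · rintro u (hu | hu) v hv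
    · exact hs'.no_adj u hu v hv
    · exact hs.no_adj u hu.2 v (hFD v hv)

/-- `G - {p, q, r}` is connected or has exactly two components, where `p, q, r` is an independent
triple. -/
def IsGoodTriple (G : SimpleGraph V) (p q r : V) : Prop :=
  p ≠ q ∧ p ≠ r ∧ q ≠ r ∧ ¬ G.Adj p q ∧ ¬ G.Adj p r ∧ ¬ G.Adj q r ∧
    (¬ Splits G {p, q, r}ᶜ ∨ ∃ C D, C.Nonempty ∧ D.Nonempty ∧ Separation G {p, q, r}ᶜ C D ∧
      ¬ Splits G C ∧ ¬ Splits G D)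

/-- Let `K₁, K₂, K₃` be pairwise non-adjacent sets partitioning the complement of `{a, b, c}`
in a graph without cut vertices, with `K₁` connected and adjacent to both `a` and `b`. Then
suitable `xᵢ ∈ Kᵢ` form an independent triple whose removal leaves at most two components. -/
lemma exists_isGoodTriple_of_three_parts [Finite V] (h2 : ∀ z, ¬ Splits G {z}ᶜ)
    (hdeg : ∀ z p q r, ∃ w, G.Adj z w ∧ w ≠ p ∧ w ≠ q ∧ w ≠ r) {a b c : V} {K₁ K₂ K₃ : Set V}
    (hcov : ∀ v, v = a ∨ v = b ∨ v = c ∨ v ∈ K₁ ∨ v ∈ K₂ ∨ v ∈ K₃)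
    (ha : a ∉ K₁ ∧ a ∉ K₂ ∧ a ∉ K₃) (hb : b ∉ K₁ ∧ b ∉ K₂ ∧ b ∉ K₃)
    (hc : c ∉ K₁ ∧ c ∉ K₂ ∧ c ∉ K₃) (h12 : ∀ v ∈ K₁, v ∉ K₂) (h13 : ∀ v ∈ K₁, v ∉ K₃)
    (h23 : ∀ v ∈ K₂, v ∉ K₃) (e12 : ∀ u ∈ K₁, ∀ v ∈ K₂, ¬ G.Adj u v)
    (e13 : ∀ u ∈ K₁, ∀ v ∈ K₃, ¬ G.Adj u v) (e23 : ∀ u ∈ K₂, ∀ v ∈ K₃, ¬ G.Adj u v)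
    (hK₁ : ¬ Splits G K₁) (hK₂ : K₂.Nonempty) (hK₃ : K₃.Nonempty)
    (hta : ∃ p ∈ K₁, G.Adj a p) (htb : ∃ p ∈ K₁, G.Adj b p) :
    ∃ p q r, IsGoodTriple G p q r := by
  have cl₁ (u : V) (hu : u ∈ K₁) (v : V) (huv : G.Adj u v) :
      v = a ∨ v = b ∨ v = c ∨ v ∈ K₁ := by
    have h1 := e12 u hu v
    have h2 := e13 u hu v
    have h3 := hcov v
    grind
  have cl₂ (u : V) (hu : u ∈ K₂) (v : V) (huv : G.Adj u v) :
      v = a ∨ v = b ∨ v = c ∨ v ∈ K₂ := by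
    have h1 := fun hv => e12 v hv u hu huv.symm
    have h2 := e23 u hu v
    have h3 := hcov v
    grind
  have cl₃ (u : V) (hu : u ∈ K₃) (v : V) (huv : G.Adj u v) :
      v = a ∨ v = b ∨ v = c ∨ v ∈ K₃ := by
    have h1 := fun hv => e13 v hv u hu huv.symm
    have h2 := fun hv => e23 v hv u hu huv.symm
    have h3 := hcov v
    grind
  obtain ⟨Q, hQK, hQ, x₁, hx₁, hx₁Q⟩ := exists_links_ssubset hdeg cl₁ hK₁ hta htb
  obtain ⟨x₂, hx₂⟩ := hK₂
  obtain ⟨x₃, hx₃⟩ := hK₃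
  have hne_of {A B : Set V} {u v : V} (hd : ∀ v ∈ A, v ∉ B) (hu : u ∈ A) (hv : v ∈ B) : u ≠ v :=
    fun h => hd u hu (h ▸ hv)
  refine ⟨x₁, x₂, x₃, hne_of h12 hx₁ hx₂, hne_of h13 hx₁ hx₃, hne_of h23 hx₂ hx₃,
    e12 x₁ hx₁ x₂ hx₂, e13 x₁ hx₁ x₃ hx₃, e23 x₂ hx₂ x₃ hx₃, ?_⟩
  set L : Set V := {x₁, x₂, x₃} with hL
  have hmemL (v : V) : v ∈ L ↔ v = x₁ ∨ v = x₂ ∨ v = x₃ := by simp [hL]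
  have hTL (v : V) (hv : v = a ∨ v = b ∨ v = c) : v ∉ L := by
    rw [hmemL]
    rintro (rfl | rfl | rfl) <;> rcases hv with rfl | rfl | rfl <;> grind
  have meets : ∀ D : Set V, D.Nonempty → (∀ v ∈ D, v ∉ L) →
      (∀ u ∈ D, ∀ v, G.Adj u v → v ∈ D ∨ v ∈ L) → a ∈ D ∨ b ∈ D ∨ c ∈ D := by
    rintro D ⟨d, hd⟩ hDL hcl
    by_contra! hno
    have hT (v : V) (hv : v ∈ D ∨ v ∈ L) : v ≠ a ∧ v ≠ b ∧ v ≠ c := by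
      have := hTL v
      refine ⟨?_, ?_, ?_⟩ <;> rintro rfl <;> grind
    have part (K : Set V) (x : V) (hx : x ∈ K) (hxL : x ∈ L) (hKL : ∀ v ∈ K, v ∈ L → v = x)
        (hK : ∀ u ∈ K, ∀ v, G.Adj u v → v = a ∨ v = b ∨ v = c ∨ v ∈ K) (haK : a ∉ K) :
        d ∉ K := by
      intro hdK
      have := mem_or_eq_of_closed h2 (D := D ∩ K) (z := x) ⟨d, hd, hdK⟩
        (fun h => hDL x h.1 hxL) (fun u hu v huv => by
          have h1 := hcl u hu.1 v huv
          have h2 := hT v h1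
          have h3 := hK u hu.2 v huv
          have h4 := hKL v
          simp only [Set.mem_inter_iff]
          grind) a
      rcases this with h | h
      · exact hno.1 h.1
      · exact haK (h ▸ hx)
    have hd1 : d ∉ K₁ := part K₁ x₁ hx₁ (by simp [hmemL])
      (fun v hv hvL => by
        rcases (hmemL v).1 hvL with rfl | rfl | rfl
        · rfl
        · exact absurd hx₂ (h12 _ hv)
        · exact absurd hx₃ (h13 _ hv)) cl₁ ha.1
    have hd2 : d ∉ K₂ := part K₂ x₂ hx₂ (by simp [hmemL])
      (fun v hv hvL => by
        rcases (hmemL v).1 hvL with rfl | rfl | rfl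
        · exact absurd hv (h12 _ hx₁)
        · rfl
        · exact absurd hx₃ (h23 _ hv)) cl₂ ha.2.1
    have hd3 : d ∉ K₃ := part K₃ x₃ hx₃ (by simp [hmemL])
      (fun v hv hvL => by
        rcases (hmemL v).1 hvL with rfl | rfl | rfl
        · exact absurd hv (h13 _ hx₁)
        · exact absurd hv (h23 _ hx₂)
        · rfl) cl₃ ha.2.2
    have h1 := hT d (Or.inl hd)
    have h2 := hcov d
    grind
  have together : ∀ C D, Separation G Lᶜ C D → a ∈ C → b ∈ C := by
    intro C D hs haC
    have hbL : b ∈ Lᶜ := hTL b (by simp)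
    refine ((hs.cover b).1 hbL).resolve_right fun hbD => ?_
    have hsub : ∀ v, v ∈ Q ∪ {a, b} → v ∈ C ∨ v ∈ D := by
      rintro v (hv | hv)
      · refine (hs.cover v).1 fun hvL => ?_
        rcases (hmemL v).1 hvL with rfl | rfl | rfl
        · exact hx₁Q hv
        · exact h12 _ (hQK hv) hx₂
        · exact h13 _ (hQK hv) hx₃
      · rcases hv with rfl | rfl
        · exact Or.inl haC
        · exact Or.inr hbD
    refine hQ (C ∩ (Q ∪ {a, b})) (D ∩ (Q ∪ {a, b})) ⟨haC, by simp⟩ ⟨hbD, by simp⟩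
      ⟨fun v h h' => hs.disj v h.1 h'.1, fun v => ?_, fun u hu v hv => hs.no_adj u hu.1 v hv.1⟩
    have := hsub v
    rw [Set.mem_inter_iff, Set.mem_inter_iff]
    grind
  have meets' {A B : Set V} (hA : A.Nonempty) (h : Separation G Lᶜ A B) :
      a ∈ A ∨ b ∈ A ∨ c ∈ A :=
    meets A hA (fun v hv => (h.cover v).2 (Or.inl hv)) fun u hu v huv => by
      by_cases hv : v ∈ L
      · exact Or.inr hv
      · exact Or.inl (((h.cover v).1 hv).resolve_right fun h' => h.no_adj u hu v h' huv)
  by_cases hspl : Splits G Lᶜ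
  · right
    obtain ⟨C, D, haC, hD, hs⟩ := hspl.exists_mem (hTL a (by simp))
    have hbC := together C D hs haC
    have hcD : c ∈ D := by
      rcases meets' hD hs.symm with h | h | h
      · exact absurd h (hs.disj a haC)
      · exact absurd h (hs.disj b hbC)
      · exact h
    refine ⟨C, D, ⟨a, haC⟩, hD, hs, fun hC => ?_, fun hD' => ?_⟩
    · obtain ⟨C₁, C₂, haC₁, hC₂, hs'⟩ := hC.exists_mem haC
      have hbC₁ := together C₁ _ (hs.refine_left hs') haC₁
      rcases meets' hC₂ (hs.refine_left hs'.symm) with h | h | h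
      · exact hs'.disj a haC₁ h
      · exact hs'.disj b hbC₁ h
      · exact hs.disj c ((hs'.cover c).2 (Or.inr h)) hcD
    · obtain ⟨D₁, D₂, hcD₁, hD₂, hs'⟩ := hD'.exists_mem hcD
      have hmem (v : V) (hv : v ∈ D₂) : v ∈ D := (hs'.cover v).2 (Or.inr hv)
      rcases meets' hD₂ (hs.symm.refine_left hs'.symm) with h | h | h
      · exact hs.disj a haC (hmem a h)
      · exact hs.disj b hbC (hmem b h)
      · exact hs'.disj c hcD₁ h
  · exact Or.inl hspl

/-- A graph without cut vertices, with minimum degree at least four, that has an independent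
triple has one whose removal leaves at most two components. -/
lemma exists_isGoodTriple [Finite V] (h2 : ∀ z, ¬ Splits G {z}ᶜ)
    (hdeg : ∀ z p q r, ∃ w, G.Adj z w ∧ w ≠ p ∧ w ≠ q ∧ w ≠ r) {a b c : V}
    (hab : a ≠ b) (hac : a ≠ c) (hbc : b ≠ c) (nab : ¬ G.Adj a b) (nac : ¬ G.Adj a c)
    (nbc : ¬ G.Adj b c) : ∃ p q r, IsGoodTriple G p q r := by
  have hmem (v : V) : v ∈ ({a, b, c} : Set V)ᶜ ↔ v ≠ a ∧ v ≠ b ∧ v ≠ c := by simp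
  obtain ⟨K₁, ⟨hK, hKT, hcl⟩, hmin⟩ := exists_min_ncard
    (p := fun K => K.Nonempty ∧ (∀ v ∈ K, v ≠ a ∧ v ≠ b ∧ v ≠ c) ∧
      ∀ u ∈ K, ∀ v, G.Adj u v → v ∈ K ∨ v = a ∨ v = b ∨ v = c) (S := ({a, b, c} : Set V)ᶜ)
    ⟨by
      obtain ⟨w, -, hw⟩ := hdeg a a b c
      exact ⟨w, (hmem w).2 hw⟩, fun v hv => (hmem v).1 hv, fun u _ v _ => by
      rw [hmem]
      grind⟩
  have hKs : ¬ Splits G K₁ := by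
    rintro ⟨C, D, hC, ⟨d, hd⟩, hs⟩
    have hCK : C ⊆ K₁ := fun v hv => (hs.cover v).2 (Or.inl hv)
    refine (hmin C ⟨hC, fun v hv => hKT v (hCK hv), fun u hu v huv => ?_⟩).not_gt
      (Set.ncard_lt_ncard ⟨hCK, fun h => hs.disj d (h ((hs.cover d).2 (Or.inr hd))) hd⟩)
    have h1 := hcl u (hCK hu) v huv
    have h2 := hs.cover v
    have h3 := hs.no_adj u hu v
    grind
  set R : Set V := {v | v ∉ K₁ ∧ v ≠ a ∧ v ≠ b ∧ v ≠ c} with hR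
  have hsep : Separation G {a, b, c}ᶜ K₁ R := by
    refine ⟨fun v hv hv' => hv'.1 hv, fun v => ?_, fun u hu v hv huv => ?_⟩
    · have := hKT v
      rw [hmem]
      simp only [hR, Set.mem_ofPred_eq]
      grind
    · have := hcl u hu v huv
      simp only [hR, Set.mem_ofPred_eq] at hv
      grind
  by_cases hRs : Splits G R
  · obtain ⟨K₂, K₃, hK₂, hK₃, hs⟩ := hRs
    have touch (t : V) (ht : t = a ∨ t = b ∨ t = c) :
        ∃ u ∈ K₁, ∃ v, G.Adj u v ∧ v ≠ t ∧ (v = a ∨ v = b ∨ v = c) := by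
      by_contra! hno
      have key := mem_or_eq_of_closed h2 (z := t) hK (by grind) (fun u hu v huv => by
        have h1 := hcl u hu v huv
        have h2 := hno u hu v huv
        grind)
      have ka := key a
      have kb := key b
      have kc := key c
      grind
    have hcov (v : V) : v = a ∨ v = b ∨ v = c ∨ v ∈ K₁ ∨ v ∈ K₂ ∨ v ∈ K₃ := by
      have h1 := hsep.cover v
      have h2 := hs.cover v
      rw [hmem] at h1
      grind
    have hR₂ (v : V) (hv : v ∈ K₂) : v ∈ R := (hs.cover v).2 (Or.inl hv)
    have hR₃ (v : V) (hv : v ∈ K₃) : v ∈ R := (hs.cover v).2 (Or.inr hv)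
    have hout (t : V) (ht : t = a ∨ t = b ∨ t = c) : t ∉ K₁ ∧ t ∉ K₂ ∧ t ∉ K₃ := by
      have hRt : t ∉ R := fun h => by
        simp only [hR, Set.mem_ofPred_eq] at h
        grind
      exact ⟨fun h => by grind, fun h => hRt (hR₂ t h), fun h => hRt (hR₃ t h)⟩
    have main (α β γ : V) (hα : α = a ∨ α = b ∨ α = c) (hβ : β = a ∨ β = b ∨ β = c)
        (hγ : γ = a ∨ γ = b ∨ γ = c)
        (hcov : ∀ v, v = α ∨ v = β ∨ v = γ ∨ v ∈ K₁ ∨ v ∈ K₂ ∨ v ∈ K₃)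
        (htα : ∃ p ∈ K₁, G.Adj p α) (htβ : ∃ p ∈ K₁, G.Adj p β) :
        ∃ p q r, IsGoodTriple G p q r :=
      exists_isGoodTriple_of_three_parts h2 hdeg hcov (hout α hα) (hout β hβ) (hout γ hγ)
        (fun v hv h => hsep.disj v hv (hR₂ v h)) (fun v hv h => hsep.disj v hv (hR₃ v h))
        hs.disj (fun u hu v hv => hsep.no_adj u hu v (hR₂ v hv))
        (fun u hu v hv => hsep.no_adj u hu v (hR₃ v hv)) hs.no_adj hKs hK₂ hK₃
        (htα.imp fun p h => ⟨h.1, h.2.symm⟩) (htβ.imp fun p h => ⟨h.1, h.2.symm⟩)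
    have touched : ((∃ p ∈ K₁, G.Adj p a) ∧ ∃ p ∈ K₁, G.Adj p b) ∨
        ((∃ p ∈ K₁, G.Adj p a) ∧ ∃ p ∈ K₁, G.Adj p c) ∨
        ((∃ p ∈ K₁, G.Adj p b) ∧ ∃ p ∈ K₁, G.Adj p c) := by
      obtain ⟨u₁, hu₁, v₁, h₁, hv₁⟩ := touch a (by simp)
      obtain ⟨u₂, hu₂, v₂, h₂, hv₂⟩ := touch b (by simp)
      obtain ⟨u₃, hu₃, v₃, h₃, hv₃⟩ := touch c (by simp)
      clear hcov hout main hcl hmin hKT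
      grind
    rcases touched with ⟨h, h'⟩ | ⟨h, h'⟩ | ⟨h, h'⟩
    · exact main a b c (by simp) (by simp) (by simp) hcov h h'
    · exact main a c b (by simp) (by simp) (by simp) (fun v => by grind) h h'
    · exact main b c a (by simp) (by simp) (by simp) (fun v => by grind) h h'
  · refine ⟨a, b, c, hab, hac, hbc, nab, nac, nbc, ?_⟩
    rcases R.eq_empty_or_nonempty with hRe | hRe
    · left
      have : ({a, b, c} : Set V)ᶜ = K₁ := by
        ext v
        rw [hsep.cover, hRe]
        simp
      rwa [this]
    · exact Or.inr ⟨K₁, R, hK, hRe, hsep, hKs, hRs⟩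

end IndependentSets

section SmallBounds

/-- Two proper `2`-colourings of a connected graph agree everywhere or nowhere. -/
lemma two_colorings_agree_iff {V : Type} {G : SimpleGraph V} {c d : V → Fin 2} (hG : G.Connected)
    (hc : ∀ u v, G.Adj u v → c u ≠ c v) (hd : ∀ u v, G.Adj u v → d u ≠ d v) (u v : V) :
    c u = d u ↔ c v = d v := by
  obtain ⟨p⟩ := hG.preconnected u v
  induction p with
  | nil => rfl
  | @cons u v w h _ ih =>
    rw [← ih]
    have h1 := hc u v h
    have h2 := hd u v h
    omega

variable {V : Type} [Finite V] {G : SimpleGraph V} {m x : ℕ}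

lemma natCard_compl_singleton_add_one (z : V) : Nat.card ({z}ᶜ : Set V) + 1 = Nat.card V := by
  have := Set.ncard_add_ncard_compl ({z} : Set V)
  rw [Set.ncard_singleton] at this
  rw [Nat.card_coe_set_eq]
  omega

lemma natCard_compl_pair_add_two {a b : V} (hab : a ≠ b) :
    Nat.card ({a, b}ᶜ : Set V) + 2 = Nat.card V := by
  have := Set.ncard_add_ncard_compl ({a, b} : Set V)
  rw [Set.ncard_pair hab] at this
  rw [Nat.card_coe_set_eq]
  omega

lemma natCard_compl_triple_add_three {a b c : V} (hab : a ≠ b) (hac : a ≠ c) (hbc : b ≠ c) :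
    Nat.card ({a, b, c}ᶜ : Set V) + 3 = Nat.card V := by
  have := Set.ncard_add_ncard_compl ({a, b, c} : Set V)
  rw [Set.ncard_eq_three.2 ⟨a, b, c, hab, hac, hbc, rfl⟩] at this
  rw [Nat.card_coe_set_eq]
  omega

open Classical in
/-- The number of colourings in which `a` and `b` agree is bounded by any bound for the
connected non-`m`-colourable graphs with one vertex less. -/
lemma sum_ite_eq_le (hG : G.Connected) (hc : ¬ G.Colorable m) {a b : V} (hab : a ≠ b) {β : ℝ}
    (hβ : 0 ≤ β) (h : ¬ G.Adj a b → (mergeGraph G a b).Connected →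
      ¬ (mergeGraph G a b).Colorable m → (numColorings (mergeGraph G a b) x : ℝ) ≤ β) :
    ∑ f : Col G x, (if f.1 a = f.1 b then (1 : ℝ) else 0) ≤ β := by
  by_cases hadj : G.Adj a b
  · rwa [sum_eq_zero fun f _ => if_neg (f.2 a b hadj)]
  · refine (sum_ite_eq_le_mergeGraph hab (fun _ => 1) (by simp)).trans ?_
    rw [← numColorings_eq_sum]
    exact h hadj (mergeGraph_connected hG hab) (not_colorable_mergeGraph hc hab hadj)

open Classical in
/-- The number of colourings in which `a, b` agree and `c, d` agree is bounded by any bound for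
the connected non-`m`-colourable graphs with two vertices less. -/
lemma sum_ite_eq_and_eq_le (hG : G.Connected) (hc : ¬ G.Colorable m) {a b c d : V} (hab : a ≠ b)
    (hcd : c ≠ d) (hcb : c ≠ b) (hdb : d ≠ b) {β : ℝ} (hβ : 0 ≤ β)
    (h : ∀ (W : Type) [Finite W] (H : SimpleGraph W), Nat.card W + 2 = Nat.card V →
      H.Connected → ¬ H.Colorable m → (numColorings H x : ℝ) ≤ β) :
    ∑ f : Col G x, (if f.1 a = f.1 b ∧ f.1 c = f.1 d then (1 : ℝ) else 0) ≤ β := by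
  by_cases hadj : G.Adj a b
  · rwa [sum_eq_zero fun f _ => if_neg fun hf => f.2 a b hadj hf.1]
  · have := sum_ite_eq_le_mergeGraph (G := G) hab
      (fun g : {v // v ≠ b} → Fin x => if g ⟨c, hcb⟩ = g ⟨d, hdb⟩ then (1 : ℝ) else 0)
      (fun g => by positivity)
    simp only [ite_and]
    refine this.trans (sum_ite_eq_le (mergeGraph_connected hG hab)
      (not_colorable_mergeGraph hc hab hadj) (by simpa using hcd) hβ
      fun _ hG' hc' => h _ _ ?_ hG' hc')
    rw [← card_ne_add_one b, ← card_ne_add_one (⟨d, hdb⟩ : {v // v ≠ b})]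

lemma nontrivial_of_one_lt_natCard (h : 1 < Nat.card V) : Nontrivial V :=
  Finite.one_lt_card_iff_nontrivial.1 h

lemma numColorings_le_of_connected {y : ℕ} (hy : 1 ≤ y) (hG : G.Connected) :
    (numColorings G (y + 1) : ℝ) ≤ (y + 1) * y ^ Nat.card V / y := by
  obtain ⟨n, hn⟩ : ∃ n, Nat.card V = n := ⟨_, rfl⟩
  have hy0 : (0 : ℝ) < y := by exact_mod_cast hy
  induction n generalizing V with
  | zero =>
    have := hG.nonempty
    exact absurd hn Nat.card_pos.ne'
  | succ n ih =>
    rcases Nat.eq_zero_or_pos n with rfl | hpos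
    · have hs : Subsingleton V := (Nat.card_eq_one_iff_unique.1 hn).1
      have := numColorings_le_descFactorial (G := G) (x := y + 1)
        fun u v h => absurd (Subsingleton.elim u v) h
      rw [hn] at this ⊢
      rw [le_div_iff₀ hy0]
      simp only [zero_add, Nat.descFactorial_one, pow_one] at this ⊢
      gcongr
      exact_mod_cast this
    · have := nontrivial_of_one_lt_natCard (V := V) (by omega)
      obtain ⟨z, hz⟩ := hG.exists_connected_induce_compl_singleton_of_finite_nontrivial
      obtain ⟨a, ha⟩ := hG.preconnected.exists_adj_of_nontrivial z
      have hcard := natCard_compl_singleton_add_one z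
      have h1 := ih hz (by omega)
      refine (numColorings_le_mul_of_adj ha).trans ((mul_le_mul_of_nonneg_left h1 hy0.le).trans ?_)
      rw [← hcard, pow_succ]
      apply le_of_eq
      ring

theorem numColorings_le_of_not_colorable_two {y : ℕ} (hy : 1 ≤ y) (hG : G.Connected)
    (hc : ¬ G.Colorable 2) : (numColorings G (y + 1) : ℝ) ≤ y ^ Nat.card V := by
  classical
  obtain ⟨n, hn⟩ : ∃ n, Nat.card V = n := ⟨_, rfl⟩
  have hy1 : (1 : ℝ) ≤ y := by exact_mod_cast hy
  induction n using Nat.strong_induction_on generalizing V with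
  | _ n ih =>
  have hn2 := card_le_of_not_colorable hc
  have := nontrivial_of_one_lt_natCard (V := V) (by omega)
  rcases exists_connected_not_colorable_or hG two_pos (m := 2) with ⟨w, hw, hwc⟩ | hcrit
  · obtain ⟨a, ha⟩ := hG.preconnected.exists_adj_of_nontrivial w
    have hcard := natCard_compl_singleton_add_one w
    have h1 := ih _ (by omega) hw hwc rfl
    refine (numColorings_le_mul_of_adj ha).trans ((mul_le_mul_of_nonneg_left h1
      (by positivity)).trans (le_of_eq ?_))
    rw [← hcard, pow_succ]
    ring
  · obtain ⟨z, hz⟩ := hG.exists_connected_induce_compl_singleton_of_finite_nontrivial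
    obtain ⟨c, hcz⟩ := hcrit z
    obtain ⟨a, b, ha, hb, hcab⟩ : ∃ a b, G.Adj z a ∧ G.Adj z b ∧ c a ≠ c b := by
      by_contra! hall
      obtain ⟨a, ha⟩ := hG.preconnected.exists_adj_of_nontrivial z
      refine hc (colorable_iff_exists.2 ⟨fun v => if v = z then c a + 1 else c v,
        fun u v huv => ?_⟩)
      have key (w : V) (hw : G.Adj z w) : c a + 1 ≠ c w := by
        have := hall a w ha hw
        omega
      by_cases hu : u = z <;> by_cases hv : v = z <;> simp only [hu, hv, if_true, if_false]
      · exact absurd (hu.trans hv.symm) huv.ne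
      · exact key v (hu ▸ huv)
      · exact (key u (hv ▸ huv.symm)).symm
      · exact hcz u hu v hv huv
    have hcard := natCard_compl_singleton_add_one z
    let a' : ({z}ᶜ : Set V) := ⟨a, ha.ne.symm⟩
    let b' : ({z}ᶜ : Set V) := ⟨b, hb.ne.symm⟩
    have hab : a' ≠ b' := fun h => hcab (congrArg c (congrArg Subtype.val h))
    have hcard' := card_ne_add_one b'
    have hE : ∑ g : Col (G.induce {z}ᶜ) (y + 1), (if g.1 a' = g.1 b' then (1 : ℝ) else 0) ≤
        y ^ Nat.card {v // v ≠ b'} := by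
      by_cases hadj : (G.induce {z}ᶜ).Adj a' b'
      · rw [sum_eq_zero fun f _ => if_neg (f.2 a' b' hadj)]
        positivity
      · refine (sum_ite_eq_le_mergeGraph hab (fun _ => 1) (by simp)).trans ?_
        rw [← numColorings_eq_sum]
        refine ih _ (by omega) (mergeGraph_connected hz hab) (fun hcol => ?_) rfl
        obtain ⟨d, hd⟩ := colorable_iff_exists.1 hcol
        have h1 := two_colorings_agree_iff (c := fun v : ({z}ᶜ : Set V) => c v)
          (d := fun v => d (mergeMap hab v)) hz (fun u v h => hcz u u.2 v v.2 h)
          (fun u v h => hd _ _ (mergeGraph_adj_mergeMap_of_not_adj hab hadj h)) a' b'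
        simp only [mergeMap_self, mergeMap_of_ne hab hab] at h1
        change c a = _ ↔ c b = _ at h1
        omega
    have h1 := numColorings_le_of_adj_adj ha hb hy
    have h2 := numColorings_le_of_connected hy hz
    have h3 := mul_le_mul_of_nonneg_left h2 (sub_nonneg.2 hy1)
    refine h1.trans ((add_le_add h3 hE).trans (le_of_eq ?_))
    rw [← hcard, ← hcard', pow_succ, pow_succ]
    field_simp
    ring

end SmallBounds

section Weights

/-- The relation between the number `k` of colours used on three vertices and the number `A` of
pairs of them with equal colours. -/
def PairCount (k : ℕ) (A : ℝ) : Prop :=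
  k = 3 ∧ A = 0 ∨ k = 2 ∧ A = 1 ∨ k = 1 ∧ A = 3

/-- The relation between the number `k` of colours used on four vertices and the number `M` of
nonempty matchings between them consisting of pairs with equal colours. -/
def MatchingCount (k : ℕ) (M : ℝ) : Prop :=
  k = 4 ∧ M = 0 ∨ k = 3 ∧ M = 1 ∨ k = 2 ∧ M = 3 ∨ k = 1 ∧ M = 9

/-- The relation between the number `k` of colours used on four vertices and the number `A` of
pairs of them with equal colours, if no three of the colours are equal. -/
def SparsePairCount (k : ℕ) (A : ℝ) : Prop :=
  k = 4 ∧ A = 0 ∨ k = 3 ∧ A = 1 ∨ k = 2 ∧ A = 2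

/-- The indicator of an equality of two colours. -/
def eqInd {x : ℕ} (a b : Fin x) : ℝ := if a = b then 1 else 0

/-- The indicator of two equalities of colours. -/
def eqInd₂ {x : ℕ} (a b c d : Fin x) : ℝ := if a = b ∧ c = d then 1 else 0

lemma pairCount_three {x : ℕ} (a b c : Fin x) :
    PairCount #{a, b, c} (eqInd a b + eqInd a c + eqInd b c) := by
  unfold PairCount eqInd
  by_cases h1 : a = b <;> by_cases h2 : a = c <;> by_cases h3 : b = c <;>
    simp_all [card_insert_of_notMem]; norm_num

lemma matchingCount_four {x : ℕ} (a b c d : Fin x) :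
    MatchingCount #{a, b, c, d}
      (eqInd a b + eqInd a c + eqInd a d + eqInd b c + eqInd b d + eqInd c d +
        (eqInd₂ a b c d + eqInd₂ a c b d + eqInd₂ a d b c)) := by
  unfold MatchingCount eqInd eqInd₂
  by_cases h1 : a = b <;> by_cases h2 : a = c <;> by_cases h3 : b = c <;>
    by_cases h4 : a = d <;> by_cases h5 : b = d <;> by_cases h6 : c = d <;>
    simp_all [card_insert_of_notMem] <;> norm_num

lemma sparsePairCount_four {x : ℕ} {a b c d : Fin x} (habc : ¬ (a = b ∧ a = c))
    (habd : ¬ (a = b ∧ a = d)) (hacd : ¬ (a = c ∧ a = d)) (hbcd : ¬ (b = c ∧ b = d)) :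
    SparsePairCount #{a, b, c, d}
      (eqInd a b + eqInd a c + eqInd a d + eqInd b c + eqInd b d + eqInd c d) := by
  unfold SparsePairCount eqInd
  by_cases h1 : a = b <;> by_cases h2 : a = c <;> by_cases h3 : b = c <;>
    by_cases h4 : a = d <;> by_cases h5 : b = d <;> by_cases h6 : c = d <;>
    simp_all [card_insert_of_notMem] <;> norm_num

variable {V : Type} [Finite V] {G : SimpleGraph V} {x : ℕ}

open Classical in
/-- A lower bound for the weight of each colouring in terms of `∑ u ∈ L, A u` bounds the number of
colourings of `G` by the number of colourings of `G - L`. -/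
lemma mul_numColorings_le {S : Set V} (L : Finset V) (hS : ∀ v, v ∈ S ↔ v ∉ L)
    (hL : ∀ u ∈ L, ∀ v ∈ L, ¬ G.Adj u v) {D : V → Finset V} (hD : ∀ u, ∀ v ∈ D u, G.Adj u v)
    {A : V → Col G x → ℝ} {c d : ℝ} (hd : 0 ≤ d)
    (h : ∀ f : Col G x, c - ∑ u ∈ L, A u f ≤ d * ∏ u ∈ L, ((x : ℝ) - #((D u).image f.1))⁻¹) :
    c * numColorings G x ≤ d * numColorings (G.induce S) x + ∑ u ∈ L, ∑ f, A u f := by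
  have h1 := sum_le_sum fun f (_ : f ∈ univ) => h f
  have h2 := sum_prod_inv_le (G := G) (x := x) L hS D
    fun u hu v hv => ⟨fun hv' => hL u hu v hv' (hD u v hv), hD u v hv⟩
  rw [sum_sub_distrib, sum_comm, ← mul_sum, sum_const, card_univ, ← numColorings_eq_card,
    nsmul_eq_mul] at h1
  have h4 := mul_le_mul_of_nonneg_left h2 hd
  linarith

lemma exists_pairCount {D : Finset V} (hD : #D = 3) {β : ℝ}
    (h : ∀ a b, a ≠ b → ∑ f : Col G x, eqInd (f.1 a) (f.1 b) ≤ β) :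
    ∃ A : Col G x → ℝ, (∀ f, PairCount #(D.image f.1) (A f)) ∧ ∑ f, A f ≤ 3 * β := by
  classical
  obtain ⟨a, b, c, hab, hac, hbc, rfl⟩ := card_eq_three.1 hD
  refine ⟨fun f => eqInd (f.1 a) (f.1 b) + eqInd (f.1 a) (f.1 c) + eqInd (f.1 b) (f.1 c),
    fun f => ?_, ?_⟩
  · simp only [image_insert, image_singleton]
    exact pairCount_three _ _ _
  · simp only [sum_add_distrib]
    linarith [h a b hab, h a c hac, h b c hbc]

lemma exists_matchingCount {D : Finset V} (hD : #D = 4) {β γ : ℝ}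
    (h : ∀ a b, a ≠ b → ∑ f : Col G x, eqInd (f.1 a) (f.1 b) ≤ β)
    (h' : ∀ a b c d, a ≠ b → c ≠ d → c ≠ b → d ≠ b →
      ∑ f : Col G x, eqInd₂ (f.1 a) (f.1 b) (f.1 c) (f.1 d) ≤ γ) :
    ∃ M : Col G x → ℝ, (∀ f, MatchingCount #(D.image f.1) (M f)) ∧
      ∑ f, M f ≤ 6 * β + 3 * γ := by
  classical
  obtain ⟨a, b, c, d, hab, hac, had, hbc, hbd, hcd, rfl⟩ := card_eq_four.1 hD
  refine ⟨fun f => eqInd (f.1 a) (f.1 b) + eqInd (f.1 a) (f.1 c) + eqInd (f.1 a) (f.1 d) +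
    eqInd (f.1 b) (f.1 c) + eqInd (f.1 b) (f.1 d) + eqInd (f.1 c) (f.1 d) +
    (eqInd₂ (f.1 a) (f.1 b) (f.1 c) (f.1 d) + eqInd₂ (f.1 a) (f.1 c) (f.1 b) (f.1 d) +
      eqInd₂ (f.1 a) (f.1 d) (f.1 b) (f.1 c)), fun f => ?_, ?_⟩
  · simp only [image_insert, image_singleton]
    exact matchingCount_four _ _ _ _
  · simp only [sum_add_distrib]
    linarith [h a b hab, h a c hac, h a d had, h b c hbc, h b d hbd, h c d hcd,
      h' a b c d hab hcd hbc.symm hbd.symm, h' a c b d hac hbd hbc hcd.symm,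
      h' a d b c had hbc hbd hcd]

lemma sum_eqInd_eq_zero {a b : V} (h : G.Adj a b) :
    ∑ f : Col G x, eqInd (f.1 a) (f.1 b) = 0 :=
  sum_eq_zero fun f _ => if_neg (f.2 a b h)

lemma exists_sparsePairCount {D : Finset V} (hD : #D = 4) {β : ℝ}
    (hind : ∀ a b c, a ≠ b → a ≠ c → b ≠ c → G.Adj a b ∨ G.Adj a c ∨ G.Adj b c)
    (h : ∀ a b, a ≠ b → ∑ f : Col G x, eqInd (f.1 a) (f.1 b) < β) :
    ∃ A : Col G x → ℝ, (∀ f, SparsePairCount #(D.image f.1) (A f)) ∧ ∑ f, A f < 4 * β := by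
  classical
  obtain ⟨a, b, c, d, hab, hac, had, hbc, hbd, hcd, rfl⟩ := card_eq_four.1 hD
  have hf (f : Col G x) {a b c : V} (hab : a ≠ b) (hac : a ≠ c) (hbc : b ≠ c) :
      ¬ (f.1 a = f.1 b ∧ f.1 a = f.1 c) := by
    rintro ⟨h1, h2⟩
    rcases hind a b c hab hac hbc with h | h | h
    exacts [f.2 _ _ h h1, f.2 _ _ h h2, f.2 _ _ h (h1.symm.trans h2)]
  have hsum {a b c : V} (hab : a ≠ b) (hac : a ≠ c) (hbc : b ≠ c) :
      ∑ f : Col G x, eqInd (f.1 a) (f.1 b) + ∑ f : Col G x, eqInd (f.1 a) (f.1 c) +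
        ∑ f : Col G x, eqInd (f.1 b) (f.1 c) < 2 * β := by
    rcases hind a b c hab hac hbc with h' | h' | h' <;>
      linarith [sum_eqInd_eq_zero (x := x) h', h a b hab, h a c hac, h b c hbc]
  refine ⟨fun f => eqInd (f.1 a) (f.1 b) + eqInd (f.1 a) (f.1 c) + eqInd (f.1 a) (f.1 d) +
    eqInd (f.1 b) (f.1 c) + eqInd (f.1 b) (f.1 d) + eqInd (f.1 c) (f.1 d), fun f => ?_, ?_⟩
  · simp only [image_insert, image_singleton]
    exact sparsePairCount_four (hf f hab hac hbc) (hf f hab had hbd) (hf f hac had hcd)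
      (hf f hbc hbd hcd)
  · simp only [sum_add_distrib]
    linarith [hsum hab hac hbc, hsum hab had hbd, hsum hac had hcd, hsum hbc hbd hcd]

end Weights

section FourBound

/-- The number of colourings with `y + 1` colours of a graph on `n` vertices obtained from `K₄`
by adding pendant vertices. -/
noncomputable def fourBound (y : ℝ) (n : ℕ) : ℝ := (y + 1) * (y - 1) * (y - 2) * y ^ n / y ^ 3

lemma fourBound_succ (y : ℝ) (n : ℕ) :
    fourBound y (n + 1) = y * fourBound y n := by
  unfold fourBound
  rw [pow_succ]
  ring

lemma fourBound_pos {y : ℝ} (hy : 4 ≤ y) (n : ℕ) : 0 < fourBound y n := by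
  have : 0 < y - 1 := by linarith
  have : 0 < y - 2 := by linarith
  unfold fourBound
  positivity

lemma PairCount.sub_add_le {y A₁ A₂ : ℝ} {k₁ k₂ : ℕ} (h₁ : PairCount k₁ A₁)
    (h₂ : PairCount k₂ A₂) (hy : 4 ≤ y) :
    y - (A₁ + A₂) ≤ (y - 2) * (y - 1) ^ 2 * ((y + 1 - k₁)⁻¹ * (y + 1 - k₂)⁻¹) := by
  obtain ⟨t, ht, rfl⟩ : ∃ t, 0 ≤ t ∧ y = t + 4 := ⟨y - 4, by linarith, by ring⟩
  rcases h₁ with ⟨rfl, rfl⟩ | ⟨rfl, rfl⟩ | ⟨rfl, rfl⟩ <;>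
  rcases h₂ with ⟨rfl, rfl⟩ | ⟨rfl, rfl⟩ | ⟨rfl, rfl⟩ <;>
  · rw [← mul_inv, ← div_eq_mul_inv, le_div_iff₀ (by push_cast; ring_nf; positivity), ← sub_nonneg]
    push_cast
    ring_nf
    positivity

lemma natCard_eq_of_complete_of_critical {V : Type} [Finite V] {G : SimpleGraph V} {m : ℕ}
    (hm : 0 < m) (hG : ∀ u v, u ≠ v → G.Adj u v) (hc : ¬ G.Colorable m)
    (hcrit : ∀ w, ColorableOn G {w}ᶜ m) : Nat.card V = m + 1 := by
  have h1 := card_le_of_not_colorable hc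
  obtain ⟨z⟩ : Nonempty V := (Nat.card_pos_iff.1 (by omega)).1
  obtain ⟨f, hf⟩ := hcrit z
  have h2 : Nat.card ({z}ᶜ : Set V) ≤ Nat.card (Fin m) :=
    Nat.card_le_card_of_injective (fun v => f v) fun u v huv => by
      by_contra hne
      exact hf u u.2 v v.2 (hG u v fun h => hne (Subtype.ext h)) huv
  have h3 := natCard_compl_singleton_add_one z
  rw [Nat.card_fin] at h2
  omega

lemma not_adj_of_mem_pair {V : Type} {G : SimpleGraph V} {a b : V} (hab : ¬ G.Adj a b) :
    ∀ u ∈ ({a, b} : Set V), ∀ v ∈ ({a, b} : Set V), ¬ G.Adj u v := by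
  rintro u (rfl | rfl) v (rfl | rfl)
  exacts [G.irrefl, hab, fun h => hab h.symm, G.irrefl]

lemma not_adj_of_mem_triple {V : Type} {G : SimpleGraph V} {a b c : V} (hab : ¬ G.Adj a b)
    (hac : ¬ G.Adj a c) (hbc : ¬ G.Adj b c) :
    ∀ u ∈ ({a, b, c} : Set V), ∀ v ∈ ({a, b, c} : Set V), ¬ G.Adj u v := by
  rintro u (rfl | rfl | rfl) v (rfl | rfl | rfl)
  exacts [G.irrefl, hab, hac, fun h => hab h.symm, G.irrefl, hbc, fun h => hac h.symm,
    fun h => hbc h.symm, G.irrefl]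

lemma induce_compl_pair {V : Type} [Finite V] {G : SimpleGraph V} {a b : V} {m : ℕ} (hm : 0 < m)
    (hc : ¬ G.Colorable (m + 1)) (hab : a ≠ b) (hadj : ¬ G.Adj a b) (hs : ¬ Splits G {a, b}ᶜ) :
    (G.induce {a, b}ᶜ).Connected ∧ ¬ (G.induce {a, b}ᶜ).Colorable m := by
  have hcard := natCard_compl_pair_add_two hab
  have hn := card_le_of_not_colorable hc
  refine ⟨induce_connected_of_not_splits ?_ hs, fun h => hc ?_⟩
  · exact Set.nonempty_coe_sort.1 (Nat.card_pos_iff.1 (by omega)).1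
  · exact colorable_succ_of_independent (not_adj_of_mem_pair hadj) ((colorableOn_iff hm).2 h)

theorem numColorings_le_fourBound {V : Type} [Finite V] {G : SimpleGraph V} {y : ℕ} (hy : 4 ≤ y)
    (hG : G.Connected) (hc : ¬ G.Colorable 3) :
    (numColorings G (y + 1) : ℝ) ≤ fourBound y (Nat.card V) := by
  obtain ⟨n, hn⟩ : ∃ n, Nat.card V = n := ⟨_, rfl⟩
  have hy4 : (4 : ℝ) ≤ y := by exact_mod_cast hy
  have hy0 : (0 : ℝ) < y := by linarith
  induction n using Nat.strong_induction_on generalizing V with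
  | _ n ih =>
  have hn3 := card_le_of_not_colorable hc
  have := nontrivial_of_one_lt_natCard (V := V) (by omega)
  rcases exists_connected_not_colorable_or hG three_pos (m := 3) with ⟨w, hw, hwc⟩ | hcrit
  · obtain ⟨a, ha⟩ := hG.preconnected.exists_adj_of_nontrivial w
    have hcard := natCard_compl_singleton_add_one w
    have h1 := ih _ (by omega) hw hwc rfl
    rw [← hcard, fourBound_succ]
    exact (numColorings_le_mul_of_adj ha).trans (mul_le_mul_of_nonneg_left h1 hy0.le)
  by_cases hcomp : ∀ u v, u ≠ v → G.Adj u v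
  · have h1 : (numColorings G (y + 1) : ℝ) ≤ _ :=
      Nat.cast_le.2 (numColorings_le_descFactorial (x := y + 1) hcomp)
    rw [natCard_eq_of_complete_of_critical three_pos hcomp hc hcrit] at h1 ⊢
    refine h1.trans (le_of_eq ?_)
    obtain ⟨t, rfl⟩ := Nat.exists_eq_add_of_le' hy
    simp only [Nat.descFactorial, fourBound, Nat.sub_zero, Nat.reduceSubDiff]
    push_cast at hy0 ⊢
    field_simp
    ring
  push Not at hcomp
  have h2 := not_splits_compl_singleton_of_critical hc hcrit
  choose D hDc hD using exists_adj_of_critical hc hcrit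
  obtain ⟨a, b, hab, hadj, hs⟩ := exists_nonadj_pair_not_splits h2 (fun z p q => by
    classical
    obtain ⟨w, hw, hwF⟩ := exists_mem_notMem_of_card_lt_card (s := {p, q}) (t := D z)
      (card_le_two.trans_lt (by rw [hDc]; omega))
    exact ⟨w, hD z w hw, by grind⟩) hcomp
  obtain ⟨hG', hc'⟩ := induce_compl_pair two_pos hc hab hadj hs
  obtain ⟨k, hk⟩ : ∃ k, n = k + 2 := ⟨n - 2, by omega⟩
  have hsum (p q : V) (hpq : p ≠ q) : ∑ f : Col G (y + 1), eqInd (f.1 p) (f.1 q) ≤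
      fourBound y (k + 1) := by
    have hcard := card_ne_add_one q
    refine sum_ite_eq_le hG hc hpq (fourBound_pos hy4 _).le fun _ h h' => ?_
    have hk' : Nat.card {v // v ≠ q} = k + 1 := by omega
    exact hk' ▸ ih _ (by omega) h h' rfl
  choose A hA hAsum using fun u => exists_pairCount (hDc u) hsum
  classical
  have key := mul_numColorings_le (S := {a, b}ᶜ) {a, b} (by simp)
    (by simpa using not_adj_of_mem_pair hadj) hD (A := A) (c := y) (d := (y - 2) * (y - 1) ^ 2)
    (by nlinarith) fun f => by
      rw [sum_pair hab, prod_pair hab]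
      push_cast
      exact (hA a f).sub_add_le (hA b f) hy4
  rw [sum_pair hab] at key
  have h3 := numColorings_le_of_not_colorable_two (y := y) (by omega) hG' hc'
  obtain rfl : Nat.card ({a, b}ᶜ : Set V) = k := by
    have := natCard_compl_pair_add_two hab
    omega
  rw [hn, hk]
  have hy1 : 0 ≤ (y - 1 : ℝ) * (y - 2) * y ^ Nat.card ({a, b}ᶜ : Set V) :=
    mul_nonneg (by nlinarith) (by positivity)
  have h4 := mul_le_mul_of_nonneg_left h3 (show 0 ≤ ((y : ℝ) - 2) * (y - 1) ^ 2 by nlinarith)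
  generalize Nat.card ({a, b}ᶜ : Set V) = k at *
  have h5 : ((y : ℝ) - 2) * (y - 1) ^ 2 * y ^ k + 6 * fourBound y (k + 1) ≤
      y * fourBound y (k + 2) := by
    have h6 : y * fourBound y (k + 2) - (((y : ℝ) - 2) * (y - 1) ^ 2 * y ^ k +
        6 * fourBound y (k + 1)) =
          (y - 1) * (y - 2) * y ^ k * ((2 * y ^ 2 - 6 * (y + 1)) / y ^ 2) := by
      unfold fourBound
      field_simp
      ring
    rw [← sub_nonneg, h6]
    exact mul_nonneg hy1 (div_nonneg (by nlinarith) (by positivity))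
  refine le_of_mul_le_mul_left ?_ hy0
  linarith [hAsum a, hAsum b]

end FourBound

section FiveBound

/-- The number of colourings with `y + 1` colours of a graph on `n` vertices obtained from `K₅`
by adding pendant vertices. -/
noncomputable def fiveBound (y : ℝ) (n : ℕ) : ℝ :=
  (y + 1) * (y - 1) * (y - 2) * (y - 3) * y ^ n / y ^ 4

lemma fiveBound_succ (y : ℝ) (n : ℕ) :
    fiveBound y (n + 1) = y * fiveBound y n := by
  unfold fiveBound
  rw [pow_succ]
  ring

lemma fiveBound_pos {y : ℝ} (hy : 4 ≤ y) (n : ℕ) : 0 < fiveBound y n := by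
  have : 0 < y - 1 := by linarith
  have : 0 < y - 2 := by linarith
  have : 0 < y - 3 := by linarith
  unfold fiveBound
  positivity

lemma MatchingCount.sub_add_le {y M₁ M₂ : ℝ} {k₁ k₂ : ℕ} (h₁ : MatchingCount k₁ M₁)
    (h₂ : MatchingCount k₂ M₂) (hy : 5 ≤ y) :
    2 * y - (M₁ + M₂) ≤ 2 * (y - 1) * (y - 2) ^ 2 * ((y + 1 - k₁)⁻¹ * (y + 1 - k₂)⁻¹) := by
  obtain ⟨t, ht, rfl⟩ : ∃ t, 0 ≤ t ∧ y = t + 5 := ⟨y - 5, by linarith, by ring⟩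
  rcases h₁ with ⟨rfl, rfl⟩ | ⟨rfl, rfl⟩ | ⟨rfl, rfl⟩ | ⟨rfl, rfl⟩ <;>
  rcases h₂ with ⟨rfl, rfl⟩ | ⟨rfl, rfl⟩ | ⟨rfl, rfl⟩ | ⟨rfl, rfl⟩ <;>
  · rw [← mul_inv, ← div_eq_mul_inv, le_div_iff₀ (by push_cast; ring_nf; positivity), ← sub_nonneg]
    push_cast
    ring_nf
    positivity

lemma MatchingCount.sub_add_add_le {M₁ M₂ M₃ : ℝ} {k₁ k₂ k₃ : ℕ} (h₁ : MatchingCount k₁ M₁)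
    (h₂ : MatchingCount k₂ M₂) (h₃ : MatchingCount k₃ M₃) :
    11 - (M₁ + (M₂ + M₃)) ≤ 72 * ((5 - k₁ : ℝ)⁻¹ * ((5 - k₂ : ℝ)⁻¹ * (5 - k₃ : ℝ)⁻¹)) := by
  rcases h₁ with ⟨rfl, rfl⟩ | ⟨rfl, rfl⟩ | ⟨rfl, rfl⟩ | ⟨rfl, rfl⟩ <;>
  rcases h₂ with ⟨rfl, rfl⟩ | ⟨rfl, rfl⟩ | ⟨rfl, rfl⟩ | ⟨rfl, rfl⟩ <;>
  rcases h₃ with ⟨rfl, rfl⟩ | ⟨rfl, rfl⟩ | ⟨rfl, rfl⟩ | ⟨rfl, rfl⟩ <;>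
  norm_num

lemma SparsePairCount.sub_add_le {A₁ A₂ : ℝ} {k₁ k₂ : ℕ} (h₁ : SparsePairCount k₁ A₁)
    (h₂ : SparsePairCount k₂ A₂) :
    5 - (A₁ + A₂) ≤ 12 * ((5 - k₁ : ℝ)⁻¹ * (5 - k₂ : ℝ)⁻¹) := by
  rcases h₁ with ⟨rfl, rfl⟩ | ⟨rfl, rfl⟩ | ⟨rfl, rfl⟩ <;>
  rcases h₂ with ⟨rfl, rfl⟩ | ⟨rfl, rfl⟩ | ⟨rfl, rfl⟩ <;>
  norm_num

lemma exists_adj_ne_ne_ne {V : Type} {G : SimpleGraph V} (hc : ¬ G.Colorable 4)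
    (hcrit : ∀ w, ColorableOn G {w}ᶜ 4)
    (z p q r : V) : ∃ w, G.Adj z w ∧ w ≠ p ∧ w ≠ q ∧ w ≠ r := by
  classical
  obtain ⟨D, hDc, hD⟩ := exists_adj_of_critical hc hcrit z
  obtain ⟨w, hw, hwF⟩ := exists_mem_notMem_of_card_lt_card (s := {p, q, r}) (t := D)
    (card_le_three.trans_lt (by rw [hDc]; omega))
  exact ⟨w, hD w hw, by grind⟩

variable {V : Type} [Finite V] {G : SimpleGraph V} {y : ℕ}

/-- `fiveBound` bounds the number of colourings of every connected graph with fewer than `n`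
vertices that is not `4`-colourable. -/
def FiveBoundBelow (y n : ℕ) : Prop :=
  ∀ (W : Type) [Finite W] (H : SimpleGraph W), Nat.card W < n → H.Connected → ¬ H.Colorable 4 →
    (numColorings H (y + 1) : ℝ) ≤ fiveBound y (Nat.card W)

lemma FiveBoundBelow.sum_eqInd_le {k : ℕ} (hy : 4 ≤ y) (hb : FiveBoundBelow y (k + 2))
    (hk : Nat.card V = k + 2) (hG : G.Connected) (hc : ¬ G.Colorable 4) {a b : V} (hab : a ≠ b) :
    ∑ f : Col G (y + 1), eqInd (f.1 a) (f.1 b) ≤ fiveBound y (k + 1) := by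
  have hcard := card_ne_add_one b
  have hk' : Nat.card {v // v ≠ b} = k + 1 := by omega
  refine sum_ite_eq_le hG hc hab (fiveBound_pos (by exact_mod_cast hy) _).le fun _ h h' => ?_
  exact hk' ▸ hb _ _ (by omega) h h'

lemma FiveBoundBelow.exists_matchingCount {k : ℕ} (hy : 4 ≤ y) (hb : FiveBoundBelow y (k + 2))
    (hk : Nat.card V = k + 2) (hG : G.Connected) (hc : ¬ G.Colorable 4) {D : Finset V}
    (hD : #D = 4) :
    ∃ M : Col G (y + 1) → ℝ, (∀ f, MatchingCount #(D.image f.1) (M f)) ∧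
      ∑ f, M f ≤ 6 * fiveBound y (k + 1) + 3 * fiveBound y k := by
  refine _root_.exists_matchingCount hD (fun a b hab => hb.sum_eqInd_le hy hk hG hc hab)
    fun a b c d hab hcd hcb hdb => ?_
  refine sum_ite_eq_and_eq_le hG hc hab hcd hcb hdb
    (fiveBound_pos (by exact_mod_cast hy) _).le fun W _ H hW h h' => ?_
  have hk' : Nat.card W = k := by omega
  exact hk' ▸ hb _ _ (by omega) h h'

/-- The bound is not attained by a non-complete `5`-critical graph if there are at least six
colours. -/
lemma FiveBoundBelow.lt_of_five_le {k : ℕ} (hy : 5 ≤ y) (hb : FiveBoundBelow y (k + 2))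
    (hk : Nat.card V = k + 2) (hG : G.Connected) (hc : ¬ G.Colorable 4)
    (hcrit : ∀ w, ColorableOn G {w}ᶜ 4) (hcomp : ∃ a b, a ≠ b ∧ ¬ G.Adj a b) :
    (numColorings G (y + 1) : ℝ) < fiveBound y (k + 2) := by
  classical
  have hy5 : (5 : ℝ) ≤ y := by exact_mod_cast hy
  have hy0 : (0 : ℝ) < y := by linarith
  have h2 := not_splits_compl_singleton_of_critical hc hcrit
  choose D hDc hD using exists_adj_of_critical hc hcrit
  obtain ⟨a, b, hab, hadj, hs⟩ := exists_nonadj_pair_not_splits h2 (fun z p q => by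
    obtain ⟨w, hw, hp, hq, -⟩ := exists_adj_ne_ne_ne hc hcrit z p q q
    exact ⟨w, hw, hp, hq⟩) hcomp
  obtain ⟨hG', hc'⟩ := induce_compl_pair three_pos hc hab hadj hs
  choose M hM hMsum using fun u => hb.exists_matchingCount (by omega) hk hG hc (hDc u)
  have key := mul_numColorings_le (S := {a, b}ᶜ) {a, b} (by simp)
    (by simpa using not_adj_of_mem_pair hadj) hD (A := M) (c := 2 * y)
    (d := 2 * (y - 1) * (y - 2) ^ 2) (by nlinarith [sq_nonneg ((y : ℝ) - 2)]) fun f => by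
      rw [sum_pair hab, prod_pair hab]
      push_cast
      exact (hM a f).sub_add_le (hM b f) hy5
  rw [sum_pair hab] at key
  have h3 := numColorings_le_fourBound (y := y) (by omega) hG' hc'
  have hk' : Nat.card ({a, b}ᶜ : Set V) = k := by
    have := natCard_compl_pair_add_two hab
    omega
  rw [hk'] at h3
  have h4 := mul_le_mul_of_nonneg_left h3
    (show 0 ≤ 2 * ((y : ℝ) - 1) * (y - 2) ^ 2 by nlinarith [sq_nonneg ((y : ℝ) - 2)])
  have h5 : 2 * ((y : ℝ) - 1) * (y - 2) ^ 2 * fourBound y k +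
      2 * (6 * fiveBound y (k + 1) + 3 * fiveBound y k) < 2 * y * fiveBound y (k + 2) := by
    have h6 : 2 * y * fiveBound y (k + 2) - (2 * ((y : ℝ) - 1) * (y - 2) ^ 2 * fourBound y k +
        2 * (6 * fiveBound y (k + 1) + 3 * fiveBound y k)) =
        fourBound y k * ((4 * y ^ 3 - 28 * y ^ 2 + 38 * y + 18) / y) := by
      unfold fourBound fiveBound
      field_simp
      ring
    rw [← sub_pos, h6]
    refine mul_pos (fourBound_pos (by linarith) k) (div_pos ?_ hy0)
    obtain ⟨t, ht, hyt⟩ : ∃ t, 0 ≤ t ∧ (y : ℝ) = t + 5 := ⟨y - 5, by linarith, by ring⟩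
    rw [hyt]
    ring_nf
    positivity
  refine lt_of_mul_lt_mul_left ?_ (show (0 : ℝ) ≤ 2 * y by positivity)
  linarith [hMsum a, hMsum b]

/-- The part outside a good triple has few colourings with five colours. -/
lemma numColorings_induce_goodTriple_le {k : ℕ} (hk : Nat.card V = k + 3)
    (hc : ¬ G.Colorable 4) {p q r : V} (hT : IsGoodTriple G p q r) :
    (numColorings (G.induce {p, q, r}ᶜ) 5 : ℝ) ≤ 5 / 64 * fiveBound 4 (k + 3) := by
  obtain ⟨hpq, hpr, hqr, npq, npr, nqr, hT⟩ := hT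
  have hcard := natCard_compl_triple_add_three hpq hpr hqr
  have hn := card_le_of_not_colorable hc
  have hnc : ¬ ColorableOn G {p, q, r}ᶜ 3 := fun h => hc
    (colorable_succ_of_independent (not_adj_of_mem_triple npq npr nqr) h)
  have four {C : Set V} (hC : ¬ Splits G C) (hC0 : C.Nonempty) (h : ¬ ColorableOn G C 3) :
      (numColorings (G.induce C) 5 : ℝ) ≤ fourBound 4 (Nat.card C) := by
    exact_mod_cast numColorings_le_fourBound (y := 4) le_rfl (induce_connected_of_not_splits hC0 hC)
      fun h' => h ((colorableOn_iff three_pos).2 h')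
  rcases hT with hT | ⟨C, D, hC0, hD0, hsep, hC, hD⟩
  · refine (four hT (Set.nonempty_coe_sort.1 (Nat.card_pos_iff.1 (by omega)).1) hnc).trans ?_
    have hk' : Nat.card ({p, q, r}ᶜ : Set V) = k := by omega
    rw [hk', fourBound, fiveBound, pow_add]
    have : (0 : ℝ) < 4 ^ k := by positivity
    linarith
  · have conn {C : Set V} (hC : ¬ Splits G C) (hC0 : C.Nonempty) :
        (numColorings (G.induce C) 5 : ℝ) ≤ 5 * 4 ^ Nat.card C / 4 := by
      have := numColorings_le_of_connected (y := 4) (by omega)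
        (induce_connected_of_not_splits hC0 hC)
      norm_num at this ⊢
      exact this
    have hCD : Nat.card C + Nat.card D = k := by
      have h1 : ({p, q, r}ᶜ : Set V) = C ∪ D := Set.ext hsep.cover
      have h2 := Set.ncard_union_eq (Set.disjoint_left.2 hsep.disj)
      rw [← h1] at h2
      simp only [Nat.card_coe_set_eq] at hcard ⊢
      omega
    have hmul : (numColorings (G.induce {p, q, r}ᶜ) 5 : ℝ) ≤
        numColorings (G.induce C) 5 * numColorings (G.induce D) 5 := by
      exact_mod_cast numColorings_induce_le_mul (fun v hv => (hsep.cover v).2 (Or.inl hv))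
        (fun v hv => (hsep.cover v).2 (Or.inr hv)) fun v hv => (hsep.cover v).1 hv
    have hk4 : (5 : ℝ) / 64 * fiveBound 4 (k + 3) =
        fourBound 4 (Nat.card C) * (5 * 4 ^ Nat.card D / 4) ∧ (5 : ℝ) / 64 * fiveBound 4 (k + 3) =
        (5 * 4 ^ Nat.card C / 4) * fourBound 4 (Nat.card D) := by
      rw [← hCD, fourBound, fourBound, fiveBound, pow_add, pow_add]
      constructor <;> ring
    by_cases h : ColorableOn G C 3
    · have h' : ¬ ColorableOn G D 3 := fun h' => hnc (.of_separation hsep h h')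
      rw [hk4.2]
      exact hmul.trans (mul_le_mul (conn hC hC0) (four hD hD0 h') (by positivity) (by positivity))
    · rw [hk4.1]
      exact hmul.trans (mul_le_mul (four hC hC0 h) (conn hD hD0) (by positivity)
        (fourBound_pos le_rfl _).le)

/-- The bound is not attained by a `5`-critical graph with an independent triple if there are
five colours. -/
lemma FiveBoundBelow.lt_of_triple {k : ℕ} (hb : FiveBoundBelow 4 (k + 2))
    (hk : Nat.card V = k + 2) (hG : G.Connected) (hc : ¬ G.Colorable 4)
    (hcrit : ∀ w, ColorableOn G {w}ᶜ 4) {a b c : V} (hab : a ≠ b) (hac : a ≠ c) (hbc : b ≠ c)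
    (nab : ¬ G.Adj a b) (nac : ¬ G.Adj a c) (nbc : ¬ G.Adj b c) :
    (numColorings G 5 : ℝ) < fiveBound 4 (k + 2) := by
  classical
  choose D hDc hD using exists_adj_of_critical hc hcrit
  obtain ⟨p, q, r, hT⟩ := exists_isGoodTriple (not_splits_compl_singleton_of_critical hc hcrit)
    (exists_adj_ne_ne_ne hc hcrit) hab hac hbc nab nac nbc
  obtain ⟨hpq, hpr, hqr, npq, npr, nqr, -⟩ := id hT
  choose M hM hMsum using fun u => hb.exists_matchingCount (G := G) le_rfl hk hG hc (hDc u)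
  have key := mul_numColorings_le (x := 5) (S := {p, q, r}ᶜ) {p, q, r} (by simp)
    (by simpa using not_adj_of_mem_triple npq npr nqr) hD (A := M) (c := 11) (d := 72)
    (by norm_num) fun f => by
      rw [sum_insert (by simp [*]), sum_pair hqr, prod_insert (by simp [*]), prod_pair hqr]
      exact (hM p f).sub_add_add_le (hM q f) (hM r f)
  rw [sum_insert (by simp [*]), sum_pair hqr] at key
  have hn := card_le_of_not_colorable hc
  obtain ⟨l, rfl⟩ : ∃ l, k = l + 1 := ⟨k - 1, by omega⟩
  have h3 := numColorings_induce_goodTriple_le (k := l) hk hc hT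
  have h4 := fiveBound_pos (le_refl 4) (l + 1)
  have h5 := fiveBound_succ 4 (l + 1)
  have h6 := fiveBound_succ 4 (l + 2)
  have h7 := hMsum p
  have h8 := hMsum q
  have h9 := hMsum r
  push_cast at h7 h8 h9
  linarith

/-- The bound is not attained by a `5`-critical graph without independent triples if there are
five colours and every pair of vertices agrees in few colourings. -/
lemma lt_fiveBound_of_no_triple {k : ℕ} (hk : Nat.card V = k + 2) (hc : ¬ G.Colorable 4)
    (hcrit : ∀ w, ColorableOn G {w}ᶜ 4) (hcomp : ∃ a b, a ≠ b ∧ ¬ G.Adj a b)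
    (hind : ∀ a b c, a ≠ b → a ≠ c → b ≠ c → G.Adj a b ∨ G.Adj a c ∨ G.Adj b c)
    (hsum : ∀ a b, a ≠ b → ∑ f : Col G 5, eqInd (f.1 a) (f.1 b) < fiveBound 4 (k + 1)) :
    (numColorings G 5 : ℝ) < fiveBound 4 (k + 2) := by
  classical
  have h2 := not_splits_compl_singleton_of_critical hc hcrit
  choose D hDc hD using exists_adj_of_critical hc hcrit
  obtain ⟨a, b, hab, hadj, hs⟩ := exists_nonadj_pair_not_splits h2 (fun z p q => by
    obtain ⟨w, hw, hp, hq, -⟩ := exists_adj_ne_ne_ne hc hcrit z p q q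
    exact ⟨w, hw, hp, hq⟩) hcomp
  obtain ⟨hG', hc'⟩ := induce_compl_pair three_pos hc hab hadj hs
  choose A hA hAsum using fun u => exists_sparsePairCount (hDc u) hind hsum
  have key := mul_numColorings_le (x := 5) (S := {a, b}ᶜ) {a, b} (by simp)
    (by simpa using not_adj_of_mem_pair hadj) hD (A := A) (c := 5) (d := 12) (by norm_num)
    fun f => by
      rw [sum_pair hab, prod_pair hab]
      exact (hA a f).sub_add_le (hA b f)
  rw [sum_pair hab] at key
  have h3 := numColorings_le_fourBound (y := 4) le_rfl hG' hc'
  have hk' : Nat.card ({a, b}ᶜ : Set V) = k := by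
    have := natCard_compl_pair_add_two hab
    omega
  have h4 : fiveBound 4 (k + 2) = 4 * fourBound 4 k := by
    unfold fourBound fiveBound
    ring
  have h5 := fiveBound_succ 4 (k + 1)
  rw [hk'] at h3
  push_cast at h3
  linarith [hAsum a, hAsum b]

/-- Some vertex has at most one neighbour. -/
def HasLeaf {V : Type} (G : SimpleGraph V) : Prop :=
  ∃ z, ∀ p q, G.Adj z p → G.Adj z q → p = q

lemma not_hasLeaf_mergeGraph {V : Type} {G : SimpleGraph V} (hc : ¬ G.Colorable 4)
    (hcrit : ∀ w, ColorableOn G {w}ᶜ 4) (p q : V) : ¬ HasLeaf (mergeGraph G p q) := by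
  rintro ⟨z, hz⟩
  obtain ⟨u, hu, huq, -⟩ := exists_adj_ne_ne_ne hc hcrit z q q q
  obtain ⟨v, hv, hvq, hvu, -⟩ := exists_adj_ne_ne_ne hc hcrit z q u u
  have h := hz ⟨u, huq⟩ ⟨v, hvq⟩ ⟨fun h => hu.ne (congrArg Subtype.val h), Or.inl hu⟩
    ⟨fun h => hv.ne (congrArg Subtype.val h), Or.inl hv⟩
  exact hvu (congrArg Subtype.val h).symm

lemma adj_of_critical_of_natCard_eq_six (h6 : Nat.card V = 6) (hc : ¬ G.Colorable 4)
    (hcrit : ∀ w, ColorableOn G {w}ᶜ 4) {p q : V} (hpq : p ≠ q) : G.Adj p q := by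
  classical
  by_contra hadj
  have := Fintype.ofFinite V
  obtain ⟨D, hDc, hD⟩ := exists_adj_of_critical hc hcrit q
  have hp : p ∉ insert q D := by
    rw [mem_insert]
    rintro (h | h)
    exacts [hpq h, hadj (hD p h).symm]
  have hq : q ∉ D := fun h => G.irrefl (hD q h)
  have huniv : insert p (insert q D) = univ := by
    rw [← card_eq_iff_eq_univ, card_insert_of_notMem hp, card_insert_of_notMem hq, hDc,
      ← Nat.card_eq_fintype_card, h6]
  have hmem (v : V) (h1 : v ≠ p) (h2 : v ≠ q) : G.Adj q v := by
    have := mem_univ v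
    rw [← huniv, mem_insert, mem_insert] at this
    exact hD v (by tauto)
  obtain ⟨f, hf⟩ := hcrit p
  have key (v : V) (h : G.Adj p v) : f q ≠ f v := by
    have h1 : v ≠ q := fun h' => hadj (h' ▸ h)
    exact hf q hpq.symm v h.ne.symm (hmem v h.ne.symm h1)
  refine hc (colorable_iff_exists.2 ⟨fun v => if v = p then f q else f v, fun u v huv => ?_⟩)
  by_cases hu : u = p <;> by_cases hv : v = p <;> simp only [hu, hv, if_true, if_false]
  · exact absurd (hu.trans hv.symm) huv.ne
  · exact key v (hu ▸ huv)
  · exact (key u (hv ▸ huv.symm)).symm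
  · exact hf u hu v hv huv

lemma sum_eqInd_lt_fiveBound {k : ℕ} (hy : 4 ≤ y) (hb : FiveBoundBelow y (k + 2))
    (heq : ∀ (W : Type) [Finite W] (H : SimpleGraph W), Nat.card W < k + 2 → H.Connected →
      ¬ H.Colorable 4 → (numColorings H (y + 1) : ℝ) = fiveBound y (Nat.card W) →
        Nat.card W = 5 ∨ HasLeaf H)
    (hk : Nat.card V = k + 2) (hG : G.Connected) (hc : ¬ G.Colorable 4)
    (hcrit : ∀ w, ColorableOn G {w}ᶜ 4) {p q : V} (hpq : p ≠ q) :
    ∑ f : Col G (y + 1), eqInd (f.1 p) (f.1 q) < fiveBound y (k + 1) := by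
  by_cases hadj : G.Adj p q
  · rw [sum_eqInd_eq_zero hadj]
    exact fiveBound_pos (by exact_mod_cast hy) _
  have hcard := card_ne_add_one q
  have hk' : Nat.card {v // v ≠ q} = k + 1 := by omega
  have hG' := mergeGraph_connected hG hpq
  have hc' := not_colorable_mergeGraph hc hpq hadj
  have h1 : ∑ f : Col G (y + 1), eqInd (f.1 p) (f.1 q) ≤
      numColorings (mergeGraph G p q) (y + 1) :=
    sum_ite_eq_le hG hc hpq (Nat.cast_nonneg _) fun _ _ _ => le_rfl
  refine h1.trans_lt (lt_of_le_of_ne (hk' ▸ hb _ _ (by omega) hG' hc') fun h => ?_)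
  rcases heq _ _ (by omega) hG' hc' (hk'.symm ▸ h) with h5 | hleaf
  · exact hadj (adj_of_critical_of_natCard_eq_six (by omega) hc hcrit hpq)
  · exact not_hasLeaf_mergeGraph hc hcrit p q hleaf

theorem numColorings_le_fiveBound {V : Type} [Finite V] {G : SimpleGraph V} (hy : 4 ≤ y)
    (hG : G.Connected) (hc : ¬ G.Colorable 4) :
    (numColorings G (y + 1) : ℝ) ≤ fiveBound y (Nat.card V) ∧
      ((numColorings G (y + 1) : ℝ) = fiveBound y (Nat.card V) → Nat.card V = 5 ∨ HasLeaf G) := by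
  classical
  obtain ⟨n, hn⟩ : ∃ n, Nat.card V = n := ⟨_, rfl⟩
  have hy4 : (4 : ℝ) ≤ y := by exact_mod_cast hy
  have hy0 : (0 : ℝ) < y := by linarith
  induction n using Nat.strong_induction_on generalizing V with
  | _ n ih =>
  have hn4 := card_le_of_not_colorable hc
  obtain ⟨k, rfl⟩ : ∃ k, n = k + 2 := ⟨n - 2, by omega⟩
  have hb : FiveBoundBelow y (k + 2) := fun W _ H hW h h' => (ih _ hW h h' rfl).1
  have := nontrivial_of_one_lt_natCard (V := V) (by omega)
  rcases exists_connected_not_colorable_or hG four_pos (m := 4) with ⟨w, hw, hwc⟩ | hcrit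
  · obtain ⟨a, ha⟩ := hG.preconnected.exists_adj_of_nontrivial w
    have hcard := natCard_compl_singleton_add_one w
    have hk : Nat.card ({w}ᶜ : Set V) = k + 1 := by omega
    have h1 := hb _ _ (by omega) hw hwc
    rw [hk] at h1
    refine ⟨(numColorings_le_mul_of_adj ha).trans ?_, fun heq => Or.inr ⟨w, fun p q hp hq => ?_⟩⟩
    · rw [hn, fiveBound_succ]
      exact mul_le_mul_of_nonneg_left h1 hy0.le
    · by_contra hpq
      have hpq' : (⟨p, hp.ne.symm⟩ : ({w}ᶜ : Set V)) ≠ ⟨q, hq.ne.symm⟩ :=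
        fun h => hpq (congrArg Subtype.val h)
      have h2 := numColorings_le_of_adj_adj hp hq (y := y) (by omega)
      have h3 := sum_ite_eq_le (x := y + 1) hw hwc hpq' (fiveBound_pos hy4 k).le fun _ h h' => by
        have hk' : Nat.card {v : ({w}ᶜ : Set V) // v ≠ ⟨q, hq.ne.symm⟩} = k :=
          Nat.succ_injective ((card_ne_add_one (V := ({w}ᶜ : Set V)) _).trans hk)
        exact hk' ▸ hb _ _ (by omega) h h'
      have h4 := mul_le_mul_of_nonneg_left h1 (show 0 ≤ (y : ℝ) - 1 by linarith)
      have h5 := fiveBound_pos hy4 k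
      rw [heq, hn] at h2
      rw [fiveBound_succ, fiveBound_succ] at *
      nlinarith
  by_cases hcomp : ∀ u v, u ≠ v → G.Adj u v
  · have h5 := natCard_eq_of_complete_of_critical four_pos hcomp hc hcrit
    refine ⟨?_, fun _ => Or.inl h5⟩
    have h1 : (numColorings G (y + 1) : ℝ) ≤ _ :=
      Nat.cast_le.2 (numColorings_le_descFactorial (x := y + 1) hcomp)
    rw [h5] at h1 ⊢
    refine h1.trans (le_of_eq ?_)
    obtain ⟨t, rfl⟩ := Nat.exists_eq_add_of_le' hy
    simp only [Nat.descFactorial, fiveBound, Nat.sub_zero, Nat.reduceSubDiff]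
    push_cast at hy0 ⊢
    field_simp
    ring
  push Not at hcomp
  suffices h : (numColorings G (y + 1) : ℝ) < fiveBound y (Nat.card V) from
    ⟨h.le, fun h' => absurd h' h.ne⟩
  rw [hn]
  rcases hy.eq_or_lt with rfl | hy5
  · push_cast
    by_cases hind : ∀ a b c, a ≠ b → a ≠ c → b ≠ c → G.Adj a b ∨ G.Adj a c ∨ G.Adj b c
    · exact lt_fiveBound_of_no_triple hn hc hcrit hcomp hind fun a b hab =>
        sum_eqInd_lt_fiveBound le_rfl hb (fun W _ H hW h h' => (ih _ hW h h' rfl).2) hn hG hc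
          hcrit hab
    · push Not at hind
      obtain ⟨a, b, c, hab, hac, hbc, nab, nac, nbc⟩ := hind
      exact hb.lt_of_triple hn hG hc hcrit hab hac hbc nab nac nbc
  · exact hb.lt_of_five_le hy5 hn hG hc hcrit hcomp

end FiveBound

section Pendants

variable {V : Type} {G : SimpleGraph V} {k : ℕ}

lemma obtainedFromCliqueByPendants_of_complete (hk : Nat.card V = k) (hk0 : 0 < k)
    (hG : ∀ u v, u ≠ v → G.Adj u v) : ObtainedFromCliqueByPendants G k := by
  have : Finite V := (Nat.card_pos_iff.1 (hk ▸ hk0)).2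
  refine ⟨k, id, le_rfl, fun i h h' => absurd h' h.not_gt, ⟨Finite.equivFinOfCardEq hk, ?_⟩⟩
  intro u v
  simp only [SimpleGraph.fromRel_adj, Fin.is_lt, true_and, ne_eq, EmbeddingLike.apply_eq_iff_eq]
  exact ⟨fun h => hG u v h.1, fun h => ⟨h.ne, Or.inl (Or.inl h.ne)⟩⟩

lemma ObtainedFromCliqueByPendants.of_induce {z a : V} (ha : G.Adj z a)
    (huniq : ∀ w, G.Adj z w → w = a) (h : ObtainedFromCliqueByPendants (G.induce {z}ᶜ) k) :
    ObtainedFromCliqueByPendants G k := by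
  classical
  obtain ⟨n, p, hkn, hp, ⟨e⟩⟩ := h
  let a' : ({z}ᶜ : Set V) := ⟨a, ha.ne.symm⟩
  let φ (v : V) : Fin (n + 1) := if h : v = z then Fin.last n else (e ⟨v, h⟩).castSucc
  have hφz : φ z = Fin.last n := dif_pos rfl
  have hφ (v : V) (h : v ≠ z) : φ v = (e ⟨v, h⟩).castSucc := dif_neg h
  have hinj : Function.Injective φ := by
    intro u v huv
    by_cases hu : u = z <;> by_cases hv : v = z
    · rw [hu, hv]
    · rw [hu, hφz, hφ v hv] at huv
      exact absurd huv.symm (Fin.castSucc_ne_last _)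
    · rw [hv, hφz, hφ u hu] at huv
      exact absurd huv (Fin.castSucc_ne_last _)
    · rw [hφ u hu, hφ v hv] at huv
      exact congrArg Subtype.val (e.injective (Fin.castSucc_injective n huv))
  have hsurj : Function.Surjective φ := by
    intro i
    induction i using Fin.lastCases with
    | last => exact ⟨z, hφz⟩
    | cast i => exact ⟨e.symm i, by rw [hφ _ (e.symm i).2]; simp⟩
  have hbij : Function.Bijective φ := ⟨hinj, hsurj⟩
  have hz (v : V) (hv : v ≠ z) : G.Adj z v ↔ (e a').val = (e ⟨v, hv⟩).val := by
    rw [Fin.val_inj, e.injective.eq_iff, Subtype.ext_iff]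
    exact ⟨fun h => (huniq v h).symm, fun h => (show a = v from h) ▸ ha⟩
  refine ⟨n + 1, fun i => if i = n then (e a').val else p i, by omega, fun i h h' => ?_,
    ⟨Equiv.ofBijective φ hbij, ?_⟩⟩
  · dsimp only
    split_ifs with hi
    · exact hi ▸ (e a').2
    · exact hp i h (by omega)
  · intro u v
    have hlt (w : ({z}ᶜ : Set V)) : (e w).val < n := (e w).2
    simp only [Equiv.ofBijective_apply, SimpleGraph.fromRel_adj, hinj.ne_iff]
    by_cases hu : u = z <;> by_cases hv : v = z
    · simp [hu, hv]
    · have := hlt ⟨v, hv⟩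
      have := hlt a'
      subst hu
      rw [hz v hv, hφz, hφ v hv]
      grind
    · have := hlt ⟨u, hu⟩
      have := hlt a'
      subst hv
      rw [G.adj_comm, hz u hu, hφz, hφ u hu]
      grind
    · have h1 := e.map_rel_iff (a := ⟨u, hu⟩) (b := ⟨v, hv⟩)
      have := hlt ⟨u, hu⟩
      have := hlt ⟨v, hv⟩
      have h2 : (G.induce {z}ᶜ).Adj ⟨u, hu⟩ ⟨v, hv⟩ ↔ G.Adj u v := Iff.rfl
      rw [← h2, ← h1, SimpleGraph.fromRel_adj, hφ u hu, hφ v hv]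
      simp only [Fin.val_castSucc, e.injective.ne_iff]
      grind

end Pendants

section Equality

variable {V : Type} {G : SimpleGraph V}

lemma adj_of_natCard_eq_succ [Finite V] {m : ℕ} (hn : Nat.card V = m + 1)
    (hc : ¬ G.Colorable m) {u v : V} (huv : u ≠ v) : G.Adj u v := by
  classical
  by_contra hadj
  have hcard := card_ne_add_one v
  have := card_le_of_not_colorable (not_colorable_mergeGraph hc huv hadj)
  omega

theorem obtainedFromCliqueByPendants_of_eq_fiveBound [Finite V] {y : ℕ} (hy : 4 ≤ y)
    (hG : G.Connected) (hc : ¬ G.Colorable 4)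
    (h : (numColorings G (y + 1) : ℝ) = fiveBound y (Nat.card V)) :
    ObtainedFromCliqueByPendants G 5 := by
  obtain ⟨n, hn⟩ : ∃ n, Nat.card V = n := ⟨_, rfl⟩
  induction n generalizing V with
  | zero =>
    have := card_le_of_not_colorable hc
    omega
  | succ n ih =>
    have hn4 := card_le_of_not_colorable hc
    by_cases h5 : Nat.card V = 5
    · exact obtainedFromCliqueByPendants_of_complete h5 (by omega)
        fun u v huv => adj_of_natCard_eq_succ h5 hc huv
    obtain ⟨z, hz⟩ := ((numColorings_le_fiveBound hy hG hc).2 h).resolve_left h5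
    have := nontrivial_of_one_lt_natCard (V := V) (by omega)
    obtain ⟨a, ha⟩ := hG.preconnected.exists_adj_of_nontrivial z
    have huniq (w : V) (hw : G.Adj z w) : w = a := hz w a hw ha
    have hcard := natCard_compl_singleton_add_one z
    have hG' : (G.induce {z}ᶜ).Connected := by
      have := Fintype.ofFinite (G.neighborSet z)
      exact hG.induce_compl_singleton_of_degree_eq_one
        (SimpleGraph.degree_eq_one_iff_existsUnique_adj.2 ⟨a, ha, huniq⟩)
    have hc' : ¬ (G.induce {z}ᶜ).Colorable 4 := by
      classical
      rw [colorable_iff_exists] at hc ⊢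
      rintro ⟨f, hf⟩
      refine hc ⟨fun v => if h : v = z then f ⟨a, ha.ne.symm⟩ + 1 else f ⟨v, h⟩, fun u v huv => ?_⟩
      by_cases hu : u = z <;> by_cases hv : v = z
      · exact absurd (hu.trans hv.symm) huv.ne
      · obtain rfl := huniq v (hu ▸ huv)
        simp [hu, hv]
      · obtain rfl := huniq u (hv ▸ huv.symm)
        simp [hu, hv]
      · simpa [hu, hv] using hf ⟨u, hu⟩ ⟨v, hv⟩ huv
    have hle := (numColorings_le_fiveBound hy hG' hc').1
    have hge := numColorings_le_mul_of_adj ha (y := y)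
    rw [h, ← hcard, fiveBound_succ] at hge
    exact .of_induce ha huniq (ih hG' hc' (le_antisymm hle (le_of_mul_le_mul_left hge
      (by positivity))) (by omega))

end Equality

end

/-- If a connected graph `G` on `n` vertices with chromatic number exactly `5` satisfies
`Q_G(y) = (y+1)·y^(n-4)·(y-1)·(y-2)·(y-3)` for some integer `y ≥ 4`, then `G` is obtained
from `K_5` by repeatedly adding pendant vertices. -/
theorem tomescu_five_chromatic_equality {V : Type} [Fintype V] (G : SimpleGraph V)
    (hconn : G.Connected) (hchrom : G.chromaticNumber = 5)
    (h : ∃ y : ℕ, 4 ≤ y ∧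
      numColorings G (y + 1) =
        (y + 1) * y ^ (Fintype.card V - 4) * (y - 1) * (y - 2) * (y - 3)) :
    ObtainedFromCliqueByPendants G 5 := by
  have hc : ¬ G.Colorable 4 := fun h4 => by
    have := h4.chromaticNumber_le
    rw [hchrom] at this
    exact absurd this (by decide)
  obtain ⟨y, hy, hQ⟩ := h
  refine obtainedFromCliqueByPendants_of_eq_fiveBound hy hconn hc ?_
  have hn := card_le_of_not_colorable hc
  obtain ⟨k, hk⟩ : ∃ k, Fintype.card V = k + 4 :=
    Nat.exists_eq_add_of_le' (by rw [← Nat.card_eq_fintype_card]; omega)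
  obtain ⟨t, rfl⟩ := Nat.exists_eq_add_of_le' hy
  have hQ' : numColorings G (t + 4 + 1) =
      (t + 4 + 1) * (t + 4) ^ k * (t + 3) * (t + 2) * (t + 1) := by
    rw [hQ, hk]
    congr
  rw [hQ', Nat.card_eq_fintype_card, hk, fiveBound, pow_add]
  push_cast
  field_simp
  ring
end
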